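/- Let I_i = [e^{−4βi−2β}, e^{−4βi−β}]. There exists an absolute constant β₀ such that for β > β₀: if λ ∈ I_i, then for every integer j ≠ i (with i, j ≥ 0) the elementary free energies satisfy f^el_i − f^el_j ≥ e^{−4β·min(i, j+1) − 3β}. -/

import Mathlib

open scoped BigOperators
open Filter

noncomputable section

attribute [local instance] Classical.propDecidable

/-! ### Basic geometry of the square lattice -/

/-- Sites of the square lattice `ℤ²`. -/
abbrev Site := ℤ × ℤ

/-- The four unit directions. -/
def dirs : Finset Site := {(1, 0), (-1, 0), (0, 1), (0, -1)}

/-- The box `Λ_n = ⟦-n/2, n/2⟧² ∩ ℤ²`. -/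
def box (n : ℕ) : Finset Site :=
  Finset.Icc (-((n : ℤ) / 2)) ((n : ℤ) / 2) ×ˢ Finset.Icc (-((n : ℤ) / 2)) ((n : ℤ) / 2)

/-- SOS gradient energy of a height function on a domain `V`: each nearest-neighbour
edge with at least one endpoint in `V` contributes the absolute height gradient
(the directed sum below counts internal edges twice, whence the factor `1/2`). -/
def sosEnergy (V : Finset Site) (ψ : Site → ℤ) : ℝ :=
  ∑ v ∈ V, ∑ d ∈ dirs,
    (if v + d ∈ V then (1 : ℝ) / 2 else 1) * |(ψ v : ℝ) - (ψ (v + d) : ℝ)|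

/-- The bulk field term `Σ_{v ∈ V} ψ_v`. -/
def sosField (V : Finset Site) (ψ : Site → ℤ) : ℝ := ∑ v ∈ V, (ψ v : ℝ)

/-- The SOS weight `exp(-β Σ|∇ψ| - λ Σ ψ)`. -/
def sosWt (β lam : ℝ) (V : Finset Site) (ψ : Site → ℤ) : ℝ :=
  Real.exp (-(β * sosEnergy V ψ + lam * sosField V ψ))

/-- The inner boundary `∂_i V`. -/
def innerBdry (V : Finset Site) : Finset Site :=
  V.filter fun v => ∃ d ∈ dirs, v + d ∉ V

/-- The interior `V̊ = V ∖ ∂_i V`. -/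
def interiorSites (V : Finset Site) : Finset Site := V \ innerBdry V

/-- The number of edges `|∂_e V|` between `V` and its complement. -/
def edgeBdryCard (V : Finset Site) : ℕ :=
  ∑ v ∈ V, (dirs.filter fun d => v + d ∉ V).card

/-- Nearest-neighbour adjacency. -/
def adjS (u v : Site) : Prop := v - u ∈ dirs

/-- A set of sites is connected (as a subgraph of `ℤ²`). -/
def connectedIn (S : Set Site) : Prop :=
  ∀ x ∈ S, ∀ y ∈ S,
    Relation.ReflTransGen (fun a b => adjS a b ∧ a ∈ S ∧ b ∈ S) x y

/-- A finite set of sites is simply connected: it is connected and its complement is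
connected. -/
def SimplyConn (V : Finset Site) : Prop :=
  connectedIn (↑V : Set Site) ∧ connectedIn ((↑V : Set Site)ᶜ)

/-! ### SOS measures with a boundary signing -/

/-- A boundary signing value: `+`, `-`, `∅` or free. -/
inductive BSign | plus | minus | zero | free

/-- The constraint imposed at an inner-boundary site by a signing, for boundary height
`h`: `+` forces `≥ h`, `-` forces `≤ h`, `∅` forces `= h`, and `f` forces nothing. -/
def BSign.ok : BSign → ℤ → ℤ → Prop
  | .plus, h, t => h ≤ t
  | .minus, h, t => t ≤ h
  | .zero, h, t => t = h
  | .free, _, _ => True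

/-- Height functions with boundary condition identically `h` outside `V`, floor `0`
on `V` (and no ceiling), compatible with the boundary signing `η` along `∂_i V`. -/
def signedConfigs (V : Finset Site) (η : Site → BSign) (h : ℤ) : Set (Site → ℤ) :=
  {ψ | (∀ x, x ∉ V → ψ x = h) ∧ (∀ v ∈ V, 0 ≤ ψ v) ∧
       ∀ v ∈ innerBdry V, BSign.ok (η v) h (ψ v)}

/-- The partition function `Z_{η,h,V}`. -/
def Zsos (β lam : ℝ) (η : Site → BSign) (h : ℤ) (V : Finset Site) : ℝ :=
  ∑' ψ : Site → ℤ, Set.indicator (signedConfigs V η h) (sosWt β lam V) ψ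

/-- Probability of an event under the SOS measure `μ_{η,h,V}`. -/
def Psos (β lam : ℝ) (η : Site → BSign) (h : ℤ) (V : Finset Site)
    (E : Set (Site → ℤ)) : ℝ :=
  (∑' ψ : Site → ℤ, Set.indicator (signedConfigs V η h ∩ E) (sosWt β lam V) ψ) /
    Zsos β lam η h V

/-! ### Contours -/

/-- A (signed geometric) contour, encoded by the finite set of sites it encloses and its
sign (up/down); the contour itself is the dual circuit `(∂_e Int)^*`. -/
structure Contour where
  int : Finset Site
  up : Bool

/-- The length `|γ|` of a contour: the number of boundary edges of its interior. -/
def Contour.len (γ : Contour) : ℕ := edgeBdryCard γ.int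

/-- A valid contour encloses a nonempty simply-connected set of sites. -/
def Contour.valid (γ : Contour) : Prop :=
  γ.int.Nonempty ∧ connectedIn (↑γ.int : Set Site) ∧ connectedIn ((↑γ.int : Set Site)ᶜ)

/-- The constant boundary signing. -/
def constSign (s : BSign) : Site → BSign := fun _ => s

/-- The `h`-renormalized weight `W^rn_h(γ)`. -/
def Wrn (β lam : ℝ) (h : ℤ) (γ : Contour) : ℝ :=
  if γ.up then
    Real.exp (-β * (γ.len : ℝ)) *
      (Zsos β lam (constSign .plus) (h + 1) γ.int / Zsos β lam (constSign .plus) h γ.int)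
  else
    Real.exp (-β * (γ.len : ℝ)) *
      (Zsos β lam (constSign .minus) (h - 1) γ.int / Zsos β lam (constSign .minus) h γ.int)

/-- The `h`-truncated weight `W^tr_h(γ) = min{W^rn_h(γ), e^{-(β-5)|γ|}}`. -/
def Wtr (β lam : ℝ) (h : ℤ) (γ : Contour) : ℝ :=
  min (Wrn β lam h γ) (Real.exp (-(β - 5) * (γ.len : ℝ)))

/-- The elementary diameter bound `min{λ⁻¹, e^{3β(h+1)}}`. -/
def elemBound (β lam : ℝ) (h : ℤ) : ℝ := min (1 / lam) (Real.exp (3 * β * ((h : ℝ) + 1)))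

/-- A set of sites is `h`-elementary small: the enclosing contour (whose ℓ∞-diameter is
one more than that of the enclosed set) has diameter at most `min{λ⁻¹, e^{3β(h+1)}}`. -/
def elemSet (β lam : ℝ) (h : ℤ) (S : Set Site) : Prop :=
  ∀ x ∈ S, ∀ y ∈ S,
    ((max |x.1 - y.1| |x.2 - y.2| : ℤ) : ℝ) + 1 ≤ elemBound β lam h

/-- A contour is `h`-elementary if `diam(γ) ≤ min{λ⁻¹, e^{3β(h+1)}}`. -/
def IsElem (β lam : ℝ) (h : ℤ) (γ : Contour) : Prop := elemSet β lam h (↑γ.int : Set Site)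

/-- Two finite sets of sites share a (primal, equivalently dual) boundary edge. -/
def shareEdge (A B : Finset Site) : Prop :=
  ∃ v, ∃ d ∈ dirs, (v ∈ A ∧ v + d ∉ A) ∧ ((v ∈ B ∧ v + d ∉ B) ∨ (v + d ∈ B ∧ v ∉ B))

/-- Compatibility of a pair of signed contours: they may not cross, and if they overlap
on an edge their signs agree when nested and differ when mutually external. -/
def compatPair (γ γ' : Contour) : Prop :=
  (γ.int ⊆ γ'.int ∨ γ'.int ⊆ γ.int ∨ Disjoint γ.int γ'.int) ∧
  (shareEdge γ.int γ'.int →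
    ((γ.int ⊆ γ'.int ∨ γ'.int ⊆ γ.int) → γ.up = γ'.up) ∧
    (Disjoint γ.int γ'.int → γ.up ≠ γ'.up))

/-- Admissible renormalized families of signed contours in `U`, compatible with the
boundary signing `η` at reference height `h` (no floor constraint except that no
down-contours are allowed when `h = 0`). -/
def famOK (η : Site → BSign) (h : ℤ) (U : Finset Site) (Γ : Multiset Contour) : Prop :=
  (∀ γ ∈ Γ, Contour.valid γ ∧ γ.int ⊆ U) ∧
  (∀ γ ∈ Γ, ∀ γ' ∈ Γ, compatPair γ γ') ∧
  (∀ v ∈ innerBdry U, ∀ γ ∈ Γ, v ∈ γ.int →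
    (γ.up = true → η v ≠ BSign.minus ∧ η v ≠ BSign.zero) ∧
    (γ.up = false → η v ≠ BSign.plus ∧ η v ≠ BSign.zero)) ∧
  (h = 0 → ∀ γ ∈ Γ, γ.up = true)

/-- The product of weights of a family of contours. -/
def prodW (w : Contour → ℝ) (Γ : Multiset Contour) : ℝ := (Γ.map w).prod

/-- The truncated partition function `Z^tr_{η,h,U}`. -/
def Ztr (β lam : ℝ) (η : Site → BSign) (h : ℤ) (U : Finset Site) : ℝ :=
  Real.exp (-lam * (h : ℝ) * (U.card : ℝ)) *
    ∑' Γ : Multiset Contour, Set.indicator {Γ | famOK η h U Γ} (prodW (Wtr β lam h)) Γ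

/-- The renormalized partition function `Z^rn_{η,h,U}`. -/
def Zrn (β lam : ℝ) (η : Site → BSign) (h : ℤ) (U : Finset Site) : ℝ :=
  Real.exp (-lam * (h : ℝ) * (U.card : ℝ)) *
    ∑' Γ : Multiset Contour, Set.indicator {Γ | famOK η h U Γ} (prodW (Wrn β lam h)) Γ

/-- The renormalized elementary partition function `Z^{rn.el}_{η,h,U}`. -/
def Zrnel (β lam : ℝ) (η : Site → BSign) (h : ℤ) (U : Finset Site) : ℝ :=
  Real.exp (-lam * (h : ℝ) * (U.card : ℝ)) *
    ∑' Γ : Multiset Contour,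
      Set.indicator {Γ | famOK η h U Γ ∧ ∀ γ ∈ Γ, IsElem β lam h γ}
        (prodW (Wrn β lam h)) Γ

/-! ### Elementary restriction of the SOS measure -/

/-- `*`-adjacency (adjacency allowing diagonal steps). -/
def starAdj (u v : Site) : Prop := u ≠ v ∧ |u.1 - v.1| ≤ 1 ∧ |u.2 - v.2| ≤ 1

/-- The `*`-connected component of `x` within `S`. -/
def compStar (S : Set Site) (x : Site) : Set Site :=
  {y | Relation.ReflTransGen (fun a b => starAdj a b ∧ a ∈ S ∧ b ∈ S) x y}

/-- The fill of a set of sites: the set together with all sites whose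
complement-component is finite. -/
def fill (C : Set Site) : Set Site :=
  C ∪ {x | {y | Relation.ReflTransGen (fun a b => adjS a b ∧ a ∉ C ∧ b ∉ C) x y}.Finite}

/-- All outermost contours of the configuration `ψ` (with boundary height `h` on `V`)
are `h`-elementary: every filled deviation component is elementary-small. -/
def allOuterElem (β lam : ℝ) (h : ℤ) (V : Finset Site) (ψ : Site → ℤ) : Prop :=
  ∀ v ∈ V, ψ v ≠ h → elemSet β lam h (fill (compStar {u : Site | u ∈ V ∧ ψ u ≠ h} v))

/-- The elementary partition function `Z^el_{η,h,V}`: the contribution to `Z_{η,h,V}`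
of configurations all of whose outermost contours are `h`-elementary. -/
def Zel (β lam : ℝ) (η : Site → BSign) (h : ℤ) (V : Finset Site) : ℝ :=
  ∑' ψ : Site → ℤ,
    Set.indicator (signedConfigs V η h ∩ {ψ | allOuterElem β lam h V ψ})
      (sosWt β lam V) ψ

/-! ### Truncated free energies and the critical sequence -/

/-- `ftr h` is the truncated free energy `f^tr_h(λ)`: the infinite-volume limit of
`|Λ_n|⁻¹ log Z^tr_{η,h,Λ_n}`, for every boundary signing. -/
def FTRlimit (β : ℝ) (ftr : ℕ → ℝ → ℝ) : Prop :=
  ∀ h : ℕ, ∀ lam : ℝ, 0 < lam → lam ≤ 1 → ∀ η : Site → BSign,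
    Tendsto (fun n => Real.log (Ztr β lam η (h : ℤ) (box n)) / ((box n).card : ℝ))
      atTop (nhds (ftr h lam))

/-- `lamc` is the strictly decreasing sequence `(λ_c^{(k)})_{k≥0}` of critical points,
tending to `0`, at which the truncated free energies `ftr` exchange maximizer. -/
def CritSeq (ftr : ℕ → ℝ → ℝ) (lamc : ℕ → ℝ) : Prop :=
  StrictAnti lamc ∧ (∀ i, 0 < lamc i) ∧ Tendsto lamc atTop (nhds 0) ∧
  (∀ i : ℕ, ∀ lam : ℝ, 0 < lam → lam ≤ 1 → lamc i < lam →
    (i = 0 ∨ lam < lamc (i - 1)) → ∀ j : ℕ, j ≠ i → ftr j lam < ftr i lam) ∧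
  (∀ i : ℕ, ftr (i + 1) (lamc i) = ftr i (lamc i) ∧
    ∀ j : ℕ, j ≠ i → j ≠ i + 1 → ftr j (lamc i) < ftr i (lamc i))

/-- `d(x) = min_k |λ_c^{(k)} - x|`. -/
def dmin (lamc : ℕ → ℝ) (x : ℝ) : ℝ := ⨅ k : ℕ, |lamc k - x|

/-- `d⁺(x) = min{λ_c^{(k)} - x : λ_c^{(k)} > x}`. -/
def dplus (lamc : ℕ → ℝ) (x : ℝ) : ℝ := sInf {y : ℝ | ∃ k, x < lamc k ∧ y = lamc k - x}

/-! ### SOS measures with general boundary conditions (floor 0, no ceiling) -/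

/-- Height functions equal to the boundary condition `φ` off `V` and nonnegative on `V`. -/
def bcConfigs (V : Finset Site) (φ : Site → ℤ) : Set (Site → ℤ) :=
  {ψ | (∀ x, x ∉ V → ψ x = φ x) ∧ ∀ v ∈ V, 0 ≤ ψ v}

/-- The partition function with boundary condition `φ`. -/
def Zbc (β lam : ℝ) (V : Finset Site) (φ : Site → ℤ) : ℝ :=
  ∑' ψ : Site → ℤ, Set.indicator (bcConfigs V φ) (sosWt β lam V) ψ

/-- Probability of an event under the SOS measure `μ_{φ,V}` (floor 0, no ceiling). -/
def Pbc (β lam : ℝ) (V : Finset Site) (φ : Site → ℤ) (E : Set (Site → ℤ)) : ℝ :=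
  (∑' ψ : Site → ℤ, Set.indicator (bcConfigs V φ ∩ E) (sosWt β lam V) ψ) /
    Zbc β lam V φ

/-! ### Glauber dynamics on the box with a ceiling -/

/-- A configuration on `Λ_n` with floor `0` and ceiling `ℓ`. -/
abbrev Cfg (n ℓ : ℕ) := {x : Site // x ∈ box n} → Fin (ℓ + 1)

/-- Extension of a configuration by the zero boundary condition. -/
def cExt {n ℓ : ℕ} (ψ : Cfg n ℓ) : Site → ℤ :=
  fun x => if h : x ∈ box n then ((ψ ⟨x, h⟩ : ℕ) : ℤ) else 0

/-- The weight of a configuration (zero boundary conditions). -/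
def cWt (n ℓ : ℕ) (β lam : ℝ) (ψ : Cfg n ℓ) : ℝ := sosWt β lam (box n) (cExt ψ)

/-- The partition function on `Λ_n` with ceiling `ℓ` and zero boundary conditions. -/
def cZ (n ℓ : ℕ) (β lam : ℝ) : ℝ := ∑ ψ : Cfg n ℓ, cWt n ℓ β lam ψ

/-- The SOS probability measure `μ_{n,λ}` (ceiling `ℓ`, zero boundary conditions). -/
def cPi (n ℓ : ℕ) (β lam : ℝ) (ψ : Cfg n ℓ) : ℝ := cWt n ℓ β lam ψ / cZ n ℓ β lam

/-- Probability of an event under `μ_{n,λ}`. -/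
def cProb (n ℓ : ℕ) (β lam : ℝ) (E : Set (Cfg n ℓ)) : ℝ :=
  (∑ ψ : Cfg n ℓ, if ψ ∈ E then cWt n ℓ β lam ψ else 0) / cZ n ℓ β lam

/-- The Glauber (heat-bath) jump rate from `ψ` to `ψ' ≠ ψ`: nonzero only if they differ
at a single site `v` by exactly one, in which case `v`'s height is resampled among
`{ψ_v - 1, ψ_v, ψ_v + 1}` (truncated at the floor and the ceiling) according to the
conditional probabilities given the other heights. -/
def glRate (n ℓ : ℕ) (β lam : ℝ) (ψ ψ' : Cfg n ℓ) : ℝ :=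
  if ψ = ψ' then 0
  else
    ∑ v : {x : Site // x ∈ box n},
      if (∀ u, u ≠ v → ψ u = ψ' u) ∧ (((ψ' v : ℕ) : ℤ) - ((ψ v : ℕ) : ℤ)) ^ 2 = 1 then
        cWt n ℓ β lam ψ' /
          ∑ t : Fin (ℓ + 1),
            (if (((t : ℕ) : ℤ) - ((ψ v : ℕ) : ℤ)) ^ 2 ≤ 1 then
              cWt n ℓ β lam (Function.update ψ v t) else 0)
      else 0

/-- Mean of an observable under `μ_{n,λ}`. -/
def cMean (n ℓ : ℕ) (β lam : ℝ) (f : Cfg n ℓ → ℝ) : ℝ :=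
  ∑ ψ : Cfg n ℓ, cPi n ℓ β lam ψ * f ψ

/-- Variance of an observable under `μ_{n,λ}`. -/
def cVar (n ℓ : ℕ) (β lam : ℝ) (f : Cfg n ℓ → ℝ) : ℝ :=
  ∑ ψ : Cfg n ℓ, cPi n ℓ β lam ψ * (f ψ - cMean n ℓ β lam f) ^ 2

/-- The Dirichlet form of the Glauber dynamics. -/
def cDirichlet (n ℓ : ℕ) (β lam : ℝ) (f : Cfg n ℓ → ℝ) : ℝ :=
  (1 / 2) * ∑ ψ : Cfg n ℓ, ∑ ψ' : Cfg n ℓ,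
    cPi n ℓ β lam ψ * glRate n ℓ β lam ψ ψ' * (f ψ' - f ψ) ^ 2

/-- The spectral gap `gap_{n,λ}` of the generator of the Glauber dynamics (ceiling `ℓ`):
by reversibility, the smallest nonzero eigenvalue of minus the generator equals the
infimum of the Rayleigh quotients `E(f,f)/Var(f)`. -/
def specGap (n ℓ : ℕ) (β lam : ℝ) : ℝ :=
  sInf {r : ℝ | ∃ f : Cfg n ℓ → ℝ,
    cVar n ℓ β lam f ≠ 0 ∧ r = cDirichlet n ℓ β lam f / cVar n ℓ β lam f}

end

open scoped BigOperators
open Filter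

noncomputable section
attribute [local instance] Classical.propDecidable

/-! ### Topology of fills -/

theorem mem_dirs (d : Site) : d ∈ dirs ↔ d = (1,0) ∨ d = (-1,0) ∨ d = (0,1) ∨ d = (0,-1) := by
  simp [dirs]

theorem neg_mem_dirs {d : Site} (h : d ∈ dirs) : -d ∈ dirs := by
  rw [mem_dirs] at *
  rcases h with h | h | h | h <;> subst h <;> simp

theorem adjS_symm {a b : Site} (h : adjS a b) : adjS b a := by
  unfold adjS at *
  have := neg_mem_dirs h
  simpa using this

theorem adjS_iff (a b : Site) : adjS a b ↔
    (b.1 = a.1 + 1 ∧ b.2 = a.2) ∨ (b.1 = a.1 - 1 ∧ b.2 = a.2) ∨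
    (b.1 = a.1 ∧ b.2 = a.2 + 1) ∨ (b.1 = a.1 ∧ b.2 = a.2 - 1) := by
  unfold adjS
  rw [mem_dirs]
  simp only [Prod.ext_iff, Prod.fst_sub, Prod.snd_sub]
  omega

theorem adjS_add {a d : Site} (h : d ∈ dirs) : adjS a (a + d) := by
  unfold adjS; simpa using h

theorem adjS_ne {a b : Site} (h : adjS a b) : a ≠ b := by
  rw [adjS_iff] at h
  rintro rfl
  omega

theorem adjS_star {a b : Site} (h : adjS a b) : starAdj a b := by
  refine ⟨adjS_ne h, ?_, ?_⟩ <;> rw [adjS_iff] at h <;> rw [abs_le] <;> omega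

theorem starAdj_symm {a b : Site} (h : starAdj a b) : starAdj b a := by
  refine ⟨h.1.symm, ?_, ?_⟩
  · rw [abs_sub_comm]; exact h.2.1
  · rw [abs_sub_comm]; exact h.2.2

theorem rtg_symm {r : Site → Site → Prop} (hr : ∀ a b, r a b → r b a) {x y : Site}
    (h : Relation.ReflTransGen r x y) : Relation.ReflTransGen r y x := by
  induction h with
  | refl => exact Relation.ReflTransGen.refl
  | tail _ hab ih => exact Relation.ReflTransGen.head (hr _ _ hab) ih

theorem rtg_mono {r s : Site → Site → Prop} (hr : ∀ a b, r a b → s a b) {x y : Site}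
    (h : Relation.ReflTransGen r x y) : Relation.ReflTransGen s x y := by
  induction h with
  | refl => exact Relation.ReflTransGen.refl
  | tail _ hab ih => exact ih.tail (hr _ _ hab)

/-- nearest-neighbour component of the complement of `C` -/
def ccomp (C : Set Site) (x : Site) : Set Site :=
  {y | Relation.ReflTransGen (fun a b => adjS a b ∧ a ∉ C ∧ b ∉ C) x y}

theorem ccomp_symm {C : Set Site} {x y : Site} (h : y ∈ ccomp C x) : x ∈ ccomp C y := by
  refine rtg_symm ?_ h
  intro a b hab
  exact ⟨adjS_symm hab.1, hab.2.2, hab.2.1⟩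

theorem ccomp_eq {C : Set Site} {x y : Site} (h : y ∈ ccomp C x) : ccomp C y = ccomp C x := by
  ext z
  constructor
  · intro hz; exact Relation.ReflTransGen.trans h hz
  · intro hz; exact Relation.ReflTransGen.trans (ccomp_symm h) hz

theorem mem_fill {C : Set Site} {x : Site} : x ∈ fill C ↔ x ∈ C ∨ (ccomp C x).Finite := Iff.rfl

theorem not_mem_fill {C : Set Site} {x : Site} :
    x ∉ fill C ↔ x ∉ C ∧ (ccomp C x).Infinite := by
  rw [mem_fill]; push Not; rfl

theorem subset_fill (C : Set Site) : C ⊆ fill C := fun _ h => Or.inl h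

theorem ccomp_not_mem {C : Set Site} {x y : Site} (hx : x ∉ C) (h : y ∈ ccomp C x) : y ∉ C := by
  induction h with
  | refl => exact hx
  | tail _ h _ => exact h.2.2

theorem ccomp_not_fill {C : Set Site} {x y : Site} (hx : x ∉ fill C) (h : y ∈ ccomp C x) :
    y ∉ fill C := by
  rw [not_mem_fill] at *
  exact ⟨ccomp_not_mem hx.1 h, by rw [ccomp_eq h]; exact hx.2⟩

theorem step_not_fill {C : Set Site} {x y : Site} (hx : x ∉ fill C) (hy : y ∉ C)
    (h : adjS x y) : y ∉ fill C :=
  ccomp_not_fill hx (Relation.ReflTransGen.single ⟨h, (not_mem_fill.1 hx).1, hy⟩)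

theorem fill_bdry {C : Set Site} {u w : Site} (hu : u ∈ fill C) (hw : w ∉ fill C)
    (h : adjS u w) : u ∈ C := by
  by_contra hc
  exact step_not_fill hw hc (adjS_symm h) hu

theorem compStar_self (S : Set Site) (x : Site) : x ∈ compStar S x := Relation.ReflTransGen.refl

theorem compStar_sub {S : Set Site} {x : Site} (hx : x ∈ S) : compStar S x ⊆ S := by
  intro y hy
  induction hy with
  | refl => exact hx
  | tail _ h _ => exact h.2.2

theorem compStar_step {S : Set Site} {x u w : Site} (hx : x ∈ S) (hu : u ∈ compStar S x)
    (hw : w ∈ S) (h : starAdj u w) : w ∈ compStar S x :=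
  Relation.ReflTransGen.tail hu ⟨h, compStar_sub hx hu, hw⟩

theorem compStar_mono {S T : Set Site} (h : S ⊆ T) (x : Site) : compStar S x ⊆ compStar T x := by
  intro y hy
  exact rtg_mono (fun a b hab => ⟨hab.1, h hab.2.1, h hab.2.2⟩) hy

theorem fill_star_bdry {S : Set Site} {x u w : Site} (hx : x ∈ S)
    (hu : u ∈ fill (compStar S x)) (hw : w ∉ fill (compStar S x)) (h : starAdj u w) : w ∉ S := by
  intro hwS
  have hwC : w ∉ compStar S x := (not_mem_fill.1 hw).1
  by_cases huC : u ∈ compStar S x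
  · exact hwC (compStar_step hx huC hwS h)
  have hna : ¬ adjS u w := fun hh => huC (fill_bdry hu hw hh)
  obtain ⟨hne, h1, h2⟩ := h
  rw [abs_le] at h1 h2
  rw [adjS_iff] at hna
  have hne' : ¬ (u.1 = w.1 ∧ u.2 = w.2) := fun hh => hne (Prod.ext hh.1 hh.2)
  have huz : adjS (u.1, w.2) u := by rw [adjS_iff]; dsimp only; omega
  have hwz : adjS w (u.1, w.2) := by rw [adjS_iff]; dsimp only; omega
  by_cases hz : ((u.1, w.2) : Site) ∈ compStar S x
  · exact hwC (compStar_step hx hz hwS (adjS_star (adjS_symm hwz)))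
  · exact step_not_fill (step_not_fill hw hz hwz) huC huz hu

theorem fill_nn_bdry {S : Set Site} {x u w : Site} (hx : x ∈ S)
    (hu : u ∈ fill (compStar S x)) (hw : w ∉ fill (compStar S x)) (h : adjS u w) :
    u ∈ S ∧ w ∉ S :=
  ⟨compStar_sub hx (fill_bdry hu hw h), fill_star_bdry hx hu hw (adjS_star h)⟩

theorem ccomp_anti {C C' : Set Site} (h : C' ⊆ C) (x : Site) : ccomp C x ⊆ ccomp C' x := by
  intro y hy
  exact rtg_mono
    (fun a b hab => ⟨hab.1, fun hh => hab.2.1 (h hh), fun hh => hab.2.2 (h hh)⟩) hy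

theorem fill_sub_fill {C C' : Set Site} (h : C' ⊆ fill C) : fill C' ⊆ fill C := by
  intro y hy
  by_contra hyC
  have hsub : ccomp C y ⊆ ccomp C' y := by
    intro z hz
    have key : z ∈ ccomp C' y ∧ z ∉ fill C := by
      induction hz with
      | refl => exact ⟨Relation.ReflTransGen.refl, hyC⟩
      | tail _ hab ih =>
        have hb := step_not_fill ih.2 hab.2.2 hab.1
        exact ⟨Relation.ReflTransGen.tail ih.1 ⟨hab.1, fun hh => ih.2 (h hh), fun hh => hb (h hh)⟩, hb⟩
    exact key.1
  rcases hy with hy | hy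
  · exact hyC (h hy)
  · exact (not_mem_fill.1 hyC).2 (Set.Finite.subset hy hsub)

theorem fill_mono {C C' : Set Site} (h : C' ⊆ C) : fill C' ⊆ fill C :=
  fill_sub_fill (h.trans (subset_fill C))

/-- Components of a set contained in `S ∪ fill K₀` are inside `fill K₀` or inside old ones. -/
theorem comp_dichotomy {S S' : Set Site} {x₀ y : Site} (hx : x₀ ∈ S)
    (hS : S' ⊆ S ∪ fill (compStar S x₀)) (hy : y ∈ S') :
    (y ∈ fill (compStar S x₀) ∧ compStar S' y ⊆ fill (compStar S x₀)) ∨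
    (y ∉ fill (compStar S x₀) ∧ y ∈ S ∧ compStar S' y ⊆ compStar S y ∧
      ∀ z ∈ compStar S' y, z ∉ fill (compStar S x₀)) := by
  by_cases hyF : y ∈ fill (compStar S x₀)
  · left
    refine ⟨hyF, ?_⟩
    intro z hz
    induction hz with
    | refl => exact hyF
    | tail _ hab ih =>
      by_contra hb
      have := fill_star_bdry hx ih hb hab.1
      rcases hS hab.2.2 with h | h
      · exact this h
      · exact hb h
  · right
    have hyS : y ∈ S := (hS hy).resolve_right hyF
    have key : ∀ z ∈ compStar S' y, z ∈ compStar S y ∧ z ∉ fill (compStar S x₀) := by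
      intro z hz
      induction hz with
      | refl => exact ⟨compStar_self _ _, hyF⟩
      | @tail a b _ hab ih =>
        have haS := compStar_sub hyS ih.1
        have hb : b ∉ fill (compStar S x₀) := by
          intro hb
          exact fill_star_bdry hx hb ih.2 (starAdj_symm hab.1) haS
        exact ⟨compStar_step hyS ih.1 ((hS hab.2.2).resolve_right hb) hab.1, hb⟩
    exact ⟨hyF, hyS, fun z hz => (key z hz).1, fun z hz => (key z hz).2⟩

/-! ### Lines and boxes -/

theorem chain_up {S : Set Site} (f : ℤ → Site) (hadj : ∀ t, adjS (f t) (f (t+1))) (a : ℤ) (n : ℕ)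
    (h : ∀ t, a ≤ t → t ≤ a + n → f t ∈ S) :
    Relation.ReflTransGen (fun a b => adjS a b ∧ a ∈ S ∧ b ∈ S) (f a) (f (a+n)) := by
  induction n with
  | zero => simpa using Relation.ReflTransGen.refl
  | succ n ih =>
    refine Relation.ReflTransGen.tail (ih fun t h1 h2 => h t h1 (by push_cast; omega)) ?_
    have := hadj (a + n)
    refine ⟨by push_cast; rw [← add_assoc]; exact this, h _ (by omega) (by push_cast; omega),
      h _ (by push_cast; omega) le_rfl⟩

theorem conn_symm {S : Set Site} {x y : Site}
    (h : Relation.ReflTransGen (fun a b => adjS a b ∧ a ∈ S ∧ b ∈ S) x y) :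
    Relation.ReflTransGen (fun a b => adjS a b ∧ a ∈ S ∧ b ∈ S) y x := by
  refine rtg_symm ?_ h
  intro a b hab
  exact ⟨adjS_symm hab.1, hab.2.2, hab.2.1⟩

theorem chain_line {S : Set Site} (f : ℤ → Site) (hadj : ∀ t, adjS (f t) (f (t+1))) (a b : ℤ)
    (h : ∀ t, f t ∈ S) :
    Relation.ReflTransGen (fun a b => adjS a b ∧ a ∈ S ∧ b ∈ S) (f a) (f b) := by
  rcases le_total a b with hab | hab
  · obtain ⟨n, rfl⟩ := Int.le.dest hab
    exact chain_up f hadj a n fun t _ _ => h t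
  · obtain ⟨n, rfl⟩ := Int.le.dest hab
    exact conn_symm (chain_up f hadj b n fun t _ _ => h t)

theorem adj_h (b t : ℤ) : adjS (t, b) (t+1, b) := by rw [adjS_iff]; simp
theorem adj_v (a t : ℤ) : adjS (a, t) (a, t+1) := by rw [adjS_iff]; simp

theorem mem_box {n : ℕ} {x : Site} : x ∈ box n ↔
    (-((n : ℤ) / 2) ≤ x.1 ∧ x.1 ≤ (n : ℤ) / 2) ∧ (-((n : ℤ) / 2) ≤ x.2 ∧ x.2 ≤ (n : ℤ) / 2) := by
  simp [box, Finset.mem_product, Finset.mem_Icc]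

theorem box_compl_conn (n : ℕ) : connectedIn ((↑(box n) : Set Site)ᶜ) := by
  have key : ∀ x ∈ ((↑(box n) : Set Site)ᶜ),
      Relation.ReflTransGen (fun a b => adjS a b ∧ a ∈ ((↑(box n) : Set Site)ᶜ) ∧
        b ∈ ((↑(box n) : Set Site)ᶜ)) x ((n : ℤ)/2 + 1, (n:ℤ)/2 + 1) := by
    rintro ⟨a, b⟩ hx
    simp only [Set.mem_compl_iff, Finset.mem_coe, mem_box] at hx
    by_cases ha : -((n : ℤ) / 2) ≤ a ∧ a ≤ (n : ℤ) / 2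
    · have hb : ¬ (-((n : ℤ) / 2) ≤ b ∧ b ≤ (n : ℤ) / 2) := fun hb => hx ⟨ha, hb⟩
      refine (chain_line (fun t => ((t, b) : Site)) (adj_h b) a ((n : ℤ)/2 + 1) ?_).trans
        (chain_line (fun t => (((n : ℤ)/2 + 1, t) : Site)) (adj_v _) b ((n : ℤ)/2 + 1) ?_)
      · intro t; simp only [Set.mem_compl_iff, Finset.mem_coe, mem_box]; tauto
      · intro t; simp only [Set.mem_compl_iff, Finset.mem_coe, mem_box]; omega
    · refine (chain_line (fun t => ((a, t) : Site)) (adj_v a) b ((n : ℤ)/2 + 1) ?_).trans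
        (chain_line (fun t => ((t, (n : ℤ)/2 + 1) : Site)) (adj_h _) a ((n : ℤ)/2 + 1) ?_)
      · intro t; simp only [Set.mem_compl_iff, Finset.mem_coe, mem_box]; tauto
      · intro t; simp only [Set.mem_compl_iff, Finset.mem_coe, mem_box]; omega
  intro x hx y hy
  exact (key x hx).trans (conn_symm (key y hy))

theorem box_compl_infinite (n : ℕ) : ((↑(box n) : Set Site)ᶜ).Infinite :=
  (Finset.finite_toSet (box n)).infinite_compl

theorem fill_box {n : ℕ} {C : Set Site} (h : C ⊆ ↑(box n)) : fill C ⊆ ↑(box n) := by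
  intro x hx
  by_contra hxb
  have hsub : ((↑(box n) : Set Site)ᶜ) ⊆ ccomp C x := by
    intro y hy
    exact rtg_mono
      (fun a b hab => ⟨hab.1, fun hh => hab.2.1 (h hh), fun hh => hab.2.2 (h hh)⟩)
      (box_compl_conn n x hxb y hy)
  rcases hx with hx | hx
  · exact hxb (h hx)
  · exact box_compl_infinite n (Set.Finite.subset hx hsub)

theorem fill_compl_conn {n : ℕ} {C : Set Site} (h : C ⊆ ↑(box n)) : connectedIn ((fill C)ᶜ) := by
  have key : ∀ x ∈ (fill C)ᶜ, ∃ z ∈ ((↑(box n) : Set Site)ᶜ),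
      Relation.ReflTransGen (fun a b => adjS a b ∧ a ∈ (fill C)ᶜ ∧ b ∈ (fill C)ᶜ) x z := by
    intro x hx
    obtain ⟨z, hz, hzb⟩ := (not_mem_fill.1 hx).2.exists_notMem_finset (box n)
    refine ⟨z, hzb, ?_⟩
    clear hzb
    induction hz with
    | refl => exact Relation.ReflTransGen.refl
    | @tail a b hxa hab ih =>
      have ha : a ∉ fill C := ccomp_not_fill hx hxa
      exact ih.tail ⟨hab.1, ha, step_not_fill ha hab.2.2 hab.1⟩
  intro x hx y hy
  obtain ⟨z, hz, hxz⟩ := key x hx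
  obtain ⟨w, hw, hyw⟩ := key y hy
  refine hxz.trans (Relation.ReflTransGen.trans ?_ (conn_symm hyw))
  have hs : ((↑(box n) : Set Site)ᶜ) ⊆ (fill C)ᶜ := Set.compl_subset_compl.2 (fill_box h)
  exact rtg_mono (fun a b hab => ⟨hab.1, hs hab.2.1, hs hab.2.2⟩)
    (box_compl_conn n z hz w hw)

/-- star-connectedness of a set -/
def starConn (D : Set Site) : Prop :=
  ∀ x ∈ D, ∀ y ∈ D, Relation.ReflTransGen (fun a b => starAdj a b ∧ a ∈ D ∧ b ∈ D) x y

theorem star_symm {S : Set Site} {x y : Site}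
    (h : Relation.ReflTransGen (fun a b => starAdj a b ∧ a ∈ S ∧ b ∈ S) x y) :
    Relation.ReflTransGen (fun a b => starAdj a b ∧ a ∈ S ∧ b ∈ S) y x := by
  refine rtg_symm ?_ h
  intro a b hab
  exact ⟨starAdj_symm hab.1, hab.2.2, hab.2.1⟩

theorem fill_starConn {S : Set Site} {x : Site} (hx : x ∈ S) :
    starConn (fill (compStar S x)) := by
  set C := compStar S x with hC
  have hCx : ∀ y ∈ C, Relation.ReflTransGen
      (fun a b => starAdj a b ∧ a ∈ fill C ∧ b ∈ fill C) x y := by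
    intro y hy
    have key : Relation.ReflTransGen
      (fun a b => starAdj a b ∧ a ∈ fill C ∧ b ∈ fill C) x y ∧ y ∈ C := by
      induction hy with
      | refl => exact ⟨Relation.ReflTransGen.refl, compStar_self _ _⟩
      | tail _ hab ih =>
        have hb := compStar_step hx ih.2 hab.2.2 hab.1
        exact ⟨ih.1.tail ⟨hab.1, Or.inl ih.2, Or.inl hb⟩, hb⟩
    exact key.1
  have key : ∀ y ∈ fill C, Relation.ReflTransGen
      (fun a b => starAdj a b ∧ a ∈ fill C ∧ b ∈ fill C) x y := by
    intro y hy
    by_cases hyC : y ∈ C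
    · exact hCx y hyC
    have hfin : (ccomp C y).Finite := hy.resolve_left hyC
    -- walk to the right
    by_contra hcon
    have hall : ∀ k : ℕ, ((y.1 + k, y.2) : Site) ∈ ccomp C y ∧ Relation.ReflTransGen
        (fun a b => starAdj a b ∧ a ∈ fill C ∧ b ∈ fill C) ((y.1 + k, y.2) : Site) y := by
      intro k
      induction k with
      | zero => simpa using ⟨(Relation.ReflTransGen.refl : y ∈ ccomp C y), Relation.ReflTransGen.refl⟩
      | succ k ih =>
        have hadj : adjS ((y.1 + k, y.2) : Site) ((y.1 + (k+1 : ℕ), y.2) : Site) := by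
          rw [adjS_iff]; left; refine ⟨?_, rfl⟩; push_cast; ring
        have h1 : ((y.1 + k, y.2) : Site) ∉ C := ccomp_not_mem hyC ih.1
        have h1f : ((y.1 + k, y.2) : Site) ∈ fill C := Or.inr (by
          change (ccomp C _).Finite
          rw [ccomp_eq ih.1]; exact hfin)
        by_cases h2 : ((y.1 + (k+1 : ℕ), y.2) : Site) ∈ C
        · exfalso
          apply hcon
          refine (hCx _ h2).trans (Relation.ReflTransGen.head ?_ ih.2)
          exact ⟨starAdj_symm (adjS_star hadj), Or.inl h2, h1f⟩
        · have h3 : ((y.1 + (k+1 : ℕ), y.2) : Site) ∈ ccomp C y :=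
            Relation.ReflTransGen.tail ih.1 ⟨hadj, h1, h2⟩
          refine ⟨h3, Relation.ReflTransGen.head ⟨starAdj_symm (adjS_star hadj), ?_, h1f⟩ ih.2⟩
          exact Or.inr (by
            change (ccomp C _).Finite
            rw [ccomp_eq h3]; exact hfin)
    refine Set.infinite_of_injective_forall_mem (f := fun k : ℕ => ((y.1 + k, y.2) : Site)) ?_
      (fun k => (hall k).1) hfin
    intro a b hab
    simpa using hab
  intro a ha b hb
  exact (star_symm (key a ha)).trans (key b hb)

end

open scoped BigOperators
open Filter

noncomputable section
attribute [local instance] Classical.propDecidable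

/-! ### Boundary edges and their connectedness -/

/-- directed boundary edges -/
def bE (D : Finset Site) : Finset (Site × Site) := (D ×ˢ dirs).filter fun e => e.1 + e.2 ∉ D

theorem mem_bE {D : Finset Site} {e : Site × Site} :
    e ∈ bE D ↔ e.1 ∈ D ∧ e.2 ∈ dirs ∧ e.1 + e.2 ∉ D := by
  simp [bE, and_assoc]

theorem bE_card (D : Finset Site) : (bE D).card = edgeBdryCard D := by
  unfold bE edgeBdryCard
  rw [Finset.card_filter, Finset.sum_product]
  refine Finset.sum_congr rfl fun v _ => ?_
  rw [Finset.card_filter]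

theorem exists_prim {G : Type*} [AddCommGroup G] (f : ℤ → G) :
    ∃ F : ℤ → G, F 0 = 0 ∧ ∀ n, F (n+1) = F n + f n := by
  refine ⟨fun n => (∑ k ∈ Finset.range n.toNat, f k) - ∑ k ∈ Finset.range (-n).toNat, f (-(k:ℤ)-1),
    by simp, ?_⟩
  intro n
  rcases lt_or_ge n 0 with h | h
  · obtain ⟨m, hm⟩ := Int.le.dest (show n + 1 ≤ 0 by omega)
    have hn : n = -(m:ℤ) - 1 := by omega
    subst hn
    have e1 : (-(m:ℤ) - 1 + 1).toNat = 0 := by omega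
    have e2 : (-(m:ℤ) - 1).toNat = 0 := by omega
    have e3 : (-(-(m:ℤ) - 1 + 1)).toNat = m := by omega
    have e4 : (-(-(m:ℤ) - 1)).toNat = m + 1 := by omega
    simp only [e1, e2, e3, e4, Finset.sum_range_succ]
    simp
  · obtain ⟨m, hm⟩ := Int.le.dest h
    have hn : n = (m:ℤ) := by omega
    subst hn
    have e1 : ((m:ℤ) + 1).toNat = m + 1 := by omega
    have e2 : ((m:ℤ)).toNat = m := by omega
    have e3 : (-((m:ℤ) + 1)).toNat = 0 := by omega
    have e4 : (-((m:ℤ))).toNat = 0 := by omega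
    simp only [e1, e2, e3, e4, Finset.sum_range_succ]
    simp

theorem exact_of_closed {G : Type*} [AddCommGroup G] (a1 a2 : ℤ → ℤ → G)
    (hc : ∀ x y, a1 x y + a2 (x+1) y = a2 x y + a1 x (y+1)) :
    ∃ g : ℤ → ℤ → G, (∀ x y, g (x+1) y = g x y + a1 x y) ∧ ∀ x y, g x (y+1) = g x y + a2 x y := by
  obtain ⟨F, hF0, hF⟩ := exists_prim (fun x => a1 x 0)
  choose H hH0 hH using fun x => exists_prim (fun y => a2 x y)
  refine ⟨fun x y => F x + H x y, ?_, ?_⟩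
  · intro x y
    induction y using Int.induction_on with
    | zero => simp [hH0, hF]
    | succ k ih =>
      have h1 := hH x k
      have h2 := hH (x+1) k
      have h3 := hc x k
      simp only at *
      rw [h1, h2, ← add_assoc, ih, add_assoc, h3]
      abel
    | pred k ih =>
      have h1 := hH x (-k-1)
      have h2 := hH (x+1) (-k-1)
      have h3 := hc x (-k-1)
      simp only [sub_add_cancel] at *
      rw [h1, h2] at ih
      have : F (x+1) + H (x+1) (-↑k-1) = (F x + (H x (-↑k-1) + a2 x (-↑k-1)) + a1 x (-↑k)) - a2 (x+1) (-↑k-1) := by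
        rw [← ih]; abel
      rw [this]
      have h4 : a1 x (-↑k) = a1 x (-↑k-1) + a2 (x+1) (-↑k-1) - a2 x (-↑k-1) := by rw [h3]; abel
      rw [h4]; abel
  · intro x y
    simp only [hH]; abel

/-- closeness of edges -/
def nearE (e e' : Site × Site) : Prop := |e.1.1 - e'.1.1| ≤ 1 ∧ |e.1.2 - e'.1.2| ≤ 1

/-- corners of a plaquette -/
def corner (x y : ℤ) (u : Site) : Prop := (x ≤ u.1 ∧ u.1 ≤ x + 1) ∧ (y ≤ u.2 ∧ u.2 ≤ y + 1)

theorem zmod2_add_self (a : ZMod 2) : a + a = 0 := CharTwo.add_self_eq_zero a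

theorem bE_conn {D : Finset Site} (hD : starConn (↑D : Set Site))
    (hDc : connectedIn ((↑D : Set Site)ᶜ)) {A : Finset (Site × Site)} (hA : A ⊆ bE D)
    (hne : A.Nonempty) (hcl : ∀ e ∈ A, ∀ e' ∈ bE D, nearE e e' → e' ∈ A) : A = bE D := by
  let ae : Site → Site → ZMod 2 := fun u d => if (u, d) ∈ A ∨ (u + d, -d) ∈ A then 1 else 0
  let iD : Site → ZMod 2 := fun u => if u ∈ D then 1 else 0
  let P : ℤ → ℤ → Prop := fun x y => ∃ e ∈ A, corner x y e.1
  have near_of : ∀ x y e e', corner x y (e : Site × Site).1 → corner x y (e' : Site × Site).1 →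
      nearE e e' := by
    intro x y e e' h h'
    unfold corner at h h'
    unfold nearE
    rw [abs_le, abs_le]; omega
  have case1 : ∀ x y u d, P x y → d ∈ dirs → corner x y u → corner x y (u + d) →
      ae u d = iD u + iD (u + d) := by
    rintro x y u d ⟨e, heA, he⟩ hd hu hud
    have h1 : (u, d) ∈ A ↔ u ∈ D ∧ u + d ∉ D := by
      constructor
      · intro h; have := mem_bE.1 (hA h); exact ⟨this.1, this.2.2⟩
      · rintro ⟨h1, h2⟩
        exact hcl e heA _ (mem_bE.2 ⟨h1, hd, h2⟩) (near_of x y _ _ he hu)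
    have h2 : (u + d, -d) ∈ A ↔ u + d ∈ D ∧ u ∉ D := by
      constructor
      · intro h; have := mem_bE.1 (hA h); simp at this; exact ⟨this.1, this.2.2⟩
      · rintro ⟨h1, h2⟩
        exact hcl e heA _ (mem_bE.2 ⟨h1, neg_mem_dirs hd, by simpa using h2⟩) (near_of x y _ _ he hud)
    simp only [ae, iD, h1, h2]
    by_cases k1 : u ∈ D <;> by_cases k2 : u + d ∈ D <;> simp [k1, k2, zmod2_add_self]
  have case2 : ∀ x y u d, ¬ P x y → corner x y u → corner x y (u + d) → ae u d = 0 := by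
    intro x y u d hP hu hud
    simp only [ae]
    rw [if_neg]
    rintro (h | h)
    · exact hP ⟨_, h, hu⟩
    · exact hP ⟨_, h, hud⟩
  have d1 : ((1, 0) : Site) ∈ dirs := by simp [dirs]
  have d2 : ((0, 1) : Site) ∈ dirs := by simp [dirs]
  have c00 : ∀ x y, corner x y (x, y) := by intro x y; unfold corner; dsimp only; omega
  have c10 : ∀ x y, corner x y ((x, y) + (1, 0)) := by
    intro x y; unfold corner; simp
  have c01 : ∀ x y, corner x y ((x, y) + (0, 1)) := by
    intro x y; unfold corner; simp
  have c10' : ∀ x y, corner x y (x+1, y) := by intro x y; unfold corner; simp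
  have c01' : ∀ x y, corner x y (x, y+1) := by intro x y; unfold corner; simp
  have c11 : ∀ x y, corner x y ((x+1, y) + (0, 1)) := by intro x y; unfold corner; simp
  have c11' : ∀ x y, corner x y ((x, y+1) + (1, 0)) := by intro x y; unfold corner; simp
  obtain ⟨g, hg1, hg2⟩ := exact_of_closed (fun x y => ae (x, y) (1, 0)) (fun x y => ae (x, y) (0, 1))
    (by
      intro x y
      by_cases hP : P x y
      · rw [case1 x y _ _ hP d1 (c00 x y) (c10 x y), case1 x y _ _ hP d2 (c00 x y) (c01 x y),
          case1 x y _ _ hP d2 (c10' x y) (c11 x y), case1 x y _ _ hP d1 (c01' x y) (c11' x y)]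
        simp only [Prod.mk_add_mk, add_zero]
        generalize iD (x, y) = p
        generalize iD (x+1, y) = q
        generalize iD (x, y+1) = r
        generalize iD (x+1, y+1) = s
        linear_combination zmod2_add_self q - zmod2_add_self r
      · rw [case2 x y _ _ hP (c00 x y) (c10 x y), case2 x y _ _ hP (c00 x y) (c01 x y),
          case2 x y _ _ hP (c10' x y) (c11 x y), case2 x y _ _ hP (c01' x y) (c11' x y)])
  let G : Site → ZMod 2 := fun u => g u.1 u.2
  have corners : ∀ x y u, corner x y u → u = (x,y) ∨ u = (x+1,y) ∨ u = (x,y+1) ∨ u = (x+1,y+1) := by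
    intro x y u h
    unfold corner at h
    simp only [Prod.ext_iff]; omega
  have PG : ∀ x y u, P x y → corner x y u → G u + iD u = G (x, y) + iD (x, y) := by
    intro x y u hP hu
    have e1 := case1 x y _ _ hP d1 (c00 x y) (c10 x y)
    have e2 := case1 x y _ _ hP d2 (c00 x y) (c01 x y)
    have e3 := case1 x y _ _ hP d2 (c10' x y) (c11 x y)
    have f1 := hg1 x y
    have f2 := hg2 x y
    have f3 := hg2 (x+1) y
    simp only [Prod.mk_add_mk, add_zero] at e1 e2 e3
    rcases corners x y u hu with rfl | rfl | rfl | rfl <;> simp only [G]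
    · rw [f1, e1]; linear_combination zmod2_add_self (iD (x+1, y))
    · rw [f2, e2]; linear_combination zmod2_add_self (iD (x, y+1))
    · rw [f3, e3, f1, e1]
      linear_combination zmod2_add_self (iD (x+1, y)) + zmod2_add_self (iD (x+1, y+1))
  have NG : ∀ x y u, ¬ P x y → corner x y u → G u = G (x, y) := by
    intro x y u hP hu
    have e1 := case2 x y _ _ hP (c00 x y) (c10 x y)
    have e2 := case2 x y _ _ hP (c00 x y) (c01 x y)
    have e3 := case2 x y _ _ hP (c10' x y) (c11 x y)
    have f1 := hg1 x y
    have f2 := hg2 x y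
    have f3 := hg2 (x+1) y
    rcases corners x y u hu with rfl | rfl | rfl | rfl <;> simp only [G]
    · rw [f1, e1, add_zero]
    · rw [f2, e2, add_zero]
    · rw [f3, e3, f1, e1, add_zero, add_zero]
  have plaq : ∀ u w : Site, |u.1 - w.1| ≤ 1 → |u.2 - w.2| ≤ 1 →
      ∃ x y, corner x y u ∧ corner x y w := by
    intro u w h1 h2
    rw [abs_le] at h1 h2
    refine ⟨min u.1 w.1, min u.2 w.2, ?_, ?_⟩ <;> unfold corner <;> omega
  have step : ∀ u w : Site, |u.1 - w.1| ≤ 1 → |u.2 - w.2| ≤ 1 → (u ∈ D ↔ w ∈ D) → G u = G w := by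
    intro u w h1 h2 hD
    obtain ⟨x, y, hu, hw⟩ := plaq u w h1 h2
    by_cases hP : P x y
    · have := (PG x y u hP hu).trans (PG x y w hP hw).symm
      have hi : iD u = iD w := by simp only [iD, hD]
      rw [hi] at this
      exact add_right_cancel this
    · exact (NG x y u hP hu).trans (NG x y w hP hw).symm
  have constD : ∀ u ∈ D, ∀ w ∈ D, G u = G w := by
    intro u hu w hw
    have := hD u hu w hw
    induction this with
    | refl => rfl
    | @tail a b _ hab ih =>
      exact (ih hab.2.1).trans (step _ _ hab.1.2.1 hab.1.2.2 (iff_of_true hab.2.1 hab.2.2))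
  have constDc : ∀ u, u ∉ D → ∀ w, w ∉ D → G u = G w := by
    intro u hu w hw
    have := hDc u hu w hw
    induction this with
    | refl => rfl
    | @tail a b _ hab ih =>
      have hs := adjS_star hab.1
      exact (ih hab.2.1).trans (step _ _ hs.2.1 hs.2.2 (iff_of_false hab.2.1 hab.2.2))
  obtain ⟨e0, he0⟩ := hne
  have hb0 := mem_bE.1 (hA he0)
  have hs0 := adjS_star (adjS_add (a := e0.1) hb0.2.1)
  have hneq : G e0.1 ≠ G (e0.1 + e0.2) := by
    obtain ⟨x, y, hu, hw⟩ := plaq _ _ hs0.2.1 hs0.2.2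
    have hP : P x y := ⟨e0, he0, hu⟩
    have := (PG x y _ hP hu).trans (PG x y _ hP hw).symm
    simp only [iD, if_pos hb0.1, if_neg hb0.2.2, add_zero] at this
    intro h
    rw [← h] at this
    simp at this
  refine Finset.Subset.antisymm hA ?_
  intro e he
  have hb := mem_bE.1 he
  have hs := adjS_star (adjS_add (a := e.1) hb.2.1)
  obtain ⟨x, y, hu, hw⟩ := plaq _ _ hs.2.1 hs.2.2
  by_cases hP : P x y
  · obtain ⟨e', he', hc'⟩ := hP
    exact hcl e' he' e he (near_of x y _ _ hc' hu)
  · exfalso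
    apply hneq
    rw [constD _ hb0.1 _ hb.1, constDc _ hb0.2.2 _ hb.2.2]
    exact (NG x y _ hP hu).trans (NG x y _ hP hw).symm

end

open scoped BigOperators
open Filter

noncomputable section
attribute [local instance] Classical.propDecidable

/-! ### Counting contours -/

/-- moves of a walk on directed edges -/
def nbE : Finset (Site × Site) :=
  (({-1, 0, 1} : Finset ℤ) ×ˢ ({-1, 0, 1} : Finset ℤ)) ×ˢ dirs

theorem dirs_card_le : dirs.card ≤ 4 := by
  unfold dirs
  refine (Finset.card_insert_le _ _).trans ?_
  have h1 := Finset.card_insert_le ((-1, 0) : Site) {(0,1), (0,-1)}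
  have h2 := Finset.card_insert_le ((0, 1) : Site) {(0,-1)}
  have h3 := Finset.card_singleton ((0, -1) : Site)
  omega

theorem nbE_card : nbE.card ≤ 36 := by
  unfold nbE
  rw [Finset.card_product, Finset.card_product]
  have : ({-1, 0, 1} : Finset ℤ).card = 3 := by decide
  rw [this]
  have := dirs_card_le
  omega

/-- traces of walks of length `k` from `a` -/
def TrW : ℕ → (Site × Site) → Finset (Finset (Site × Site))
  | 0, a => {{a}}
  | k + 1, a => nbE.biUnion fun m => (TrW k (a.1 + m.1, m.2)).image (insert a)

theorem TrW_zero (a : Site × Site) : TrW 0 a = {{a}} := rfl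

theorem TrW_succ (k : ℕ) (a : Site × Site) :
    TrW (k+1) a = nbE.biUnion fun m => (TrW k (a.1 + m.1, m.2)).image (insert a) := rfl

attribute [irreducible] TrW

theorem TrW_card (k : ℕ) (a : Site × Site) : (TrW k a).card ≤ 36 ^ k := by
  induction k generalizing a with
  | zero => simp [TrW_zero]
  | succ k ih =>
    simp only [TrW_succ]
    refine Finset.card_biUnion_le.trans ?_
    refine (Finset.sum_le_card_nsmul _ _ (36 ^ k) fun m _ => Finset.card_image_le.trans (ih _)).trans ?_
    rw [smul_eq_mul, pow_succ, mul_comm]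
    exact Nat.mul_le_mul_left _ nbE_card

theorem TrW_self {k : ℕ} {a : Site × Site} {A : Finset (Site × Site)} (h : A ∈ TrW k a) : a ∈ A := by
  cases k with
  | zero => simp [TrW_zero] at h; simp [h]
  | succ k =>
    simp only [TrW_succ, Finset.mem_biUnion, Finset.mem_image] at h
    obtain ⟨m, _, B, _, rfl⟩ := h
    exact Finset.mem_insert_self _ _

theorem move_mem {a b : Site × Site} (h : nearE a b) (hb : b.2 ∈ dirs) :
    ∃ m ∈ nbE, (a.1 + m.1, m.2) = b := by
  refine ⟨(b.1 - a.1, b.2), ?_, by simp⟩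
  unfold nearE at h
  rw [abs_le, abs_le] at h
  simp only [nbE, Finset.mem_product, Finset.mem_insert, Finset.mem_singleton, Prod.fst_sub, Prod.snd_sub]
  refine ⟨⟨?_, ?_⟩, hb⟩ <;> omega

theorem TrW_step {k : ℕ} {a b : Site × Site} {A : Finset (Site × Site)} (h : nearE a b)
    (hb : b.2 ∈ dirs) (hA : A ∈ TrW k b) : insert a A ∈ TrW (k+1) a := by
  obtain ⟨m, hm, rfl⟩ := move_mem h hb
  simp only [TrW_succ, Finset.mem_biUnion, Finset.mem_image]
  exact ⟨m, hm, A, hA, rfl⟩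

theorem nearE_symm {a b : Site × Site} (h : nearE a b) : nearE b a := by
  unfold nearE at *
  rw [abs_sub_comm, abs_sub_comm b.1.2]; exact h

theorem TrW_detour0 {k : ℕ} {a e' : Site × Site} {A : Finset (Site × Site)} (hA : A ∈ TrW k a)
    (had : a.2 ∈ dirs) (hn : nearE a e') (hd' : e'.2 ∈ dirs) :
    insert e' A ∈ TrW (k+2) a := by
  have h1 := TrW_step (nearE_symm hn) had hA
  have h2 := TrW_step hn hd' h1
  rwa [Finset.insert_comm, Finset.insert_eq_of_mem (TrW_self hA)] at h2

theorem TrW_detour {e e' : Site × Site} (hn : nearE e e') (hd' : e'.2 ∈ dirs) (k : ℕ) :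
    ∀ {a : Site × Site} {A : Finset (Site × Site)}, A ∈ TrW k a →
    e ∈ A → (∀ e ∈ A, e.2 ∈ dirs) → insert e' A ∈ TrW (k+2) a := by
  induction k with
  | zero =>
    intro a A hA he hd
    have h0 : A = {a} := Finset.mem_singleton.1 (TrW_zero a ▸ hA)
    have h1 : e = a := by rw [h0] at he; exact Finset.mem_singleton.1 he
    have had : a.2 ∈ dirs := hd _ (h1 ▸ he)
    have hna : nearE a e' := h1 ▸ hn
    have hA' : ∀ k, A ∈ TrW k a → insert e' A ∈ TrW (k+2) a := fun k hk => TrW_detour0 hk had hna hd'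
    exact hA' _ hA
  | succ k ih =>
    intro a A hA he hd
    by_cases hea : e = a
    · exact TrW_detour0 hA (hd _ (hea ▸ he)) (hea ▸ hn) hd'
    · simp only [TrW_succ, Finset.mem_biUnion, Finset.mem_image] at hA
      obtain ⟨m, hm, B, hB, rfl⟩ := hA
      have heB : e ∈ B := by
        rcases Finset.mem_insert.1 he with h | h
        · exact absurd h hea
        · exact h
      have := ih hB heB fun x hx => hd x (Finset.mem_insert_of_mem hx)
      rw [Finset.insert_comm]
      rw [TrW_succ]
      simp only [Finset.mem_biUnion, Finset.mem_image]
      exact ⟨m, hm, _, this, rfl⟩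

/-- good sets: nonempty star-connected with connected complement -/
def Good (D : Finset Site) : Prop :=
  D.Nonempty ∧ starConn (↑D : Set Site) ∧ connectedIn ((↑D : Set Site)ᶜ)

theorem bE_trace {D : Finset Site} (hD : Good D) {a : Site × Site} (ha : a ∈ bE D) :
    bE D ∈ TrW (2 * ((bE D).card - 1)) a := by
  have key : ∀ k, k + 1 ≤ (bE D).card → ∃ A ⊆ bE D, A.card = k + 1 ∧ A ∈ TrW (2 * k) a := by
    intro k
    induction k with
    | zero => intro _; exact ⟨{a}, by simpa using ha, by simp, by simp [TrW_zero]⟩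
    | succ k ih =>
      intro hk
      obtain ⟨A, hA, hc, hT⟩ := ih (by omega)
      have hne : A ≠ bE D := by rintro rfl; omega
      have : ∃ e ∈ A, ∃ e' ∈ bE D, nearE e e' ∧ e' ∉ A := by
        by_contra hcon
        push Not at hcon
        exact hne (bE_conn hD.2.1 hD.2.2 hA ⟨a, TrW_self hT⟩ hcon)
      obtain ⟨e, he, e', he', hn, hnA⟩ := this
      refine ⟨insert e' A, Finset.insert_subset he' hA, by rw [Finset.card_insert_of_notMem hnA, hc], ?_⟩
      exact TrW_detour hn (mem_bE.1 he').2.1 _ hT he (fun x hx => (mem_bE.1 (hA hx)).2.1)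
  have hpos : 0 < (bE D).card := Finset.card_pos.2 ⟨a, ha⟩
  obtain ⟨A, hA, hc, hT⟩ := key ((bE D).card - 1) (by omega)
  have : A = bE D := Finset.eq_of_subset_of_card_le hA (by omega)
  rwa [this] at hT

/-- walk along a direction until exiting -/
theorem exists_exit (D : Finset Site) {u d : Site} (hu : u ∈ D) (hd : d ∈ dirs) :
    ∃ k : ℕ, (∀ j ≤ k, u + (j:ℤ) • d ∈ D) ∧ u + (k:ℤ) • d + d ∉ D := by
  have hd0 : d ≠ 0 := by
    rcases (mem_dirs d).1 hd with h | h | h | h <;> rw [h] <;> simp [Prod.ext_iff]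
  have hinj : Function.Injective (fun k : ℕ => u + (k:ℤ) • d) := by
    intro k l h
    simp only [add_right_inj] at h
    have h1 := congrArg Prod.fst h
    have h2 := congrArg Prod.snd h
    simp at h1 h2
    rcases (mem_dirs d).1 hd with h | h | h | h <;> rw [h] at h1 h2 <;> simp_all
  have hex : ∃ k : ℕ, u + (k:ℤ) • d ∉ D := by
    by_contra hcon
    push Not at hcon
    exact Set.infinite_range_of_injective hinj
      (D.finite_toSet.subset (by rintro _ ⟨k, rfl⟩; exact hcon k))
  classical
  have hs := Nat.find_spec hex
  have hm := fun j (hj : j < Nat.find hex) => not_not.1 (Nat.find_min hex hj)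
  have h0 : Nat.find hex ≠ 0 := by
    intro h; rw [h] at hs; simp at hs; exact hs hu
  obtain ⟨k, hk⟩ := Nat.exists_eq_succ_of_ne_zero h0
  refine ⟨k, fun j hj => hm j (by omega), ?_⟩
  rw [hk] at hs
  have : u + (k:ℤ) • d + d = u + ((k.succ : ℕ):ℤ) • d := by
    push_cast; rw [add_smul, one_smul, add_assoc]
  rwa [this]

theorem mem_dirs_r : ((1, 0) : Site) ∈ dirs := by simp [dirs]
theorem mem_dirs_l : ((-1, 0) : Site) ∈ dirs := by simp [dirs]
theorem mem_dirs_u : ((0, 1) : Site) ∈ dirs := by simp [dirs]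
theorem mem_dirs_d : ((0, -1) : Site) ∈ dirs := by simp [dirs]

theorem bE_dir_card (D : Finset Site) {d : Site} (hd : d ∈ dirs) (f : Site → ℤ)
    (hf : ∀ (u : Site) (k : ℤ), f (u + k • d) = f u) :
    (D.image f).card ≤ ((bE D).filter fun e => e.2 = d).card := by
  refine le_trans (Finset.card_le_card ?_)
    (Finset.card_image_le (s := (bE D).filter fun e => e.2 = d) (f := fun e => f e.1))
  intro x hx
  obtain ⟨u, hu, rfl⟩ := Finset.mem_image.1 hx
  obtain ⟨k, hk, hk'⟩ := exists_exit D hu hd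
  refine Finset.mem_image.2 ⟨(u + (k:ℤ) • d, d), ?_, hf _ _⟩
  rw [Finset.mem_filter, mem_bE]
  exact ⟨⟨hk k le_rfl, hd, hk'⟩, rfl⟩

theorem perim_ge (D : Finset Site) :
    2 * (D.image Prod.fst).card + 2 * (D.image Prod.snd).card ≤ edgeBdryCard D := by
  rw [← bE_card]
  have h1 := bE_dir_card D mem_dirs_r Prod.snd (by intro u k; simp)
  have h2 := bE_dir_card D mem_dirs_l Prod.snd (by intro u k; simp)
  have h3 := bE_dir_card D mem_dirs_u Prod.fst (by intro u k; simp)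
  have h4 := bE_dir_card D mem_dirs_d Prod.fst (by intro u k; simp)
  have h5 : (bE D).card = ∑ d ∈ dirs, ((bE D).filter fun e => e.2 = d).card :=
    Finset.card_eq_sum_card_fiberwise fun e he => (mem_bE.1 he).2.1
  rw [h5, dirs, Finset.sum_insert (by simp), Finset.sum_insert (by simp), Finset.sum_insert (by simp),
    Finset.sum_singleton]
  omega

theorem perim_ge_four {D : Finset Site} (h : D.Nonempty) : 4 ≤ edgeBdryCard D := by
  have h1 := Finset.card_pos.2 (h.image Prod.fst)
  have h2 := Finset.card_pos.2 (h.image Prod.snd)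
  have := perim_ge D
  omega

theorem perim_ge_six {D : Finset Site} {u v : Site} (hu : u ∈ D) (hv : v ∈ D) (huv : u ≠ v) :
    6 ≤ edgeBdryCard D := by
  have h1 := Finset.card_pos.2 (Finset.Nonempty.image ⟨u, hu⟩ (Prod.fst))
  have h2 := Finset.card_pos.2 (Finset.Nonempty.image ⟨u, hu⟩ (Prod.snd))
  have := perim_ge D
  have : 1 < (D.image Prod.fst).card ∨ 1 < (D.image Prod.snd).card := by
    by_cases h : u.1 = v.1
    · right
      refine Finset.one_lt_card.2 ⟨u.2, Finset.mem_image_of_mem _ hu, v.2, Finset.mem_image_of_mem _ hv, ?_⟩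
      intro h'; exact huv (Prod.ext h h')
    · left
      exact Finset.one_lt_card.2 ⟨u.1, Finset.mem_image_of_mem _ hu, v.1, Finset.mem_image_of_mem _ hv, h⟩
  omega

theorem bE_inj : Function.Injective bE := by
  have key : ∀ D D' : Finset Site, bE D = bE D' → D ⊆ D' := by
    intro D D' h x hx
    obtain ⟨k, hk, hk'⟩ := exists_exit D hx mem_dirs_r
    have hm : ((x + (k:ℤ) • ((1,0):Site)), ((1,0):Site)) ∈ bE D' := by
      rw [← h, mem_bE]; exact ⟨hk k le_rfl, mem_dirs_r, hk'⟩
    have := (mem_bE.1 hm).1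
    by_contra hxD
    -- descend
    have : ∀ j : ℕ, j ≤ k → x + ((k - j : ℕ):ℤ) • ((1,0):Site) ∈ D' := by
      intro j
      induction j with
      | zero => intro _; simpa using this
      | succ j ih =>
        intro hj
        have h1 := ih (by omega)
        by_contra hn
        have : ((x + ((k - j : ℕ):ℤ) • ((1,0):Site)), ((-1,0):Site)) ∈ bE D' := by
          rw [mem_bE]
          refine ⟨h1, mem_dirs_l, ?_⟩
          convert hn using 2
          have e : (k - j : ℕ) = (k - (j+1) : ℕ) + 1 := by omega
          rw [e]
          ext <;> simp
          omega
        rw [← h, mem_bE] at this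
        apply this.2.2
        have e : (k - j : ℕ) = (k - (j+1) : ℕ) + 1 := by omega
        have h3 := hk (k - (j+1)) (by omega)
        convert h3 using 1
        rw [e]
        ext <;> simp
        omega
    have := this k le_rfl
    simp at this
    exact hxD this
  intro D D' h
  exact Finset.Subset.antisymm (key _ _ h) (key _ _ h.symm)

theorem exit_edge {D : Finset Site} {v : Site} (hv : v ∈ D) :
    ∃ t < (bE D).card, ((v.1 + (t:ℤ), v.2), ((1,0):Site)) ∈ bE D := by
  obtain ⟨k, hk, hk'⟩ := exists_exit D hv mem_dirs_r
  refine ⟨k, ?_, ?_⟩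
  · have h1 := perim_ge D
    rw [← bE_card] at h1
    have h2 : k + 1 ≤ (D.image Prod.fst).card := by
      rw [← Finset.card_range (k+1)]
      refine Finset.card_le_card_of_injOn (fun j : ℕ => v.1 + (j:ℤ)) ?_ ?_
      · intro j hj
        have := hk j (by simp at hj; omega)
        exact Finset.mem_coe.2 (Finset.mem_image.2 ⟨_, this, by simp⟩)
      · intro a _ b _ h; simpa using h
    omega
  · rw [mem_bE]
    have e : ((v.1 + (k:ℤ), v.2) : Site) = v + (k:ℤ) • ((1,0):Site) := by ext <;> simp
    rw [e]
    exact ⟨hk k le_rfl, mem_dirs_r, hk'⟩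

theorem count_good (G : Finset (Finset Site)) (v : Site) (l : ℕ)
    (hG : ∀ D ∈ G, Good D ∧ v ∈ D ∧ edgeBdryCard D = l) : (G.card : ℝ) ≤ Real.exp (8 * l) := by
  have h1 : G.card ≤ l * 36 ^ (2 * (l - 1)) := by
    rw [← Finset.card_image_of_injective G bE_inj]
    have : G.image bE ⊆ (Finset.range l).biUnion fun t =>
        TrW (2 * (l-1)) ((v.1 + (t:ℤ), v.2), ((1,0):Site)) := by
      intro M hM
      obtain ⟨D, hD, rfl⟩ := Finset.mem_image.1 hM
      obtain ⟨hg, hvD, hl⟩ := hG D hD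
      obtain ⟨t, ht, hte⟩ := exit_edge hvD
      have := bE_trace hg hte
      rw [bE_card, hl] at this ht
      exact Finset.mem_biUnion.2 ⟨t, Finset.mem_range.2 ht, this⟩
    refine (Finset.card_le_card this).trans (Finset.card_biUnion_le.trans ?_)
    refine (Finset.sum_le_card_nsmul _ _ (36 ^ (2 * (l-1))) fun t _ => TrW_card _ _).trans ?_
    simp
  have h2 : l * 36 ^ (2 * (l - 1)) ≤ 2592 ^ l := by
    have a1 : l ≤ 2 ^ l := Nat.lt_two_pow_self.le
    have a2 : 36 ^ (2 * (l - 1)) ≤ 1296 ^ l := by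
      rw [pow_mul]; norm_num
      exact Nat.pow_le_pow_right (by norm_num) (by omega)
    calc _ ≤ 2 ^ l * 1296 ^ l := Nat.mul_le_mul a1 a2
      _ = 2592 ^ l := by rw [← mul_pow]; norm_num
  have h3 : ((2592 : ℝ)) ≤ Real.exp 8 := by
    have := Real.exp_one_gt_d9
    have h : Real.exp 8 = (Real.exp 1)^8 := by rw [← Real.exp_nat_mul]; norm_num
    rw [h]
    calc (2592:ℝ) ≤ 2.7182818283^8 := by norm_num
      _ ≤ _ := pow_le_pow_left₀ (by norm_num) this.le 8
  calc (G.card : ℝ) ≤ ((2592 ^ l : ℕ) : ℝ) := by exact_mod_cast h1.trans h2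
    _ = (2592:ℝ)^l := by push_cast; rfl
    _ ≤ (Real.exp 8)^l := pow_le_pow_left₀ (by norm_num) h3 l
    _ = Real.exp (8 * l) := by rw [← Real.exp_nat_mul]; ring_nf

theorem sum_good (G : Finset (Finset Site)) (v : Site) (n0 : ℕ) (b : ℝ) (hb : 9 ≤ b)
    (hG : ∀ D ∈ G, Good D ∧ v ∈ D ∧ n0 ≤ edgeBdryCard D) :
    ∑ D ∈ G, Real.exp (-(b * edgeBdryCard D)) ≤ 2 * Real.exp (-((b - 8) * n0)) := by
  obtain ⟨N, hN⟩ : ∃ N, ∀ D ∈ G, edgeBdryCard D < n0 + N := by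
    refine ⟨G.sup edgeBdryCard + 1, fun D hD => ?_⟩
    have := Finset.le_sup (f := edgeBdryCard) hD
    omega
  set r := Real.exp (-(b-8)) with hr
  have hr0 : 0 < r := Real.exp_pos _
  have hr1 : r ≤ 1/2 := by
    have : r ≤ Real.exp (-1) := Real.exp_le_exp.2 (by linarith)
    have h2 : Real.exp (-1) ≤ 1/2 := by
      rw [Real.exp_neg, inv_le_comm₀ (Real.exp_pos _) (by norm_num)]
      have := Real.exp_one_gt_d9; norm_num; linarith
    linarith
  have hmap : ∀ D ∈ G, edgeBdryCard D ∈ Finset.Ico n0 (n0 + N) := fun D hD =>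
    Finset.mem_Ico.2 ⟨(hG D hD).2.2, hN D hD⟩
  rw [← Finset.sum_fiberwise_of_maps_to hmap]
  have : ∀ l ∈ Finset.Ico n0 (n0 + N), ∑ D ∈ G with edgeBdryCard D = l,
      Real.exp (-(b * edgeBdryCard D)) ≤ r ^ l := by
    intro l _
    have hc := count_good (G.filter fun D => edgeBdryCard D = l) v l (by
      intro D hD
      rw [Finset.mem_filter] at hD
      exact ⟨(hG D hD.1).1, (hG D hD.1).2.1, hD.2⟩)
    calc _ = ∑ D ∈ G with edgeBdryCard D = l, Real.exp (-(b * l)) := by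
          refine Finset.sum_congr rfl fun D hD => ?_
          rw [(Finset.mem_filter.1 hD).2]
      _ = _ := by rw [Finset.sum_const, nsmul_eq_mul]
      _ ≤ Real.exp (8 * l) * Real.exp (-(b * l)) :=
          mul_le_mul_of_nonneg_right hc (Real.exp_pos _).le
      _ = r ^ l := by rw [hr, ← Real.exp_add, ← Real.exp_nat_mul]; ring_nf
  refine (Finset.sum_le_sum this).trans ?_
  rw [Finset.sum_Ico_eq_sum_range]
  simp only [Nat.add_sub_cancel_left, pow_add]
  rw [← Finset.mul_sum]
  have hgeo : ∑ i ∈ Finset.range N, r ^ i ≤ 2 := by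
    have : ∑ i ∈ Finset.range N, r ^ i ≤ ∑ i ∈ Finset.range N, (1/2:ℝ) ^ i :=
      Finset.sum_le_sum fun i _ => pow_le_pow_left₀ hr0.le hr1 i
    refine this.trans ?_
    exact sum_geometric_two_le N
  have he : r ^ n0 = Real.exp (-((b - 8) * n0)) := by
    rw [hr, ← Real.exp_nat_mul]; ring_nf
  rw [← he, mul_comm]
  exact mul_le_mul_of_nonneg_right hgeo (by positivity)

end

open scoped BigOperators ENNReal
open Filter

noncomputable section
attribute [local instance] Classical.propDecidable

/-! ### Isoperimetry -/

/-- sets of contour diameter at most `B` -/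
def small (B : ℝ) (S : Set Site) : Prop :=
  ∀ x ∈ S, ∀ y ∈ S, ((max |x.1 - y.1| |x.2 - y.2| : ℤ) : ℝ) + 1 ≤ B

theorem small_anti {B : ℝ} {S T : Set Site} (h : S ⊆ T) (hT : small B T) : small B S :=
  fun x hx y hy => hT x (h hx) y (h hy)

theorem small_mono {B B' : ℝ} {S : Set Site} (h : B ≤ B') (hS : small B S) : small B' S :=
  fun x hx y hy => (hS x hx y hy).trans h

theorem card_le_B {B : ℝ} (R : Finset ℤ) (hne : R.Nonempty)
    (h : ∀ a ∈ R, ∀ b ∈ R, ((|a - b| : ℤ) : ℝ) + 1 ≤ B) : (R.card : ℝ) ≤ B := by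
  have hsub : R ⊆ Finset.Icc (R.min' hne) (R.max' hne) := fun x hx =>
    Finset.mem_Icc.2 ⟨Finset.min'_le _ _ hx, Finset.le_max' _ _ hx⟩
  have h1 := Finset.card_le_card hsub
  rw [Int.card_Icc] at h1
  have h2 := h _ (R.max'_mem hne) _ (R.min'_mem hne)
  have hle : R.min' hne ≤ R.max' hne := Finset.min'_le _ _ (R.max'_mem hne)
  rw [abs_of_nonneg (by omega)] at h2
  have h3 : (R.card : ℤ) ≤ R.max' hne - R.min' hne + 1 := by omega
  have h4 : (R.card : ℝ) ≤ ((R.max' hne - R.min' hne : ℤ) : ℝ) + 1 := by exact_mod_cast h3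
  linarith

theorem card_le_perim {B : ℝ} {D : Finset Site} (hne : D.Nonempty) (h : small B ↑D) :
    (D.card : ℝ) ≤ B * edgeBdryCard D := by
  have h1 : (D.image Prod.snd).card ≤ B := by
    refine card_le_B _ (hne.image _) ?_
    intro a ha b hb
    obtain ⟨x, hx, rfl⟩ := Finset.mem_image.1 ha
    obtain ⟨y, hy, rfl⟩ := Finset.mem_image.1 hb
    refine le_trans ?_ (h x hx y hy)
    gcongr
    exact le_max_right _ _
  have h2 : D.card ≤ (D.image Prod.fst).card * (D.image Prod.snd).card := by
    rw [← Finset.card_product]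
    refine Finset.card_le_card fun x hx => Finset.mem_product.2
      ⟨Finset.mem_image_of_mem _ hx, Finset.mem_image_of_mem _ hx⟩
  have h3 := perim_ge D
  have h4 : (D.image Prod.fst).card ≤ edgeBdryCard D := by omega
  calc (D.card : ℝ) ≤ (D.image Prod.fst).card * (D.image Prod.snd).card := by exact_mod_cast h2
    _ ≤ edgeBdryCard D * B := by gcongr
    _ = _ := mul_comm _ _

theorem ivt_proj (f : Site → ℤ) (hf : ∀ a b, starAdj a b → f b ≤ f a + 1) {D : Set Site} {x y : Site}
    (hx : x ∈ D) (h : Relation.ReflTransGen (fun a b => starAdj a b ∧ a ∈ D ∧ b ∈ D) x y) :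
    ∀ c, f x ≤ c → c ≤ f y → ∃ z ∈ D, f z = c := by
  induction h with
  | refl => intro c h1 h2; exact ⟨x, hx, by omega⟩
  | @tail a b _ hab ih =>
    intro c h1 h2
    by_cases h : c ≤ f a
    · exact ih c h1 h
    · have := hf a b hab.1
      exact ⟨b, hab.2.2, by omega⟩

theorem perim_ge_proj (f : Site → ℤ) (hf : ∀ a b, starAdj a b → f b ≤ f a + 1) {D : Finset Site}
    (hD : starConn (↑D : Set Site)) {x y : Site} (hx : x ∈ D) (hy : y ∈ D) :
    |f x - f y| + 1 ≤ ((D.image f).card : ℤ) := by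
  wlog hxy : f x ≤ f y generalizing x y
  · rw [abs_sub_comm]; exact this hy hx (by omega)
  have : Finset.Icc (f x) (f y) ⊆ D.image f := by
    intro c hc
    rw [Finset.mem_Icc] at hc
    obtain ⟨z, hz, rfl⟩ := ivt_proj f hf hx (hD x hx y hy) c hc.1 hc.2
    exact Finset.mem_image_of_mem _ hz
  have := Finset.card_le_card this
  rw [Int.card_Icc] at this
  rw [abs_sub_comm, abs_of_nonneg (by omega)]
  omega

theorem perim_gt_of_not_small {B : ℝ} {D : Finset Site} (hD : starConn (↑D : Set Site))
    (h : ¬ small B ↑D) : B < edgeBdryCard D := by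
  unfold small at h
  push Not at h
  obtain ⟨x, hx, y, hy, hxy⟩ := h
  have h1 := perim_ge_proj Prod.fst (by
    intro a b hab
    have := abs_le.1 hab.2.1; omega) hD hx hy
  have h2 := perim_ge_proj Prod.snd (by
    intro a b hab
    have := abs_le.1 hab.2.2; omega) hD hx hy
  have h3 := perim_ge D
  have h4 : max |x.1 - y.1| |x.2 - y.2| + 1 ≤ (edgeBdryCard D : ℤ) := by omega
  have : ((max |x.1 - y.1| |x.2 - y.2| : ℤ) : ℝ) + 1 ≤ edgeBdryCard D := by exact_mod_cast h4
  linarith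

/-! ### Energy -/

/-- indicator bump -/
def bump (C : Finset Site) (ψ : Site → ℤ) : Site → ℤ := fun u => ψ u + if u ∈ C then 1 else 0

/-- indicator dent -/
def dent (C : Finset Site) (ψ : Site → ℤ) : Site → ℤ := fun u => ψ u - if u ∈ C then 1 else 0

theorem bump_inj (C : Finset Site) : Function.Injective (bump C) := by
  intro ψ φ h
  funext u
  have := congrFun h u
  simpa [bump] using this

theorem dent_inj (C : Finset Site) : Function.Injective (dent C) := by
  intro ψ φ h
  funext u
  have := congrFun h u
  simpa [dent] using this

theorem bump_mem {C : Finset Site} {ψ : Site → ℤ} {u : Site} (h : u ∈ C) : bump C ψ u = ψ u + 1 := by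
  simp [bump, h]
theorem bump_not {C : Finset Site} {ψ : Site → ℤ} {u : Site} (h : u ∉ C) : bump C ψ u = ψ u := by
  simp [bump, h]
theorem dent_mem {C : Finset Site} {ψ : Site → ℤ} {u : Site} (h : u ∈ C) : dent C ψ u = ψ u - 1 := by
  simp [dent, h]
theorem dent_not {C : Finset Site} {ψ : Site → ℤ} {u : Site} (h : u ∉ C) : dent C ψ u = ψ u := by
  simp [dent, h]
theorem bump_ge (C : Finset Site) (ψ : Site → ℤ) (u : Site) : ψ u ≤ bump C ψ u := by
  unfold bump; split_ifs <;> omega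

theorem bdry_in_card (V C : Finset Site) (hC : C ⊆ V) :
    ((V ×ˢ dirs).filter fun e => e.1 ∉ C ∧ e.1 + e.2 ∈ C).card =
      ((bE C).filter fun e => e.1 + e.2 ∈ V).card := by
  refine Finset.card_bij' (fun e _ => (e.1 + e.2, -e.2)) (fun e _ => (e.1 + e.2, -e.2)) ?_ ?_ ?_ ?_
  · intro e he
    simp only [Finset.mem_filter, Finset.mem_product, mem_bE] at he ⊢
    simp only [add_neg_cancel_right]
    exact ⟨⟨he.2.2, neg_mem_dirs he.1.2, he.2.1⟩, he.1.1⟩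
  · intro e he
    simp only [Finset.mem_filter, Finset.mem_product, mem_bE] at he ⊢
    simp only [add_neg_cancel_right]
    exact ⟨⟨he.2, neg_mem_dirs he.1.2.1⟩, he.1.2.2, he.1.1⟩
  · intro e he; simp
  · intro e he; simp

theorem energy_bump {V C : Finset Site} (hC : C ⊆ V) {ψ : Site → ℤ}
    (h : ∀ u ∈ C, ∀ d ∈ dirs, u + d ∉ C → ψ u < ψ (u + d)) :
    sosEnergy V ψ = sosEnergy V (bump C ψ) + edgeBdryCard C := by
  unfold sosEnergy
  rw [← Finset.sum_product', ← Finset.sum_product']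
  have key : ∀ e ∈ V ×ˢ dirs,
      (if e.1 + e.2 ∈ V then (1 : ℝ) / 2 else 1) * |(ψ e.1 : ℝ) - (ψ (e.1 + e.2) : ℝ)| =
      (if e.1 + e.2 ∈ V then (1 : ℝ) / 2 else 1) * |(bump C ψ e.1 : ℝ) - (bump C ψ (e.1 + e.2) : ℝ)|
      + ((if e.1 ∈ C ∧ e.1 + e.2 ∉ C then (if e.1 + e.2 ∈ V then (1 : ℝ) / 2 else 1) else 0)
        + (if e.1 ∉ C ∧ e.1 + e.2 ∈ C then (1:ℝ)/2 else 0)) := by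
    intro e he
    rw [Finset.mem_product] at he
    by_cases h1 : e.1 ∈ C <;> by_cases h2 : e.1 + e.2 ∈ C
    · simp [bump, h1, h2]
    · have h3 := h _ h1 _ he.2 h2
      simp only [bump, h1, h2, if_true, if_false, add_zero, not_true, not_false_iff, and_true, and_false,
        true_and]
      have a1 : ((ψ e.1 : ℝ) - (ψ (e.1 + e.2) : ℝ)) ≤ -1 := by
        have : (ψ e.1 : ℝ) + 1 ≤ ψ (e.1 + e.2) := by exact_mod_cast h3
        linarith
      push_cast
      rw [abs_of_nonpos (by linarith), abs_of_nonpos (by linarith)]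
      ring
    · have h3 := h _ h2 _ (neg_mem_dirs he.2) (by simpa using h1)
      rw [add_neg_cancel_right] at h3
      have hV := hC h2
      simp only [bump, h1, h2, hV, if_true, if_false, add_zero, not_true, not_false_iff, and_true,
        and_false, zero_add]
      have a1 : (1:ℝ) ≤ ((ψ e.1 : ℝ) - (ψ (e.1 + e.2) : ℝ)) := by
        have : (ψ (e.1 + e.2) : ℝ) + 1 ≤ ψ e.1 := by exact_mod_cast h3
        linarith
      push_cast
      rw [abs_of_nonneg (by linarith), abs_of_nonneg (by linarith)]
      ring
    · simp [bump, h1, h2]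
  rw [Finset.sum_congr rfl key, Finset.sum_add_distrib, Finset.sum_add_distrib]
  congr 1
  rw [← Finset.sum_filter, ← Finset.sum_filter]
  have e1 : (V ×ˢ dirs).filter (fun e => e.1 ∈ C ∧ e.1 + e.2 ∉ C) = bE C := by
    ext e
    simp only [Finset.mem_filter, Finset.mem_product, mem_bE]
    constructor
    · rintro ⟨⟨_, a⟩, b, c⟩; exact ⟨b, a, c⟩
    · rintro ⟨a, b, c⟩; exact ⟨⟨hC a, b⟩, a, c⟩
  rw [e1, Finset.sum_const, bdry_in_card V C hC, nsmul_eq_mul, ← bE_card, Finset.card_filter]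
  push_cast
  rw [Finset.sum_mul, ← Finset.sum_add_distrib, Finset.card_eq_sum_ones]
  push_cast
  refine Finset.sum_congr rfl fun e _ => ?_
  split_ifs <;> norm_num

theorem energy_neg (V : Finset Site) (ψ : Site → ℤ) : sosEnergy V (fun u => - ψ u) = sosEnergy V ψ := by
  unfold sosEnergy
  refine Finset.sum_congr rfl fun v _ => Finset.sum_congr rfl fun d _ => ?_
  congr 1
  push_cast
  rw [← abs_neg]; congr 1; ring

theorem energy_dent {V C : Finset Site} (hC : C ⊆ V) {ψ : Site → ℤ}
    (h : ∀ u ∈ C, ∀ d ∈ dirs, u + d ∉ C → ψ (u + d) < ψ u) :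
    sosEnergy V ψ = sosEnergy V (dent C ψ) + edgeBdryCard C := by
  have := energy_bump hC (ψ := fun u => - ψ u) (fun u hu d hd hn => by
    have := h u hu d hd hn
    omega)
  rw [energy_neg] at this
  rw [this, ← energy_neg V (dent C ψ)]
  congr 2
  funext u
  simp [bump, dent]; ring

theorem field_bump {V C : Finset Site} (hC : C ⊆ V) (ψ : Site → ℤ) :
    sosField V (bump C ψ) = sosField V ψ + C.card := by
  unfold sosField bump
  push_cast
  rw [Finset.sum_add_distrib]
  congr 1
  rw [← Finset.sum_filter, Finset.filter_mem_eq_inter, Finset.inter_eq_right.2 hC]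
  simp

theorem field_dent {V C : Finset Site} (hC : C ⊆ V) (ψ : Site → ℤ) :
    sosField V ψ = sosField V (dent C ψ) + C.card := by
  rw [← field_bump hC]
  congr 1
  funext u
  simp [bump, dent]

theorem wt_bump {β lam B : ℝ} (hl : 0 ≤ lam) (hB : lam * B ≤ 1) {V C : Finset Site} (hC : C ⊆ V)
    (hne : C.Nonempty) (hs : small B ↑C) {ψ : Site → ℤ}
    (h : ∀ u ∈ C, ∀ d ∈ dirs, u + d ∉ C → ψ u < ψ (u + d)) :
    sosWt β lam V ψ ≤ Real.exp (-((β - 1) * edgeBdryCard C)) * sosWt β lam V (bump C ψ) := by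
  unfold sosWt
  rw [← Real.exp_add, Real.exp_le_exp, energy_bump hC h, field_bump hC]
  have h1 := card_le_perim hne hs
  have h2 : lam * C.card ≤ edgeBdryCard C := by
    calc lam * C.card ≤ lam * (B * edgeBdryCard C) := by gcongr
      _ = (lam * B) * edgeBdryCard C := by ring
      _ ≤ 1 * edgeBdryCard C := by gcongr
      _ = _ := one_mul _
  nlinarith

theorem wt_bump_one {β lam : ℝ} {V : Finset Site} {v : Site} (hv : v ∈ V) {ψ : Site → ℤ}
    (h : ∀ d ∈ dirs, ψ v < ψ (v + d)) :
    sosWt β lam V ψ ≤ Real.exp (-4 * β + lam) * sosWt β lam V (bump {v} ψ) := by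
  unfold sosWt
  have hs : ({v} : Finset Site) ⊆ V := by simpa using hv
  rw [← Real.exp_add, Real.exp_le_exp, energy_bump hs (by
    intro u hu d hd _
    rw [Finset.mem_singleton] at hu
    rw [hu]; exact h d hd), field_bump hs]
  have : edgeBdryCard {v} = 4 := by
    unfold edgeBdryCard
    rw [Finset.sum_singleton, Finset.filter_true_of_mem]
    · rfl
    · intro d hd
      rw [Finset.mem_singleton]
      exact (adjS_ne (adjS_add hd)).symm
  rw [this]
  simp
  linarith

theorem wt_dent {β lam : ℝ} (hl : 0 ≤ lam) {V C : Finset Site} (hC : C ⊆ V)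
    {ψ : Site → ℤ} (h : ∀ u ∈ C, ∀ d ∈ dirs, u + d ∉ C → ψ (u + d) < ψ u) :
    sosWt β lam V ψ ≤ Real.exp (-(β * edgeBdryCard C)) * sosWt β lam V (dent C ψ) := by
  unfold sosWt
  rw [← Real.exp_add, Real.exp_le_exp, energy_dent hC h, field_dent hC]
  have : 0 ≤ lam * C.card := by positivity
  nlinarith

end

open scoped BigOperators
open Filter

noncomputable section
attribute [local instance] Classical.propDecidable

/-! ### Partition functions -/

theorem summable_pi_geom (r : ℝ) (h0 : 0 ≤ r) (h1 : r < 1) (N : ℕ) :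
    Summable (fun x : Fin N → ℕ => ∏ i, r ^ x i) := by
  induction N with
  | zero => exact Summable.of_finite
  | succ N ih =>
    rw [← (Fin.consEquiv (fun _ : Fin (N+1) => ℕ)).summable_iff]
    have := Summable.mul_of_nonneg (summable_geometric_of_lt_one h0 h1) ih
      (fun _ => by positivity) (fun _ => by positivity)
    refine this.congr fun x => ?_
    simp [Fin.prod_univ_succ, Fin.consEquiv]

/-- model parameters -/
structure Par where
  β : ℝ
  lam : ℝ
  n : ℕ
  L : ℤ
  hβ : 100 ≤ β
  hl : 0 < lam
  hl1 : lam ≤ Real.exp (-β)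

namespace Par
variable (p : Par)

/-- volume -/
def V : Finset Site := box p.n

/-- weight -/
def w (ψ : Site → ℤ) : ℝ := sosWt p.β p.lam p.V ψ

/-- configurations with boundary height `L` and floor `-1` -/
def Om : Set (Site → ℤ) := {ψ | (∀ x, x ∉ p.V → ψ x = p.L) ∧ ∀ v ∈ p.V, -1 ≤ ψ v}

theorem w_pos (ψ : Site → ℤ) : 0 < p.w ψ := Real.exp_pos _

theorem energy_nonneg (V : Finset Site) (ψ : Site → ℤ) : 0 ≤ sosEnergy V ψ := by
  unfold sosEnergy
  refine Finset.sum_nonneg fun v _ => Finset.sum_nonneg fun d _ => ?_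
  split_ifs <;> positivity

theorem summ_Om : Summable (Set.indicator p.Om p.w) := by
  rw [← summable_subtype_iff_indicator]
  let e := p.V.equivFin
  let f : p.Om → (Fin p.V.card → ℕ) := fun ψ i => (ψ.1 (e.symm i) + 1).toNat
  have hf : Function.Injective f := by
    intro ψ φ h
    apply Subtype.ext
    funext x
    by_cases hx : x ∈ p.V
    · have := congrFun h (e ⟨x, hx⟩)
      simp only [f, Equiv.symm_apply_apply] at this
      have h1 := ψ.2.2 x hx
      have h2 := φ.2.2 x hx
      omega
    · rw [ψ.2.1 x hx, φ.2.1 x hx]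
  have hr1 : Real.exp (-p.lam) < 1 := by
    rw [Real.exp_lt_one_iff]; linarith [p.hl]
  have h1 := ((summable_pi_geom (Real.exp (-p.lam)) (Real.exp_pos _).le hr1 p.V.card).comp_injective hf).mul_left
    (Real.exp (p.lam * p.V.card))
  refine Summable.of_nonneg_of_le (fun ψ => (p.w_pos _).le) (fun ψ => ?_) h1
  simp only [Function.comp]
  have h2 : ∏ i, Real.exp (-p.lam) ^ f ψ i = Real.exp (-p.lam * ∑ v ∈ p.V, ((ψ.1 v : ℝ) + 1)) := by
    rw [Finset.mul_sum, Real.exp_sum, ← Finset.prod_coe_sort p.V, ← Equiv.prod_comp e.symm]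
    refine Finset.prod_congr rfl fun i _ => ?_
    rw [← Real.exp_nat_mul]
    congr 1
    have h3 := ψ.2.2 _ (e.symm i).2
    have h4 : ((f ψ i : ℕ) : ℝ) = (ψ.1 (e.symm i) : ℝ) + 1 := by
      have : ((f ψ i : ℕ) : ℤ) = ψ.1 (e.symm i) + 1 := by simp only [f]; omega
      exact_mod_cast this
    rw [h4]; ring
  rw [h2, ← Real.exp_add]
  unfold w sosWt
  rw [Real.exp_le_exp, Finset.sum_add_distrib]
  have h3 := energy_nonneg p.V ψ.1
  have h4 : 0 ≤ p.β * sosEnergy p.V ψ.1 := mul_nonneg (by linarith [p.hβ]) h3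
  unfold sosField
  simp
  linarith

/-- partition function of a set of configurations -/
def Z (A : Set (Site → ℤ)) : ℝ := ∑' ψ, Set.indicator (A ∩ p.Om) p.w ψ

theorem summ (A : Set (Site → ℤ)) : Summable (Set.indicator (A ∩ p.Om) p.w) := by
  have := p.summ_Om.indicator A
  rwa [Set.indicator_indicator] at this

theorem ind_nonneg (A : Set (Site → ℤ)) (ψ : Site → ℤ) : 0 ≤ Set.indicator A p.w ψ :=
  Set.indicator_nonneg (fun ψ _ => (p.w_pos ψ).le) ψ

theorem Z_nonneg (A : Set (Site → ℤ)) : 0 ≤ p.Z A := tsum_nonneg fun ψ => p.ind_nonneg _ ψ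

theorem Z_mono {A A' : Set (Site → ℤ)} (h : ∀ ψ ∈ A, ψ ∈ p.Om → ψ ∈ A') : p.Z A ≤ p.Z A' := by
  refine (p.summ A).tsum_le_tsum (fun ψ => ?_) (p.summ A')
  exact Set.indicator_le_indicator_of_subset (s := A ∩ p.Om) (t := A' ∩ p.Om) (fun ψ hψ => ⟨h ψ hψ.1 hψ.2, hψ.2⟩)
    (fun ψ => (p.w_pos ψ).le) ψ

theorem Z_sum_le {ι : Type*} (s : Finset ι) (t : ι → Set (Site → ℤ)) {A : Set (Site → ℤ)}
    (h : ∀ ψ ∈ A, ψ ∈ p.Om → ∃ i ∈ s, ψ ∈ t i) : p.Z A ≤ ∑ i ∈ s, p.Z (t i) := by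
  unfold Z
  rw [← Summable.tsum_finsetSum (fun i _ => p.summ (t i))]
  refine (p.summ A).tsum_le_tsum (fun ψ => ?_) (summable_sum fun i _ => p.summ (t i))
  by_cases hψ : ψ ∈ A ∩ p.Om
  · obtain ⟨i, hi, hit⟩ := h ψ hψ.1 hψ.2
    rw [Set.indicator_of_mem hψ]
    refine le_trans ?_ (Finset.single_le_sum (fun j _ => p.ind_nonneg (t j ∩ p.Om) ψ) hi)
    rw [Set.indicator_of_mem (show ψ ∈ t i ∩ p.Om from ⟨hit, hψ.2⟩)]
  · rw [Set.indicator_of_notMem hψ]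
    exact Finset.sum_nonneg fun j _ => p.ind_nonneg _ _

theorem Z_add_le {A A' A'' : Set (Site → ℤ)} (h : ∀ ψ ∈ A, ψ ∈ p.Om → ψ ∈ A' ∨ ψ ∈ A'') :
    p.Z A ≤ p.Z A' + p.Z A'' := by
  have := p.Z_sum_le (Finset.univ : Finset Bool) (fun b => cond b A' A'') (A := A) (by
    intro ψ h1 h2
    rcases h ψ h1 h2 with h | h
    · exact ⟨true, Finset.mem_univ _, h⟩
    · exact ⟨false, Finset.mem_univ _, h⟩)
  simpa using this

theorem Z_disj {A A' A'' : Set (Site → ℤ)} (hd : ∀ ψ ∈ A, ψ ∈ A' → False) (h : ∀ ψ ∈ A, ψ ∈ A'')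
    (h' : ∀ ψ ∈ A', ψ ∈ A'') : p.Z A + p.Z A' ≤ p.Z A'' := by
  unfold Z
  rw [← (p.summ A).tsum_add (p.summ A')]
  refine ((p.summ A).add (p.summ A')).tsum_le_tsum (fun ψ => ?_) (p.summ A'')
  by_cases h1 : ψ ∈ A ∩ p.Om
  · have h2 : ψ ∉ A' ∩ p.Om := fun hc => hd ψ h1.1 hc.1
    rw [Set.indicator_of_mem h1, Set.indicator_of_notMem h2, Set.indicator_of_mem (show ψ ∈ A'' ∩ p.Om from ⟨h ψ h1.1, h1.2⟩), add_zero]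
  · rw [Set.indicator_of_notMem h1, zero_add]
    exact Set.indicator_le_indicator_of_subset (s := A' ∩ p.Om) (t := A'' ∩ p.Om) (fun ψ hψ => ⟨h' ψ hψ.1, hψ.2⟩)
      (fun ψ => (p.w_pos ψ).le) ψ

theorem Z_inj {A A' : Set (Site → ℤ)} (f : (Site → ℤ) → (Site → ℤ))
    (hi : Set.InjOn f (A ∩ p.Om)) (hm : ∀ ψ ∈ A, ψ ∈ p.Om → f ψ ∈ A' ∧ f ψ ∈ p.Om) (c : ℝ) (hc : 0 ≤ c)
    (hw : ∀ ψ ∈ A, ψ ∈ p.Om → p.w ψ ≤ c * p.w (f ψ)) : p.Z A ≤ c * p.Z A' := by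
  unfold Z
  rw [← tsum_subtype, ← tsum_subtype]
  let g : ↑(A ∩ p.Om) → ↑(A' ∩ p.Om) := fun ψ => ⟨f ψ.1, hm ψ.1 ψ.2.1 ψ.2.2⟩
  have hg : Function.Injective g := by
    intro a b h
    exact Subtype.ext (hi a.2 b.2 (congrArg Subtype.val h))
  have s1 : Summable (fun x : ↑(A ∩ p.Om) => p.w x) := summable_subtype_iff_indicator.2 (p.summ A)
  have s2 : Summable (fun x : ↑(A' ∩ p.Om) => p.w x) := summable_subtype_iff_indicator.2 (p.summ A')
  rw [← tsum_mul_left]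
  refine s1.tsum_le_tsum_of_inj g hg (fun _ _ => mul_nonneg hc (p.w_pos _).le) (fun x => ?_) (s2.mul_left c)
  exact hw x.1 x.2.1 x.2.2

theorem Z_pos {A : Set (Site → ℤ)} {ψ : Site → ℤ} (h : ψ ∈ A) (h' : ψ ∈ p.Om) : 0 < p.Z A := by
  refine (p.summ A).tsum_pos (fun φ => p.ind_nonneg _ φ) ψ ?_
  rw [Set.indicator_of_mem (show ψ ∈ A ∩ p.Om from ⟨h, h'⟩)]
  exact p.w_pos ψ

end Par
end

open scoped BigOperators
open Filter

noncomputable section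
attribute [local instance] Classical.propDecidable

/-! ### Low sites -/

/-- restriction of a set to a finite set, as a finset -/
def fin (R : Finset Site) (S : Set Site) : Finset Site := R.filter fun u => u ∈ S

theorem coe_fin {R : Finset Site} {S : Set Site} (h : S ⊆ ↑R) : (↑(fin R S) : Set Site) = S := by
  ext u; simp only [fin, Finset.coe_filter, Set.mem_ofPred_eq]
  exact ⟨fun h => h.2, fun hu => ⟨h hu, hu⟩⟩

theorem mem_fin {R : Finset Site} {S : Set Site} {u : Site} : u ∈ fin R S ↔ u ∈ R ∧ u ∈ S := by
  simp [fin]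

theorem fin_sub (R : Finset Site) (S : Set Site) : fin R S ⊆ R := Finset.filter_subset _ _

/-- fill-closed -/
def FC (R : Finset Site) : Prop := ∀ C : Set Site, C ⊆ ↑R → fill C ⊆ ↑R

theorem FC_box (n : ℕ) : FC (box n) := fun _ h => fill_box h

theorem good_fin {n : ℕ} {R : Finset Site} (hR : R ⊆ box n) (hF : FC R) {S : Set Site} (hS : S ⊆ ↑R)
    {v : Site} (hv : v ∈ S) :
    Good (fin R (fill (compStar S v))) ∧ v ∈ fin R (fill (compStar S v)) ∧
      (↑(fin R (fill (compStar S v))) : Set Site) = fill (compStar S v) := by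
  have h1 : compStar S v ⊆ ↑R := (compStar_sub hv).trans hS
  have h2 := coe_fin (hF _ h1)
  have h3 : v ∈ fin R (fill (compStar S v)) :=
    mem_fin.2 ⟨hS hv, subset_fill _ (compStar_self S v)⟩
  refine ⟨⟨⟨v, h3⟩, ?_, ?_⟩, h3, h2⟩
  · rw [h2]; exact fill_starConn hv
  · rw [h2]; exact fill_compl_conn (n := n) (h1.trans (by exact_mod_cast hR))

theorem le_exp_of_le {x a q : ℝ} (ha : 0 ≤ a) (h : x ≤ a + q * x) (h0 : 0 ≤ q) (h1 : q ≤ 1/2) :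
    x ≤ Real.exp (2 * q) * a := by
  have h2 : 1 + 2 * q ≤ Real.exp (2 * q) := by linarith [Real.add_one_le_exp (2 * q)]
  have h3 : (1 - q) * x ≤ a := by linarith
  have h4 : (1 + 2 * q) * a ≤ Real.exp (2 * q) * a := by gcongr
  have h5 : 1 ≤ (1 + 2 * q) * (1 - q) := by nlinarith
  by_cases hx : x ≤ 0
  · exact hx.trans (by positivity)
  · push Not at hx
    have h6 : (1 + 2 * q) * ((1 - q) * x) ≤ (1 + 2 * q) * a := by gcongr
    nlinarith

namespace Par
variable (p : Par)

/-- low cluster -/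
def lowS (R : Finset Site) (ψ : Site → ℤ) (m : ℤ) : Set Site := {u | u ∈ R ∧ ψ u ≤ m}

/-- filled low cluster -/
def lowF (R : Finset Site) (ψ : Site → ℤ) (m : ℤ) (v : Site) : Finset Site :=
  fin R (fill (compStar (lowS R ψ m) v))

/-- raise-closed families -/
structure RC (R : Finset Site) (B : ℝ) (Q : Set (Site → ℤ)) : Prop where
  sub : R ⊆ p.V
  fc : FC R
  bd : ∀ ψ ∈ Q, ψ ∈ p.Om → ∀ y ∈ R, ∀ d ∈ dirs, y + d ∉ R → ψ y < p.L → p.L ≤ ψ (y + d)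
  up : ∀ ψ ∈ Q, ψ ∈ p.Om → ∀ v ∈ R, ∀ m < p.L, ψ v ≤ m →
    small B ↑(lowF R ψ m v) ∧ bump (lowF R ψ m v) ψ ∈ Q

/-- single-site cost -/
def s : ℝ := Real.exp (-4 * p.β + p.lam)

/-- non-single cost -/
def kap : ℝ := 2 * Real.exp (-((p.β - 9) * 6))

theorem s_pos : 0 < p.s := Real.exp_pos _
theorem kap_pos : 0 < p.kap := by unfold kap; positivity

theorem lam_le_one : p.lam ≤ 1 := p.hl1.trans (Real.exp_le_one_iff.2 (by linarith [p.hβ]))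

theorem exp_one_ge_two : (2:ℝ) ≤ Real.exp 1 := by linarith [Real.add_one_le_exp (1:ℝ)]

theorem s_le : p.s ≤ 1/4 := by
  unfold s
  have h1 : Real.exp (-4 * p.β + p.lam) ≤ Real.exp (-2) :=
    Real.exp_le_exp.2 (by linarith [p.hβ, p.lam_le_one])
  have h2 : Real.exp (-2) ≤ 1/4 := by
    rw [Real.exp_neg, inv_le_comm₀ (Real.exp_pos _) (by norm_num)]
    have : Real.exp 2 = Real.exp 1 * Real.exp 1 := by rw [← Real.exp_add]; norm_num
    rw [this]; nlinarith [exp_one_ge_two]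
  linarith

theorem kap_le : 2 * p.kap ≤ p.s := by
  unfold kap s
  have h4 : (4:ℝ) ≤ Real.exp 2 := by
    have : Real.exp 2 = Real.exp 1 * Real.exp 1 := by rw [← Real.exp_add]; norm_num
    rw [this]; nlinarith [exp_one_ge_two]
  calc 2 * (2 * Real.exp (-((p.β - 9) * 6))) = 4 * Real.exp (-((p.β - 9) * 6)) := by ring
    _ ≤ Real.exp 2 * Real.exp (-((p.β - 9) * 6)) := by gcongr
    _ = Real.exp (2 + -((p.β - 9) * 6)) := by rw [Real.exp_add]
    _ ≤ _ := Real.exp_le_exp.2 (by linarith [p.hβ, p.hl])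

theorem bump_Om {C : Finset Site} (hC : C ⊆ p.V) {ψ : Site → ℤ} (h : ψ ∈ p.Om) : bump C ψ ∈ p.Om := by
  refine ⟨fun x hx => ?_, fun v hv => (h.2 v hv).trans (bump_ge C ψ v)⟩
  rw [bump_not (fun hc => hx (hC hc))]; exact h.1 x hx

variable {p}

theorem RC.facts {R : Finset Site} {B : ℝ} {Q : Set (Site → ℤ)} (h : p.RC R B Q) {ψ : Site → ℤ}
    (hQ : ψ ∈ Q) (hO : ψ ∈ p.Om) {v : Site} (hv : v ∈ R) {m : ℤ} (hm : m < p.L) (hvm : ψ v ≤ m) :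
    Good (lowF R ψ m v) ∧ v ∈ lowF R ψ m v ∧ lowF R ψ m v ⊆ p.V ∧
    ∀ u ∈ lowF R ψ m v, ∀ d ∈ dirs, u + d ∉ lowF R ψ m v → ψ u < ψ (u + d) := by
  have hvS : v ∈ lowS R ψ m := ⟨hv, hvm⟩
  obtain ⟨h1, h2, h3⟩ := good_fin (n := p.n) h.sub h.fc (S := lowS R ψ m) (fun u hu => hu.1) hvS
  refine ⟨h1, h2, (fin_sub _ _).trans h.sub, ?_⟩
  intro u hu d hd hud
  have hu' : u ∈ fill (compStar (lowS R ψ m) v) := by rw [← h3]; exact hu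
  have hud' : u + d ∉ fill (compStar (lowS R ψ m) v) := by rw [← h3]; exact hud
  obtain ⟨a, b⟩ := fill_nn_bdry hvS hu' hud' (adjS_add hd)
  by_cases hR : u + d ∈ R
  · have : ¬ ψ (u + d) ≤ m := fun hc => b ⟨hR, hc⟩
    have := a.2
    omega
  · have := h.bd ψ hQ hO u a.1 d hd hR (by have := a.2; omega)
    have := a.2
    omega

theorem lowF_bump {R : Finset Site} (hF : FC R) {ψ : Site → ℤ} {m : ℤ} {v : Site} (C : Finset Site) 
    (hv : v ∈ R) (hvm : ψ v ≤ m) :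
    lowF R ψ m v ⊆ lowF R (bump C ψ) (m+1) v := by
  intro u hu
  obtain ⟨hu1, hu2⟩ := mem_fin.1 hu
  refine mem_fin.2 ⟨hu1, fill_mono (compStar_mono ?_ v) hu2⟩
  rintro x ⟨hx1, hx2⟩
  refine ⟨hx1, ?_⟩
  unfold bump; split_ifs <;> omega

theorem sum_good_mul (G : Finset (Finset Site)) (v : Site) (n0 : ℕ) (b : ℝ) (hb : 9 ≤ b)
    (hG : ∀ D ∈ G, Good D ∧ v ∈ D ∧ n0 ≤ edgeBdryCard D) (f : Finset Site → ℝ) (z : ℝ) (hz : 0 ≤ z)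
    (hf : ∀ D ∈ G, f D ≤ Real.exp (-(b * edgeBdryCard D)) * z) :
    ∑ D ∈ G, f D ≤ 2 * Real.exp (-((b - 8) * n0)) * z := by
  refine (Finset.sum_le_sum hf).trans ?_
  rw [← Finset.sum_mul]
  exact mul_le_mul_of_nonneg_right (sum_good G v n0 b hb hG) hz

theorem RC.b_step {R : Finset Site} {B : ℝ} (hB : p.lam * B ≤ 1) {Q : Set (Site → ℤ)} (h : p.RC R B Q)
    {v : Site} (hv : v ∈ R) (m : ℤ) (hm : m < p.L) :
    p.Z {ψ | ψ ∈ Q ∧ ψ v ≤ m ∧ lowF R ψ m v ≠ {v}} ≤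
      p.kap * p.Z {ψ | ψ ∈ Q ∧ ψ v ≤ m + 1 ∧ lowF R ψ (m+1) v ≠ {v}} := by
  set Tg := {ψ | ψ ∈ Q ∧ ψ v ≤ m + 1 ∧ lowF R ψ (m+1) v ≠ {v}} with hTg
  let G := p.V.powerset.filter fun D => Good D ∧ v ∈ D ∧ 6 ≤ edgeBdryCard D
  refine (p.Z_sum_le G (fun D => {ψ | ψ ∈ Q ∧ ψ v ≤ m ∧ lowF R ψ m v ≠ {v} ∧ lowF R ψ m v = D}) ?_).trans ?_
  · rintro ψ ⟨hQ, hvm, hne⟩ hO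
    obtain ⟨g1, g2, g3, g4⟩ := h.facts hQ hO hv hm hvm
    refine ⟨lowF R ψ m v, ?_, hQ, hvm, hne, rfl⟩
    refine Finset.mem_filter.2 ⟨Finset.mem_powerset.2 g3, g1, g2, ?_⟩
    have : ∃ u ∈ lowF R ψ m v, u ≠ v := by
      by_contra hc
      push Not at hc
      exact hne (Finset.eq_singleton_iff_unique_mem.2 ⟨g2, hc⟩)
    obtain ⟨u, hu, huv⟩ := this
    exact perim_ge_six hu g2 huv
  · have := sum_good_mul G v 6 (p.β - 1) (by linarith [p.hβ]) (fun D hD => (Finset.mem_filter.1 hD).2)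
      (fun D => p.Z {ψ | ψ ∈ Q ∧ ψ v ≤ m ∧ lowF R ψ m v ≠ {v} ∧ lowF R ψ m v = D}) (p.Z Tg)
      (p.Z_nonneg _) (by
        intro D hD
        refine p.Z_inj (bump D) (bump_inj D).injOn ?_ _ (Real.exp_pos _).le ?_
        · rintro ψ ⟨hQ, hvm, hne, rfl⟩ hO
          obtain ⟨g1, g2, g3, g4⟩ := h.facts hQ hO hv hm hvm
          refine ⟨⟨(h.up ψ hQ hO v hv m hm hvm).2, ?_, ?_⟩, p.bump_Om g3 hO⟩
          · rw [bump_mem g2]; omega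
          · intro hc
            apply hne
            have := lowF_bump h.fc (lowF R ψ m v) hv hvm
            rw [hc] at this
            exact Finset.Subset.antisymm this (by simpa using g2)
        · rintro ψ ⟨hQ, hvm, hne, rfl⟩ hO
          obtain ⟨g1, g2, g3, g4⟩ := h.facts hQ hO hv hm hvm
          exact wt_bump p.hl.le hB g3 g1.1 (h.up ψ hQ hO v hv m hm hvm).1 g4)
    refine this.trans (le_of_eq ?_)
    unfold kap
    norm_num
    left
    ring

theorem RC.a_step {R : Finset Site} {B : ℝ} {Q : Set (Site → ℤ)} (h : p.RC R B Q)
    {v : Site} (hv : v ∈ R) (m : ℤ) (hm : m < p.L) :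
    p.Z {ψ | ψ ∈ Q ∧ ψ v ≤ m ∧ lowF R ψ m v = {v}} ≤
      p.s * p.Z {ψ | ψ ∈ Q ∧ ψ v ≤ m + 1} := by
  refine p.Z_inj (bump {v}) (bump_inj _).injOn ?_ _ p.s_pos.le ?_
  · rintro ψ ⟨hQ, hvm, he⟩ hO
    obtain ⟨g1, g2, g3, g4⟩ := h.facts hQ hO hv hm hvm
    have := (h.up ψ hQ hO v hv m hm hvm).2
    rw [he] at this g3
    refine ⟨⟨this, ?_⟩, p.bump_Om g3 hO⟩
    rw [bump_mem (by simp)]; omega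
  · rintro ψ ⟨hQ, hvm, he⟩ hO
    obtain ⟨g1, g2, g3, g4⟩ := h.facts hQ hO hv hm hvm
    refine wt_bump_one (h.sub hv) fun d hd => g4 v g2 d hd ?_
    rw [he, Finset.mem_singleton]
    exact (adjS_ne (adjS_add hd)).symm

/-- Lemma 1 -/
theorem RC.low {R : Finset Site} {B : ℝ} (hB : p.lam * B ≤ 1) {Q : Set (Site → ℤ)} (h : p.RC R B Q)
    {v : Site} (hv : v ∈ R) (n : ℕ) :
    p.Z {ψ | ψ ∈ Q ∧ ψ v ≤ p.L - n} ≤ 2 * p.s ^ n * p.Z Q := by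
  have hk := p.kap_pos
  have hk2 := p.kap_le
  have hs := p.s_pos
  have hZ := p.Z_nonneg Q
  have hb : ∀ n : ℕ, p.Z {ψ | ψ ∈ Q ∧ ψ v ≤ p.L - ((n:ℤ)+1) ∧ lowF R ψ (p.L - ((n:ℤ)+1)) v ≠ {v}} ≤
      p.kap ^ (n+1) * p.Z Q := by
    intro n
    induction n with
    | zero =>
      refine (h.b_step hB hv _ (by omega)).trans ?_
      rw [zero_add, pow_one]
      refine mul_le_mul_of_nonneg_left (p.Z_mono ?_) hk.le
      intro ψ hψ _; exact hψ.1
    | succ n ih =>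
      refine (h.b_step hB hv _ (by omega)).trans ?_
      rw [pow_succ', mul_assoc]
      refine mul_le_mul_of_nonneg_left ?_ hk.le
      have e : p.L - (((n+1 : ℕ) : ℤ)+1) + 1 = p.L - ((n:ℤ)+1) := by push_cast; ring
      rw [e]; exact ih
  have main : ∀ n : ℕ, p.Z {ψ | ψ ∈ Q ∧ ψ v ≤ p.L - n} ≤ (2 * p.s ^ n - p.kap ^ n) * p.Z Q := by
    intro n
    induction n with
    | zero =>
      norm_num
      exact p.Z_mono fun ψ hψ _ => hψ.1
    | succ n ih =>
      have h1 := h.a_step hv (p.L - ((n:ℤ)+1)) (by omega)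
      have h2 := hb n
      have h3 : p.Z {ψ | ψ ∈ Q ∧ ψ v ≤ p.L - ((n+1 : ℕ):ℤ)} ≤ _ := p.Z_add_le
        (A' := {ψ | ψ ∈ Q ∧ ψ v ≤ p.L - ((n:ℤ)+1) ∧ lowF R ψ (p.L - ((n:ℤ)+1)) v = {v}})
        (A'' := {ψ | ψ ∈ Q ∧ ψ v ≤ p.L - ((n:ℤ)+1) ∧ lowF R ψ (p.L - ((n:ℤ)+1)) v ≠ {v}}) (by
          rintro ψ ⟨a, b⟩ _
          push_cast at b
          by_cases hc : lowF R ψ (p.L - ((n:ℤ)+1)) v = {v}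
          · exact Or.inl ⟨a, b, hc⟩
          · exact Or.inr ⟨a, b, hc⟩)
      have e : p.L - ((n:ℤ)+1) + 1 = p.L - n := by ring
      rw [e] at h1
      have h4 : p.s * p.Z {ψ | ψ ∈ Q ∧ ψ v ≤ p.L - n} ≤ p.s * ((2 * p.s ^ n - p.kap ^ n) * p.Z Q) := by
        gcongr
      refine h3.trans ((add_le_add (h1.trans h4) h2).trans ?_)
      have h5 : 0 ≤ p.kap ^ n * p.Z Q * (p.s - 2 * p.kap) :=
        mul_nonneg (mul_nonneg (pow_nonneg hk.le n) hZ) (by linarith)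
      rw [pow_succ, pow_succ]
      nlinarith
  refine (main n).trans ?_
  have : 0 ≤ p.kap ^ n * p.Z Q := mul_nonneg (pow_nonneg hk.le n) hZ
  linarith

theorem RC.inter {R : Finset Site} {B : ℝ} {Q : Set (Site → ℤ)} (h : p.RC R B Q) (R' : Finset Site)
    (c : Site → ℤ) : p.RC R B {ψ | ψ ∈ Q ∧ ∀ u ∈ R', c u < ψ u} where
  sub := h.sub
  fc := h.fc
  bd := fun ψ hψ => h.bd ψ hψ.1
  up := fun ψ hψ hO v hv m hm hvm => ⟨(h.up ψ hψ.1 hO v hv m hm hvm).1,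
    (h.up ψ hψ.1 hO v hv m hm hvm).2, fun u hu => (hψ.2 u hu).trans_le (bump_ge _ _ _)⟩

/-- Lemma 2 -/
theorem RC.seq {R : Finset Site} {B : ℝ} (hB : p.lam * B ≤ 1) {Q : Set (Site → ℤ)} (h : p.RC R B Q)
    (n : ℕ) (hn : 1 ≤ n) (c : Site → ℤ) (R' : Finset Site) (hR' : R' ⊆ R)
    (hc : ∀ u ∈ R', c u ≤ p.L - n) :
    p.Z Q ≤ Real.exp (4 * p.s ^ n * R'.card) * p.Z {ψ | ψ ∈ Q ∧ ∀ u ∈ R', c u < ψ u} := by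
  induction R' using Finset.induction_on with
  | empty => simp
  | @insert v R'' hv ih =>
    have h1 := ih (fun u hu => hR' (Finset.mem_insert_of_mem hu)) (fun u hu => hc u (Finset.mem_insert_of_mem hu))
    have hs : p.s ^ n ≤ 1/4 := by
      calc p.s ^ n ≤ p.s ^ 1 := pow_le_pow_of_le_one p.s_pos.le (by linarith [p.s_le]) hn
        _ ≤ 1/4 := by rw [pow_one]; exact p.s_le
    have h2 := (h.inter R'' c).low hB (hR' (Finset.mem_insert_self _ _)) n
    have h3 : p.Z {ψ | ψ ∈ Q ∧ ∀ u ∈ R'', c u < ψ u} ≤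
        Real.exp (2 * (2 * p.s ^ n)) * p.Z {ψ | ψ ∈ Q ∧ ∀ u ∈ insert v R'', c u < ψ u} := by
      refine le_exp_of_le (p.Z_nonneg _) ?_ (by have := p.s_pos; positivity) (by linarith)
      refine (p.Z_add_le (A' := {ψ | ψ ∈ Q ∧ ∀ u ∈ insert v R'', c u < ψ u})
        (A'' := {ψ | ψ ∈ {ψ | ψ ∈ Q ∧ ∀ u ∈ R'', c u < ψ u} ∧ ψ v ≤ p.L - n}) ?_).trans (by gcongr)
      rintro ψ ⟨a, b⟩ _
      by_cases hlt : c v < ψ v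
      · left; exact ⟨a, Finset.forall_mem_insert _ _ _ |>.2 ⟨hlt, b⟩⟩
      · right; exact ⟨⟨a, b⟩, (not_lt.1 hlt).trans (hc v (Finset.mem_insert_self _ _))⟩
    rw [Finset.card_insert_of_notMem hv]
    calc _ ≤ _ := h1
      _ ≤ Real.exp (4 * p.s ^ n * R''.card) * (Real.exp (2 * (2 * p.s ^ n)) *
        p.Z {ψ | ψ ∈ Q ∧ ∀ u ∈ insert v R'', c u < ψ u}) := by gcongr
      _ = _ := by rw [← mul_assoc, ← Real.exp_add]; push_cast; ring_nf

end Par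
end

open scoped BigOperators
open Filter

noncomputable section
attribute [local instance] Classical.propDecidable

namespace Par
variable (p : Par)

/-! ### Contour erasure -/

/-- up sites -/
def upS (ψ : Site → ℤ) : Set Site := {u | u ∈ p.V ∧ p.L < ψ u}
/-- down sites -/
def dnS (ψ : Site → ℤ) : Set Site := {u | u ∈ p.V ∧ ψ u < p.L}
/-- deviating sites -/
def devS (ψ : Site → ℤ) : Set Site := {u | u ∈ p.V ∧ ψ u ≠ p.L}

/-- floor constraint -/
def OmF (fl : Site → ℤ) : Set (Site → ℤ) := {ψ | ∀ v ∈ p.V, fl v ≤ ψ v}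

variable {p}

theorem FC_V : FC p.V := FC_box p.n

theorem FC_of_fill {D : Finset Site} {K : Set Site} (h : (↑D : Set Site) = fill K) : FC D := by
  intro C hC
  rw [h] at hC ⊢
  exact fill_sub_fill hC

theorem erase {fl : Site → ℤ} {a : ℕ} {B : ℝ} (hB : p.lam * B ≤ 1)
    (hsB : 4 * p.s ^ (a+1) * B ≤ 1)
    (hfl0 : ∀ u ∈ p.V, 0 ≤ fl u) (hfl : ∀ u ∈ p.V, fl u ≤ p.L - a)
    {A : Set (Site → ℤ)} {A' : Finset Site → Set (Site → ℤ)} {v : Site} (hv : v ∈ p.V)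
    (h1 : ∀ ψ ∈ A, ψ ∈ p.Om → ψ ∈ p.OmF fl ∧ ψ v ≠ p.L ∧ small B (fill (compStar (p.devS ψ) v)))
    (h2 : ∀ ψ ∈ A, ψ ∈ p.Om → ∀ D : Finset Site, v ∈ D → (↑D : Set Site) ⊆ fill (compStar (p.devS ψ) v) →
      ((↑D : Set Site) = fill (compStar (p.upS ψ) v) ∧ p.L < ψ v ∨
       (↑D : Set Site) = fill (compStar (p.dnS ψ) v) ∧ ψ v < p.L) →
      ∀ φ ∈ p.Om, φ ∈ p.OmF fl → (∀ u, u ∉ D → φ u = ψ u) → φ ∈ A' D) :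
    p.Z A ≤ ∑ D ∈ p.V.powerset.filter (fun D => Good D ∧ v ∈ D),
      2 * Real.exp (-((p.β - 1) * edgeBdryCard D)) * p.Z (A' D) := by
  set G := p.V.powerset.filter (fun D => Good D ∧ v ∈ D) with hG
  have hsplit := p.Z_add_le (A := A) (A' := {ψ | ψ ∈ A ∧ ψ v < p.L}) (A'' := {ψ | ψ ∈ A ∧ p.L < ψ v}) (by
    intro ψ hψ hO
    rcases lt_or_gt_of_ne (h1 ψ hψ hO).2.1 with h | h
    · exact Or.inl ⟨hψ, h⟩
    · exact Or.inr ⟨hψ, h⟩)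
  have hdown : p.Z {ψ | ψ ∈ A ∧ ψ v < p.L} ≤
      ∑ D ∈ G, Real.exp (-((p.β - 1) * edgeBdryCard D)) * p.Z (A' D) := by
    refine (p.Z_sum_le G (fun D => {ψ | ψ ∈ A ∧ ψ v < p.L ∧ fin p.V (fill (compStar (p.dnS ψ) v)) = D})
      ?_).trans (Finset.sum_le_sum ?_)
    · rintro ψ ⟨hA, hlt⟩ hO
      obtain ⟨g1, g2, g3⟩ := good_fin (n := p.n) (R := p.V) (subset_refl _) FC_V (S := p.dnS ψ) (fun u hu => hu.1)
        (v := v) ⟨hv, hlt⟩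
      exact ⟨_, Finset.mem_filter.2 ⟨Finset.mem_powerset.2 (fin_sub _ _), g1, g2⟩, hA, hlt, rfl⟩
    · intro D hD
      have hDV : D ⊆ p.V := Finset.mem_powerset.1 (Finset.mem_filter.1 hD).1
      have hfacts : ∀ ψ, ψ ∈ A ∧ ψ v < p.L ∧ fin p.V (fill (compStar (p.dnS ψ) v)) = D → ψ ∈ p.Om →
          Good D ∧ v ∈ D ∧ (↑D : Set Site) = fill (compStar (p.dnS ψ) v) ∧
          (↑D : Set Site) ⊆ fill (compStar (p.devS ψ) v) := by
        rintro ψ ⟨hA, hlt, rfl⟩ hO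
        obtain ⟨g1, g2, g3⟩ := good_fin (n := p.n) (R := p.V) (subset_refl _) FC_V (S := p.dnS ψ) (fun u hu => hu.1)
          (v := v) ⟨hv, hlt⟩
        refine ⟨g1, g2, g3, ?_⟩
        rw [g3]
        refine fill_mono (compStar_mono ?_ v)
        exact fun u hu => ⟨hu.1, ne_of_lt hu.2⟩
      refine p.Z_inj (bump D) (bump_inj D).injOn ?_ _ (Real.exp_pos _).le ?_
      · intro ψ hψ hO
        obtain ⟨g1, g2, g3, g4⟩ := hfacts ψ hψ hO
        have hO' := p.bump_Om hDV hO
        refine ⟨h2 ψ hψ.1 hO D g2 g4 (Or.inr ⟨g3, hψ.2.1⟩) _ hO' ?_ (fun u hu => bump_not hu), hO'⟩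
        intro u hu
        exact ((h1 ψ hψ.1 hO).1 u hu).trans (bump_ge _ _ _)
      · intro ψ hψ hO
        obtain ⟨g1, g2, g3, g4⟩ := hfacts ψ hψ hO
        refine wt_bump p.hl.le hB hDV g1.1 (small_anti g4 (h1 ψ hψ.1 hO).2.2) ?_
        intro u hu d hd hud
        have hu' : u ∈ fill (compStar (p.dnS ψ) v) := by rw [← g3]; exact hu
        have hud' : u + d ∉ fill (compStar (p.dnS ψ) v) := by rw [← g3]; exact hud
        obtain ⟨a, b⟩ := fill_nn_bdry (show v ∈ p.dnS ψ from ⟨hv, hψ.2.1⟩) hu' hud' (adjS_add hd)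
        have ha := a.2
        by_cases hV : u + d ∈ p.V
        · have : ¬ ψ (u+d) < p.L := fun hc => b ⟨hV, hc⟩
          omega
        · rw [hO.1 _ hV]; exact ha
  have hup : p.Z {ψ | ψ ∈ A ∧ p.L < ψ v} ≤
      ∑ D ∈ G, Real.exp (-((p.β - 1) * edgeBdryCard D)) * p.Z (A' D) := by
    refine (p.Z_sum_le G (fun D => {ψ | ψ ∈ A ∧ p.L < ψ v ∧ fin p.V (fill (compStar (p.upS ψ) v)) = D})
      ?_).trans (Finset.sum_le_sum ?_)
    · rintro ψ ⟨hA, hlt⟩ hO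
      obtain ⟨g1, g2, g3⟩ := good_fin (n := p.n) (R := p.V) (subset_refl _) FC_V (S := p.upS ψ) (fun u hu => hu.1)
        (v := v) ⟨hv, hlt⟩
      exact ⟨_, Finset.mem_filter.2 ⟨Finset.mem_powerset.2 (fin_sub _ _), g1, g2⟩, hA, hlt, rfl⟩
    · intro D hD
      have hDV : D ⊆ p.V := Finset.mem_powerset.1 (Finset.mem_filter.1 hD).1
      have hfacts : ∀ ψ, ψ ∈ A ∧ p.L < ψ v ∧ fin p.V (fill (compStar (p.upS ψ) v)) = D → ψ ∈ p.Om →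
          Good D ∧ v ∈ D ∧ (↑D : Set Site) = fill (compStar (p.upS ψ) v) ∧
          (↑D : Set Site) ⊆ fill (compStar (p.devS ψ) v) ∧
          ∀ u ∈ D, ∀ d ∈ dirs, u + d ∉ D → p.L < ψ u ∧ ψ (u + d) ≤ p.L := by
        rintro ψ ⟨hA, hlt, rfl⟩ hO
        obtain ⟨g1, g2, g3⟩ := good_fin (n := p.n) (R := p.V) (subset_refl _) FC_V (S := p.upS ψ) (fun u hu => hu.1)
          (v := v) ⟨hv, hlt⟩
        refine ⟨g1, g2, g3, ?_, ?_⟩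
        · rw [g3]
          refine fill_mono (compStar_mono ?_ v)
          exact fun u hu => ⟨hu.1, ne_of_gt hu.2⟩
        · intro u hu d hd hud
          have hu' : u ∈ fill (compStar (p.upS ψ) v) := by rw [← g3]; exact hu
          have hud' : u + d ∉ fill (compStar (p.upS ψ) v) := by rw [← g3]; exact hud
          obtain ⟨a, b⟩ := fill_nn_bdry (show v ∈ p.upS ψ from ⟨hv, hlt⟩) hu' hud' (adjS_add hd)
          refine ⟨a.2, ?_⟩
          by_cases hV : u + d ∈ p.V
          · exact not_lt.1 fun hc => b ⟨hV, hc⟩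
          · rw [hO.1 _ hV]
      let Q : Set (Site → ℤ) := {φ | ∃ ψ, (ψ ∈ A ∧ p.L < ψ v ∧ fin p.V (fill (compStar (p.upS ψ) v)) = D) ∧
        ψ ∈ p.Om ∧ (∀ u, u ∉ D → φ u = ψ u) ∧ (∀ u ∈ D, fl u - 1 ≤ φ u) ∧
        ∀ u ∈ D, ∀ d ∈ dirs, u + d ∉ D → p.L ≤ φ u}
      have step1 : p.Z {ψ | ψ ∈ A ∧ p.L < ψ v ∧ fin p.V (fill (compStar (p.upS ψ) v)) = D} ≤
          Real.exp (-(p.β * edgeBdryCard D)) * p.Z Q := by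
        refine p.Z_inj (dent D) (dent_inj D).injOn ?_ _ (Real.exp_pos _).le ?_
        · intro ψ hψ hO
          obtain ⟨g1, g2, g3, g4, g5⟩ := hfacts ψ hψ hO
          have hF := (h1 ψ hψ.1 hO).1
          refine ⟨⟨ψ, hψ, hO, fun u hu => dent_not hu, ?_, ?_⟩, ?_, ?_⟩
          · intro u hu
            rw [dent_mem hu]
            have := hF u (hDV hu); omega
          · intro u hu d hd hud
            rw [dent_mem hu]
            have := (g5 u hu d hd hud).1; omega
          · intro x hx
            rw [dent_not (fun hc => hx (hDV hc))]; exact hO.1 x hx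
          · intro u hu
            have := hF u hu
            have := hfl0 u hu
            unfold dent; split_ifs <;> omega
        · intro ψ hψ hO
          obtain ⟨g1, g2, g3, g4, g5⟩ := hfacts ψ hψ hO
          refine wt_dent p.hl.le hDV ?_
          intro u hu d hd hud
          have := g5 u hu d hd hud
          omega
      by_cases hQne : ∃ φ, φ ∈ Q
      · obtain ⟨φ0, ψ0, hψ0, hO0, -⟩ := hQne
        obtain ⟨g1, g2, g3, g4, -⟩ := hfacts ψ0 hψ0 hO0
        have hsm : small B ↑D := small_anti g4 (h1 ψ0 hψ0.1 hO0).2.2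
        have hRC : p.RC D B Q :=
          { sub := hDV
            fc := FC_of_fill g3
            bd := by
              rintro φ ⟨ψ, _, _, _, _, hb⟩ _ y hy d hd hyd hlt
              have := hb y hy d hd hyd
              omega
            up := by
              rintro φ ⟨ψ, hψ, hO, e1, e2, e3⟩ _ x hx m hm hxm
              have hsub : lowF D φ m x ⊆ D := fin_sub _ _
              refine ⟨small_anti (by exact_mod_cast hsub) hsm, ψ, hψ, hO, ?_, ?_, ?_⟩
              · intro u hu
                rw [bump_not (fun hc => hu (hsub hc))]; exact e1 u hu
              · intro u hu; exact (e2 u hu).trans (bump_ge _ _ _)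
              · intro u hu d hd hud; exact (e3 u hu d hd hud).trans (bump_ge _ _ _) }
        have step2 := hRC.seq hB (a+1) (by omega) (fun u => fl u - 1) D (subset_refl _) (by
          intro u hu
          have := hfl u (hDV hu)
          push_cast
          omega)
        have step3 : p.Z {φ | φ ∈ Q ∧ ∀ u ∈ D, fl u - 1 < φ u} ≤ p.Z (A' D) := by
          refine p.Z_mono ?_
          rintro φ ⟨⟨ψ, hψ, hO, e1, e2, e3⟩, hf⟩ hOφ
          obtain ⟨g1, g2, g3, g4, g5⟩ := hfacts ψ hψ hO
          refine h2 ψ hψ.1 hO D g2 g4 (Or.inl ⟨g3, hψ.2.1⟩) φ hOφ ?_ e1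
          intro u hu
          by_cases huD : u ∈ D
          · have := hf u huD; omega
          · rw [e1 u huD]; exact (h1 ψ hψ.1 hO).1 u hu
        have hcard := card_le_perim g1.1 hsm
        have hexp : 4 * p.s ^ (a+1) * D.card ≤ edgeBdryCard D := by
          have hs := p.s_pos
          calc 4 * p.s ^ (a+1) * D.card ≤ 4 * p.s ^ (a+1) * (B * edgeBdryCard D) := by gcongr
            _ = (4 * p.s ^ (a+1) * B) * edgeBdryCard D := by ring
            _ ≤ 1 * edgeBdryCard D := by gcongr
            _ = _ := one_mul _
        have hZ := p.Z_nonneg (A' D)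
        calc _ ≤ _ := step1
          _ ≤ Real.exp (-(p.β * edgeBdryCard D)) * (Real.exp (4 * p.s ^ (a+1) * D.card) * p.Z (A' D)) := by
            gcongr
            exact step2.trans (by gcongr)
          _ ≤ Real.exp (-(p.β * edgeBdryCard D)) * (Real.exp (edgeBdryCard D) * p.Z (A' D)) := by
            gcongr
          _ = _ := by
            rw [← mul_assoc, ← Real.exp_add]; ring_nf
      · have : p.Z Q ≤ p.Z ∅ := p.Z_mono fun φ hφ _ => absurd ⟨φ, hφ⟩ hQne
        have h0 : p.Z ∅ = 0 := by simp [Z]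
        rw [h0] at this
        have h3 : p.Z Q = 0 := le_antisymm this (p.Z_nonneg _)
        rw [h3, mul_zero] at step1
        exact step1.trans (mul_nonneg (Real.exp_pos _).le (p.Z_nonneg _))
  refine hsplit.trans ((add_le_add hdown hup).trans (le_of_eq ?_))
  rw [← Finset.sum_add_distrib]
  refine Finset.sum_congr rfl fun D _ => by ring

end Par
end

open scoped BigOperators
open Filter

noncomputable section
attribute [local instance] Classical.propDecidable

namespace Par
variable (p : Par)

/-! ### Elementary configurations -/

/-- all outer contours small -/
def el (B : ℝ) (ψ : Site → ℤ) : Prop :=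
  ∀ v ∈ p.V, ψ v ≠ p.L → small B (fill (compStar (p.devS ψ) v))

variable {p}

theorem dev_sub {ψ φ : Site → ℤ} {D F : Set Site} (hD : D ⊆ F) (h : ∀ u, u ∉ D → φ u = ψ u) :
    p.devS φ ⊆ p.devS ψ ∪ F := by
  intro u hu
  by_cases huD : u ∈ D
  · exact Or.inr (hD huD)
  · exact Or.inl ⟨hu.1, by rw [← h u huD]; exact hu.2⟩

/-- changing a configuration inside one outer contour keeps it elementary -/
theorem el_pres {B : ℝ} {ψ φ : Site → ℤ} (he : p.el B ψ) {v : Site} (hv : v ∈ p.devS ψ)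
    {D : Set Site} (hD : D ⊆ fill (compStar (p.devS ψ) v)) (h : ∀ u, u ∉ D → φ u = ψ u) : p.el B φ := by
  intro y hy hyL
  rcases comp_dichotomy hv (dev_sub hD h) (show y ∈ p.devS φ from ⟨hy, hyL⟩) with ⟨_, h2⟩ | ⟨_, h2, h3, _⟩
  · exact small_anti (fill_sub_fill h2) (he v hv.1 hv.2)
  · exact small_anti (fill_mono h3) (he y h2.1 h2.2)

/-- Lemma 4 -/
theorem dev_prob {fl : Site → ℤ} {a : ℕ} {B : ℝ} (hB : p.lam * B ≤ 1)
    (hsB : 4 * p.s ^ (a+1) * B ≤ 1)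
    (hfl0 : ∀ u ∈ p.V, 0 ≤ fl u) (hfl : ∀ u ∈ p.V, fl u ≤ p.L - a) {v : Site} (hv : v ∈ p.V) :
    p.Z {ψ | (ψ ∈ p.OmF fl ∧ p.el B ψ) ∧ ψ v ≠ p.L} ≤
      4 * Real.exp (-((p.β - 9) * 4)) * p.Z {ψ | ψ ∈ p.OmF fl ∧ p.el B ψ} := by
  have h := erase (A := {ψ | (ψ ∈ p.OmF fl ∧ p.el B ψ) ∧ ψ v ≠ p.L})
    (A' := fun _ => {ψ | ψ ∈ p.OmF fl ∧ p.el B ψ}) hB hsB hfl0 hfl hv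
    (fun ψ hψ _ => ⟨hψ.1.1, hψ.2, hψ.1.2 v hv hψ.2⟩)
    (fun ψ hψ _ D _ hDs _ φ _ hφ hoff => ⟨hφ, el_pres hψ.1.2 ⟨hv, hψ.2⟩ hDs (by simpa using hoff)⟩)
  refine h.trans ?_
  have h2 := sum_good_mul (p.V.powerset.filter (fun D => Good D ∧ v ∈ D)) v 4 (p.β - 1) (by linarith [p.hβ])
    (fun D hD => ⟨(Finset.mem_filter.1 hD).2.1, (Finset.mem_filter.1 hD).2.2,
      perim_ge_four (Finset.mem_filter.1 hD).2.1.1⟩)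
    (fun D => 2 * Real.exp (-((p.β - 1) * edgeBdryCard D)) * p.Z {ψ | ψ ∈ p.OmF fl ∧ p.el B ψ})
    (2 * p.Z {ψ | ψ ∈ p.OmF fl ∧ p.el B ψ}) (by linarith [p.Z_nonneg {ψ | ψ ∈ p.OmF fl ∧ p.el B ψ}])
    (fun D _ => le_of_eq (by ring))
  refine h2.trans (le_of_eq ?_)
  have : p.β - 1 - 8 = p.β - 9 := by ring
  rw [this]
  push_cast
  ring

variable (p)

/-- a site enclosed by a large outer contour -/
def bad (B : ℝ) (ψ : Site → ℤ) (v : Site) : Prop :=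
  ∃ w ∈ p.devS ψ, v ∈ fill (compStar (p.devS ψ) w) ∧ ¬ small B (fill (compStar (p.devS ψ) w))

/-- no site of `U` enclosed by a large contour -/
def X (fl : Site → ℤ) (B' B : ℝ) (U : Finset Site) : Set (Site → ℤ) :=
  {ψ | ψ ∈ p.OmF fl ∧ p.el B' ψ ∧ ∀ u ∈ U, ¬ p.bad B ψ u}

/-- configurations modified inside a given large contour -/
def AF (fl : Site → ℤ) (B' B : ℝ) (U F S : Finset Site) : Set (Site → ℤ) :=
  {φ | φ ∈ p.OmF fl ∧ (∀ u ∈ S, φ u ≠ p.L) ∧ ∃ ψ ∈ p.X fl B' B U, ψ ∈ p.Om ∧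
    (∃ w ∈ p.devS ψ, (↑F : Set Site) = fill (compStar (p.devS ψ) w)) ∧ ∀ u, u ∉ F → φ u = ψ u}

/-- boundary length carried by `S` -/
def mB (F S : Finset Site) : ℕ := ∑ u ∈ S, (dirs.filter fun d => u + d ∉ F).card

variable {p}

theorem mB_split {F S D : Finset Site} (hD : D ⊆ F) : mB F S ≤ mB F (S \ D) + edgeBdryCard D := by
  have h1 : mB F S = mB F (S \ D) + mB F (S ∩ D) := by
    unfold mB
    rw [← Finset.sum_sdiff (Finset.inter_subset_left : S ∩ D ⊆ S), Finset.sdiff_inter_self_left]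
  have h2 : mB F (S ∩ D) ≤ edgeBdryCard D := by
    unfold mB edgeBdryCard
    refine (Finset.sum_le_sum_of_subset (Finset.inter_subset_right)).trans (Finset.sum_le_sum fun u _ => ?_)
    exact Finset.card_le_card (Finset.monotone_filter_right _ fun d _ h h' => h (hD h'))
  omega

theorem mB_inner (F : Finset Site) : mB F (innerBdry F) = edgeBdryCard F := by
  unfold mB edgeBdryCard innerBdry
  refine Finset.sum_subset (Finset.filter_subset _ _) fun u hu hn => ?_
  rw [Finset.card_eq_zero, Finset.filter_eq_empty_iff]
  intro d hd hc
  exact hn (Finset.mem_filter.2 ⟨hu, d, hd, hc⟩)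

theorem four_exp : 4 * Real.exp (-(4:ℝ)) ≤ 1 := by
  have h := Real.add_one_le_exp (4:ℝ)
  rw [Real.exp_neg]
  have : 0 < Real.exp 4 := Real.exp_pos _
  rw [← div_eq_mul_inv, div_le_one this]
  linarith

theorem AF_bound {fl : Site → ℤ} {a : ℕ} {B' B : ℝ} (hB : p.lam * B' ≤ 1)
    (hsB : 4 * p.s ^ (a+1) * B' ≤ 1)
    (hfl0 : ∀ u ∈ p.V, 0 ≤ fl u) (hfl : ∀ u ∈ p.V, fl u ≤ p.L - a) {U F : Finset Site} (hF : F ⊆ p.V) :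
    ∀ (k : ℕ) (S : Finset Site), S.card ≤ k → S ⊆ F →
      p.Z (p.AF fl B' B U F S) ≤ Real.exp (-((p.β - 10) * mB F S)) * p.Z (p.AF fl B' B U F ∅) := by
  intro k
  induction k with
  | zero =>
    intro S hS _
    rw [Finset.card_eq_zero.1 (by omega : S.card = 0)]
    simp [mB]
  | succ k ih =>
    intro S hS hSF
    rcases S.eq_empty_or_nonempty with rfl | ⟨v, hv⟩
    · simp [mB]
    have hvF := hSF hv
    have hin : ∀ φ ∈ p.AF fl B' B U F S, fill (compStar (p.devS φ) v) ⊆ ↑F ∧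
        small B' (fill (compStar (p.devS φ) v)) := by
      rintro φ ⟨h1, h2, ψ, hψ, hO, ⟨w, hw, hwF⟩, hoff⟩
      have hd := dev_sub (p := p) (D := (↑F : Set Site)) (F := fill (compStar (p.devS ψ) w))
        (φ := φ) (ψ := ψ) (by rw [hwF]) (by simpa using hoff)
      have hvd : v ∈ p.devS φ := ⟨hF hvF, h2 v hv⟩
      have hvF' : v ∈ fill (compStar (p.devS ψ) w) := by rw [← hwF]; exact hvF
      rcases comp_dichotomy hw hd hvd with ⟨_, g⟩ | ⟨g, _⟩
      · refine ⟨by rw [hwF]; exact fill_sub_fill g, ?_⟩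
        exact small_anti (fill_sub_fill g) (hψ.2.1 w hw.1 hw.2)
      · exact absurd hvF' g
    have h := erase (A := p.AF fl B' B U F S)
      (A' := fun D => {φ | D ⊆ F ∧ φ ∈ p.AF fl B' B U F (S \ D)}) hB hsB hfl0 hfl (hF hvF)
      (fun φ hφ _ => ⟨hφ.1, hφ.2.1 v hv, (hin φ hφ).2⟩)
      (by
        intro φ hφ _ D hvD hDs _ φ' _ hφ' hoff
        have hDF : D ⊆ F := by
          have := hDs.trans (hin φ hφ).1
          exact_mod_cast this
        refine ⟨hDF, hφ', ?_, ?_⟩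
        · intro u hu
          rw [Finset.mem_sdiff] at hu
          rw [hoff u hu.2]; exact hφ.2.1 u hu.1
        · obtain ⟨h1, h2, ψ, hψ, hO, hw, hof⟩ := hφ
          refine ⟨ψ, hψ, hO, hw, fun u hu => ?_⟩
          rw [hoff u (fun hc => hu (hDF hc)), hof u hu])
    refine h.trans ?_
    have hZ := p.Z_nonneg (p.AF fl B' B U F ∅)
    have hβ := p.hβ
    have h2 := sum_good_mul (p.V.powerset.filter (fun D => Good D ∧ v ∈ D)) v 4 9 (by norm_num)
      (fun D hD => ⟨(Finset.mem_filter.1 hD).2.1, (Finset.mem_filter.1 hD).2.2,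
        perim_ge_four (Finset.mem_filter.1 hD).2.1.1⟩)
      (fun D => 2 * Real.exp (-((p.β - 1) * edgeBdryCard D)) *
        p.Z {φ | D ⊆ F ∧ φ ∈ p.AF fl B' B U F (S \ D)})
      (2 * (Real.exp (-((p.β - 10) * mB F S)) * p.Z (p.AF fl B' B U F ∅))) (by positivity)
      (by
        intro D hD
        have hvD := (Finset.mem_filter.1 hD).2.2
        by_cases hDF : D ⊆ F
        · have hlt : (S \ D).card ≤ k := by
            have : (S \ D).card < S.card := Finset.card_lt_card
              ⟨Finset.sdiff_subset, fun hc => (Finset.mem_sdiff.1 (hc hv)).2 hvD⟩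
            omega
          have i1 := ih (S \ D) hlt (Finset.sdiff_subset.trans hSF)
          have i2 : p.Z {φ | D ⊆ F ∧ φ ∈ p.AF fl B' B U F (S \ D)} ≤ p.Z (p.AF fl B' B U F (S \ D)) :=
            p.Z_mono fun φ hφ _ => hφ.2
          have i3 : (mB F S : ℝ) ≤ mB F (S \ D) + edgeBdryCard D := by exact_mod_cast mB_split hDF
          have i4 : Real.exp (-((p.β - 1) * edgeBdryCard D)) * Real.exp (-((p.β - 10) * mB F (S \ D))) ≤
              Real.exp (-(9 * edgeBdryCard D)) * Real.exp (-((p.β - 10) * mB F S)) := by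
            rw [← Real.exp_add, ← Real.exp_add]
            apply Real.exp_le_exp.2
            nlinarith
          calc _ ≤ 2 * Real.exp (-((p.β - 1) * edgeBdryCard D)) *
                (Real.exp (-((p.β - 10) * mB F (S \ D))) * p.Z (p.AF fl B' B U F ∅)) := by
                  gcongr; exact i2.trans i1
            _ = 2 * (Real.exp (-((p.β - 1) * edgeBdryCard D)) * Real.exp (-((p.β - 10) * mB F (S \ D)))) *
                p.Z (p.AF fl B' B U F ∅) := by ring
            _ ≤ 2 * (Real.exp (-(9 * edgeBdryCard D)) * Real.exp (-((p.β - 10) * mB F S))) *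
                p.Z (p.AF fl B' B U F ∅) := by gcongr
            _ = _ := by ring
        · have i2 : p.Z {φ | D ⊆ F ∧ φ ∈ p.AF fl B' B U F (S \ D)} ≤ p.Z ∅ :=
            p.Z_mono fun φ hφ _ => absurd hφ.1 hDF
          have i3 : p.Z {φ | D ⊆ F ∧ φ ∈ p.AF fl B' B U F (S \ D)} = 0 :=
            le_antisymm (i2.trans (by simp [Z])) (p.Z_nonneg _)
          rw [i3, mul_zero]
          positivity)
    refine h2.trans ?_
    have e : (9:ℝ) - 8 = 1 := by norm_num
    rw [e]
    have hf := four_exp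
    push_cast
    have hpos : 0 ≤ Real.exp (-((p.β - 10) * mB F S)) * p.Z (p.AF fl B' B U F ∅) := by positivity
    rw [one_mul]
    nlinarith

theorem X_bad_F {fl : Site → ℤ} {a : ℕ} {B' B : ℝ} (hB : p.lam * B' ≤ 1)
    (hsB : 4 * p.s ^ (a+1) * B' ≤ 1)
    (hfl0 : ∀ u ∈ p.V, 0 ≤ fl u) (hfl : ∀ u ∈ p.V, fl u ≤ p.L - a) {U F : Finset Site} (hF : F ⊆ p.V)
    (hns : ¬ small B (↑F : Set Site)) :
    p.Z {ψ | ψ ∈ p.X fl B' B U ∧ ∃ w ∈ p.devS ψ, (↑F : Set Site) = fill (compStar (p.devS ψ) w)} ≤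
      Real.exp (-((p.β - 10) * edgeBdryCard F)) * p.Z (p.X fl B' B U) := by
  have h1 := AF_bound hB hsB hfl0 hfl (U := U) (B := B) hF _ (innerBdry F) le_rfl (Finset.filter_subset _ _)
  rw [mB_inner] at h1
  refine (p.Z_mono ?_).trans (h1.trans (mul_le_mul_of_nonneg_left (p.Z_mono ?_) (Real.exp_pos _).le))
  · rintro ψ ⟨hψ, w, hw, hwF⟩ hO
    refine ⟨hψ.1, ?_, ψ, hψ, hO, ⟨w, hw, hwF⟩, fun _ _ => rfl⟩
    intro u hu
    obtain ⟨huF, d, hd, hud⟩ := Finset.mem_filter.1 hu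
    have hu' : u ∈ fill (compStar (p.devS ψ) w) := by rw [← hwF]; exact huF
    have hud' : u + d ∉ fill (compStar (p.devS ψ) w) := by rw [← hwF]; exact hud
    exact (fill_nn_bdry hw hu' hud' (adjS_add hd)).1.2
  · rintro φ ⟨hφ, -, ψ, hψ, hO, ⟨w, hw, hwF⟩, hoff⟩ _
    have hoff' : ∀ u, u ∉ (↑F : Set Site) → φ u = ψ u := by simpa using hoff
    refine ⟨hφ, el_pres hψ.2.1 hw (D := ↑F) (by rw [hwF]) hoff', ?_⟩
    rintro u hu ⟨y, hy, huy, hny⟩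
    rcases comp_dichotomy hw (dev_sub (by rw [hwF]) hoff') hy with ⟨_, g⟩ | ⟨_, g2, g3, _⟩
    · refine hψ.2.2 u hu ⟨w, hw, fill_sub_fill g huy, ?_⟩
      rw [← hwF]; exact hns
    · exact hψ.2.2 u hu ⟨y, g2, fill_mono g3 huy, fun hc => hny (small_anti (fill_mono g3) hc)⟩

/-- Lemma 5 -/
theorem shrink {fl : Site → ℤ} {a : ℕ} {B' B : ℝ} (hB : p.lam * B' ≤ 1)
    (hsB : 4 * p.s ^ (a+1) * B' ≤ 1)
    (hfl0 : ∀ u ∈ p.V, 0 ≤ fl u) (hfl : ∀ u ∈ p.V, fl u ≤ p.L - a) (n0 : ℕ) (hn1 : 1 ≤ n0) (hn0 : (n0:ℝ) ≤ B) :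
    p.Z {ψ | ψ ∈ p.OmF fl ∧ p.el B' ψ} ≤ Real.exp (4 * Real.exp (-((p.β - 18) * n0)) * p.V.card) *
      p.Z {ψ | ψ ∈ p.OmF fl ∧ p.el B ψ} := by
  set δ := 2 * Real.exp (-((p.β - 18) * n0)) with hδ
  have hδ0 : 0 ≤ δ := by positivity
  have hδ1 : δ ≤ 1/2 := by
    have h1 : Real.exp (-((p.β - 18) * n0)) ≤ Real.exp (-4) := by
      apply Real.exp_le_exp.2
      have : (1:ℝ) ≤ n0 := by exact_mod_cast hn1
      nlinarith [p.hβ]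
    have h2 := four_exp
    linarith
  have key : ∀ U ⊆ p.V, p.Z (p.X fl B' B ∅) ≤ Real.exp (2 * δ * U.card) * p.Z (p.X fl B' B U) := by
    intro U
    induction U using Finset.induction_on with
    | empty => intro _; simp
    | @insert v U hv ih =>
      intro hU
      have i1 := ih (fun u hu => hU (Finset.mem_insert_of_mem hu))
      have hvV := hU (Finset.mem_insert_self _ _)
      have h1 : p.Z {ψ | ψ ∈ p.X fl B' B U ∧ p.bad B ψ v} ≤ δ * p.Z (p.X fl B' B U) := by
        let G := p.V.powerset.filter (fun F => Good F ∧ v ∈ F ∧ ¬ small B (↑F : Set Site))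
        refine (p.Z_sum_le G (fun F => {ψ | ψ ∈ p.X fl B' B U ∧ ∃ w ∈ p.devS ψ, (↑F : Set Site) = fill (compStar (p.devS ψ) w)})
          ?_).trans ?_
        · rintro ψ ⟨hψ, w, hw, hvw, hns⟩ hO
          obtain ⟨g1, g2, g3⟩ := good_fin (n := p.n) (R := p.V) (subset_refl _) FC_V (S := p.devS ψ) (fun u hu => hu.1) hw
          refine ⟨_, Finset.mem_filter.2 ⟨Finset.mem_powerset.2 (fin_sub _ _), g1, ?_, ?_⟩, hψ, w, hw, g3⟩
          · exact mem_fin.2 ⟨hvV, hvw⟩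
          · rw [g3]; exact hns
        · have := sum_good_mul G v n0 (p.β - 10) (by linarith [p.hβ]) (by
            intro D hD
            obtain ⟨_, g1, g2, g3⟩ := Finset.mem_filter.1 hD
            refine ⟨g1, g2, ?_⟩
            have := perim_gt_of_not_small g1.2.1 g3
            have h4 : (n0:ℝ) < edgeBdryCard D := hn0.trans_lt this
            exact_mod_cast h4.le)
            (fun F => p.Z {ψ | ψ ∈ p.X fl B' B U ∧ ∃ w ∈ p.devS ψ, (↑F : Set Site) = fill (compStar (p.devS ψ) w)})
            (p.Z (p.X fl B' B U)) (p.Z_nonneg _) (by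
              intro F hF
              obtain ⟨g0, g1, g2, g3⟩ := Finset.mem_filter.1 hF
              exact X_bad_F hB hsB hfl0 hfl (Finset.mem_powerset.1 g0) g3)
          refine this.trans (le_of_eq ?_)
          rw [hδ]; congr 4; ring
      have h2 : p.Z (p.X fl B' B U) ≤ p.Z (p.X fl B' B (insert v U)) + p.Z {ψ | ψ ∈ p.X fl B' B U ∧ p.bad B ψ v} := by
        refine p.Z_add_le fun ψ hψ _ => ?_
        by_cases hb : p.bad B ψ v
        · exact Or.inr ⟨hψ, hb⟩
        · refine Or.inl ⟨hψ.1, hψ.2.1, fun u hu => ?_⟩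
          rcases Finset.mem_insert.1 hu with rfl | hu
          · exact hb
          · exact hψ.2.2 u hu
      have h3 := le_exp_of_le (p.Z_nonneg _) (h2.trans (by gcongr)) hδ0 hδ1
      refine i1.trans ((mul_le_mul_of_nonneg_left h3 (Real.exp_pos _).le).trans (le_of_eq ?_))
      rw [← mul_assoc, ← Real.exp_add, Finset.card_insert_of_notMem hv]
      push_cast
      ring_nf
  have h1 : p.Z {ψ | ψ ∈ p.OmF fl ∧ p.el B' ψ} ≤ p.Z (p.X fl B' B ∅) :=
    p.Z_mono fun ψ hψ _ => ⟨hψ.1, hψ.2, by simp⟩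
  have h2 : p.Z (p.X fl B' B p.V) ≤ p.Z {ψ | ψ ∈ p.OmF fl ∧ p.el B ψ} := by
    refine p.Z_mono fun ψ hψ _ => ⟨hψ.1, fun v hv hvL => ?_⟩
    by_contra hc
    exact hψ.2.2 v hv ⟨v, ⟨hv, hvL⟩, subset_fill _ (compStar_self _ _), hc⟩
  have h3 := key p.V (subset_refl _)
  have e : 2 * δ = 4 * Real.exp (-((p.β - 18) * n0)) := by rw [hδ]; ring
  rw [e] at h3
  exact h1.trans (h3.trans (by gcongr))

end Par
end

open scoped BigOperators
open Filter

noncomputable section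
attribute [local instance] Classical.propDecidable

theorem fill_single (v : Site) : fill {v} ⊆ {v} := by
  intro x hx
  by_contra hne
  rw [Set.mem_singleton_iff] at hne
  obtain ⟨t, ht, hray⟩ : ∃ t : ℤ, (t = 1 ∨ t = -1) ∧ ∀ k : ℕ, (x.1 + k * t, x.2) ≠ v := by
    by_cases h : x.2 = v.2 ∧ x.1 < v.1
    · refine ⟨-1, Or.inr rfl, fun k hc => ?_⟩
      have := congrArg Prod.fst hc
      dsimp only at this
      omega
    · refine ⟨1, Or.inl rfl, fun k hc => ?_⟩
      have h1 := congrArg Prod.fst hc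
      have h2 := congrArg Prod.snd hc
      dsimp only at h1 h2
      apply hne
      apply Prod.ext <;> omega
  rcases hx with hx | hx
  · exact hne hx
  · have hinj : Function.Injective (fun k : ℕ => ((x.1 + k * t, x.2) : Site)) := by
      intro k l hkl
      have h1 := congrArg Prod.fst hkl
      dsimp only at h1
      rcases ht with rfl | rfl <;> omega
    refine Set.infinite_range_of_injective hinj (hx.subset ?_)
    rintro _ ⟨k, rfl⟩
    induction k with
    | zero => simpa using Relation.ReflTransGen.refl
    | succ k ih =>
      refine Relation.ReflTransGen.tail ih ⟨?_, hray k, hray (k+1)⟩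
      unfold adjS
      rcases ht with rfl | rfl
      · convert mem_dirs_r using 1
        apply Prod.ext
        · simp
        · simp
      · convert mem_dirs_l using 1
        apply Prod.ext
        · simp
        · simp

namespace Par
variable (p : Par)

theorem low_RC {B : ℝ} {fl : Site → ℤ} : p.RC p.V B {ψ | ψ ∈ p.OmF fl ∧ p.el B ψ} where
  sub := subset_refl _
  fc := FC_V
  bd := fun ψ _ hO y _ d _ hyd _ => (hO.1 _ hyd).ge
  up := by
    intro ψ hψ hO v hv m hm hvm
    have hvd : v ∈ p.devS ψ := ⟨hv, by omega⟩
    have hsub : (↑(lowF p.V ψ m v) : Set Site) ⊆ fill (compStar (p.devS ψ) v) := by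
      intro u hu
      refine fill_mono (compStar_mono ?_ v) (mem_fin.1 hu).2
      exact fun u hu => ⟨hu.1, by have := hu.2; omega⟩
    refine ⟨small_anti hsub (hψ.2 v hv (by omega)), fun u hu => (hψ.1 u hu).trans (bump_ge _ _ _), ?_⟩
    exact el_pres hψ.2 hvd hsub (fun u hu => bump_not hu)

/-- shifted parameters -/
def sh : Par := { p with L := p.L - 1 }

theorem shift (B : ℝ) : p.sh.Z {ψ | ψ ∈ p.sh.OmF (fun _ => 0) ∧ p.sh.el B ψ} =
    Real.exp (p.lam * p.V.card) * p.Z {ψ | ψ ∈ p.OmF (fun _ => 1) ∧ p.el B ψ} := by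
  unfold Z
  rw [← tsum_mul_left, ← (Equiv.addRight (1 : Site → ℤ)).tsum_eq (fun ψ => _ * _)]
  refine tsum_congr fun ψ => ?_
  have hdev : p.sh.devS ψ = p.devS (ψ + 1) := by
    ext u
    show (u ∈ p.V ∧ ψ u ≠ p.L - 1) ↔ (u ∈ p.V ∧ ψ u + 1 ≠ p.L)
    refine and_congr_right fun _ => ?_
    omega
  have hiff : ψ ∈ {ψ | ψ ∈ p.sh.OmF (fun _ => 0) ∧ p.sh.el B ψ} ∩ p.sh.Om ↔
      ψ + 1 ∈ {ψ | ψ ∈ p.OmF (fun _ => 1) ∧ p.el B ψ} ∩ p.Om := by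
    constructor
    · rintro ⟨⟨h1, h2⟩, h3, h4⟩
      refine ⟨⟨?_, ?_⟩, ?_, ?_⟩
      · intro v hv
        have : (0:ℤ) ≤ ψ v := h1 v hv
        show (1:ℤ) ≤ ψ v + 1
        omega
      · intro v hv hL
        rw [← hdev]
        refine h2 v hv ?_
        show ψ v ≠ p.L - 1
        have : ψ v + 1 ≠ p.L := hL
        omega
      · intro x hx
        have : ψ x = p.L - 1 := h3 x hx
        show ψ x + 1 = p.L
        omega
      · intro v hv
        have : (0:ℤ) ≤ ψ v := h1 v hv
        show (-1:ℤ) ≤ ψ v + 1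
        omega
    · rintro ⟨⟨h1, h2⟩, h3, h4⟩
      refine ⟨⟨?_, ?_⟩, ?_, ?_⟩
      · intro v hv
        have : (1:ℤ) ≤ ψ v + 1 := h1 v hv
        show (0:ℤ) ≤ ψ v
        omega
      · intro v hv hL
        rw [hdev]
        refine h2 v hv ?_
        show ψ v + 1 ≠ p.L
        have : ψ v ≠ p.L - 1 := hL
        omega
      · intro x hx
        have : ψ x + 1 = p.L := h3 x hx
        show ψ x = p.L - 1
        omega
      · intro v hv
        have : (1:ℤ) ≤ ψ v + 1 := h1 v hv
        omega
  rw [Equiv.coe_addRight]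
  by_cases h : ψ ∈ {ψ | ψ ∈ p.sh.OmF (fun _ => 0) ∧ p.sh.el B ψ} ∩ p.sh.Om
  · rw [Set.indicator_of_mem h, Set.indicator_of_mem (hiff.1 h)]
    show sosWt p.β p.lam p.V ψ = Real.exp (p.lam * p.V.card) * sosWt p.β p.lam p.V (ψ + 1)
    unfold sosWt
    rw [← Real.exp_add]
    congr 1
    have e1 : sosEnergy p.V (ψ + 1) = sosEnergy p.V ψ := by
      unfold sosEnergy
      refine Finset.sum_congr rfl fun v _ => Finset.sum_congr rfl fun d _ => ?_
      simp
    have e2 : sosField p.V (ψ + 1) = sosField p.V ψ + p.V.card := by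
      unfold sosField
      simp [Finset.sum_add_distrib]
    rw [e1, e2]
    ring
  · rw [Set.indicator_of_notMem h, Set.indicator_of_notMem (fun hc => h (hiff.2 hc)), mul_zero]

variable {p}

theorem wt_spike {v : Site} (hv : v ∈ p.V) {ψ : Site → ℤ} (hvL : ψ v = p.L)
    (h : ∀ d ∈ dirs, ψ (v + d) = p.L) (k : ℕ) :
    p.w ψ ≤ Real.exp (4 * p.β * k) * p.w (Function.update ψ v (p.L - k)) := by
  induction k with
  | zero =>
    have : Function.update ψ v (p.L - (0:ℕ)) = ψ := by
      rw [← hvL]; simp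
    rw [this]; simp
  | succ k ih =>
    refine ih.trans ?_
    set ψ' := Function.update ψ v (p.L - (k+1 : ℕ)) with hψ'
    have hb : bump {v} ψ' = Function.update ψ v (p.L - k) := by
      funext u
      by_cases hu : u = v
      · subst hu
        simp only [bump, hψ', Function.update_self, Finset.mem_singleton, if_true]
        push_cast; ring
      · simp [bump, hψ', hu]
    have hs : ({v} : Finset Site) ⊆ p.V := by simpa using hv
    have hE := energy_bump hs (ψ := ψ') (by
      intro u hu d hd hn
      rw [Finset.mem_singleton] at hu hn
      subst hu
      rw [hψ', Function.update_self, Function.update_of_ne hn, h d hd]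
      push_cast; omega)
    have hF := field_bump hs ψ'
    have h4 : edgeBdryCard {v} ≤ 4 := by
      unfold edgeBdryCard
      rw [Finset.sum_singleton]
      exact (Finset.card_filter_le _ _).trans (by unfold dirs; decide)
    rw [hb] at hE hF
    unfold w sosWt
    rw [← Real.exp_add, ← Real.exp_add, Real.exp_le_exp, hE, hF]
    have h4' : (edgeBdryCard {v} : ℝ) ≤ 4 := by exact_mod_cast h4
    have := p.hβ
    have := p.hl
    simp only [Finset.card_singleton]
    push_cast
    nlinarith

/-- the block around a site -/
def blk (v : Site) : Finset Site := Finset.Icc (v.1 - 1) (v.1 + 1) ×ˢ Finset.Icc (v.2 - 1) (v.2 + 1)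

theorem mem_blk {u v : Site} : u ∈ blk v ↔ u = v ∨ starAdj v u := by
  unfold blk starAdj
  rw [Finset.mem_product, Finset.mem_Icc, Finset.mem_Icc, abs_le, abs_le]
  constructor
  · intro h
    by_cases he : u = v
    · exact Or.inl he
    · refine Or.inr ⟨fun hc => he hc.symm, ⟨?_, ?_⟩, ?_, ?_⟩ <;> omega
  · rintro (rfl | ⟨_, h1, h2⟩)
    · refine ⟨⟨?_, ?_⟩, ?_, ?_⟩ <;> omega
    · refine ⟨⟨?_, ?_⟩, ?_, ?_⟩ <;> omega

theorem blk_card (v : Site) : (blk v).card = 9 := by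
  unfold blk
  rw [Finset.card_product, Int.card_Icc, Int.card_Icc]
  have h1 : (v.1 + 1 + 1 - (v.1 - 1)).toNat = 3 := by omega
  have h2 : (v.2 + 1 + 1 - (v.2 - 1)).toNat = 3 := by omega
  rw [h1, h2]

theorem el_spike {B : ℝ} (hB : 1 ≤ B) {ψ : Site → ℤ} (he : p.el B ψ) {v : Site}
    (hb : ∀ u ∈ blk v, ψ u = p.L) (t : ℤ) : p.el B (Function.update ψ v t) := by
  set φ := Function.update ψ v t with hφ
  have hnb : ∀ u, starAdj v u → u ∉ p.devS φ := by
    rintro u hu ⟨_, h⟩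
    apply h
    rw [hφ, Function.update_of_ne (fun hc => hu.1 hc.symm)]
    exact hb u (mem_blk.2 (Or.inr hu))
  intro y hy hyL
  by_cases hyv : y = v
  · subst hyv
    have : compStar (p.devS φ) y ⊆ {y} := by
      intro z hz
      induction hz with
      | refl => rfl
      | tail _ hab ih =>
        rw [Set.mem_singleton_iff] at ih
        subst ih
        exact absurd hab.2.2 (hnb _ hab.1)
    have h2 := (fill_mono this).trans (fill_single y)
    refine small_anti h2 ?_
    intro a ha b hb
    rw [Set.mem_singleton_iff] at ha hb
    subst ha; subst hb
    simpa using hB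
  · have key : ∀ z, Relation.ReflTransGen (fun a b => starAdj a b ∧ a ∈ p.devS φ ∧ b ∈ p.devS φ) y z →
        z ≠ v ∧ z ∈ compStar (p.devS ψ) y := by
      intro z hz
      induction hz with
      | refl => exact ⟨hyv, compStar_self _ _⟩
      | @tail a b _ hab ih =>
        have hbv : b ≠ v := by
          rintro rfl
          exact hnb a (starAdj_symm hab.1) hab.2.1
        have conv : ∀ c, c ≠ v → c ∈ p.devS φ → c ∈ p.devS ψ := by
          rintro c hc ⟨h1, h2⟩
          rw [hφ, Function.update_of_ne hc] at h2
          exact ⟨h1, h2⟩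
        exact ⟨hbv, Relation.ReflTransGen.tail ih.2 ⟨hab.1, conv a ih.1 hab.2.1, conv b hbv hab.2.2⟩⟩
    have hyd : ψ y ≠ p.L := by
      rw [hφ, Function.update_of_ne hyv] at hyL; exact hyL
    exact small_anti (fill_mono fun z hz => (key z hz).2) (he y hy hyd)

end Par
end

open scoped BigOperators
open Filter

noncomputable section
attribute [local instance] Classical.propDecidable

namespace Par
variable {p : Par}

/-- mixed floor -/
def flU (U : Finset Site) : Site → ℤ := fun u => if u ∈ U then 0 else 1

theorem blk_prob {h : ℕ} (hL : p.L = h + 1) {B : ℝ} (hB : p.lam * B ≤ 1)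
    (hsB : 4 * p.s ^ (h+1) * B ≤ 1) (U : Finset Site) (v : Site) :
    p.Z {ψ | ψ ∈ p.OmF (flU U) ∧ p.el B ψ} ≤
      2 * p.Z {ψ | (ψ ∈ p.OmF (flU U) ∧ p.el B ψ) ∧ ∀ u ∈ blk v, ψ u = p.L} := by
  set Q : Set (Site → ℤ) := {ψ | ψ ∈ p.OmF (flU U) ∧ p.el B ψ} with hQ
  have h1 := p.Z_add_le (A := Q) (A' := {ψ | ψ ∈ Q ∧ ∀ u ∈ blk v, ψ u = p.L})
    (A'' := {ψ | ψ ∈ Q ∧ ∃ u ∈ blk v, ψ u ≠ p.L}) (by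
      intro ψ hψ _
      by_cases hc : ∀ u ∈ blk v, ψ u = p.L
      · exact Or.inl ⟨hψ, hc⟩
      · push Not at hc
        exact Or.inr ⟨hψ, hc⟩)
  have h2 := p.Z_sum_le (blk v) (fun u => {ψ | ψ ∈ Q ∧ ψ u ≠ p.L})
    (A := {ψ | ψ ∈ Q ∧ ∃ u ∈ blk v, ψ u ≠ p.L}) (by
      rintro ψ ⟨hψ, u, hu, hne⟩ _
      exact ⟨u, hu, hψ, hne⟩)
  have hZ := p.Z_nonneg Q
  have h3 : ∀ u ∈ blk v, p.Z {ψ | ψ ∈ Q ∧ ψ u ≠ p.L} ≤ 4 * Real.exp (-((p.β - 9) * 4)) * p.Z Q := by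
    intro u _
    by_cases hu : u ∈ p.V
    · refine dev_prob hB hsB (fun u _ => ?_) (fun u _ => ?_) hu
      · unfold flU; split_ifs <;> omega
      · unfold flU; rw [hL]; split_ifs <;> omega
    · have i2 : p.Z {ψ | ψ ∈ Q ∧ ψ u ≠ p.L} ≤ p.Z ∅ :=
        p.Z_mono fun φ hφ hO => absurd (hO.1 u hu) hφ.2
      refine i2.trans ?_
      have : p.Z ∅ = 0 := by simp [Z]
      rw [this]; positivity
  have h4 := Finset.sum_le_sum h3
  rw [Finset.sum_const, blk_card, nsmul_eq_mul] at h4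
  have h5 : 4 * Real.exp (-((p.β - 9) * 4)) ≤ 1/18 := by
    have hβ := p.hβ
    have e : Real.exp (-((p.β - 9) * 4)) ≤ Real.exp (-(71:ℝ)) := Real.exp_le_exp.2 (by linarith)
    have e2 : Real.exp (-(71:ℝ)) * 72 ≤ 1 := by
      rw [Real.exp_neg]
      have h71 := Real.add_one_le_exp (71:ℝ)
      rw [inv_mul_le_one₀ (Real.exp_pos _)]
      linarith
    linarith
  have h6 : 4 * Real.exp (-((p.β - 9) * 4)) * p.Z Q ≤ 1/18 * p.Z Q := by gcongr
  push_cast at h4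
  have goal : p.Z Q ≤ 2 * p.Z {ψ | ψ ∈ Q ∧ ∀ u ∈ blk v, ψ u = p.L} := by linarith
  exact goal

theorem raise_step {h : ℕ} (hL : p.L = h + 1) {B : ℝ} (hB : p.lam * B ≤ 1) (hB1 : 1 ≤ B)
    (hsB : 4 * p.s ^ (h+1) * B ≤ 1) {U : Finset Site} {v : Site} (hv : v ∈ p.V) (hvU : v ∉ U) :
    (1 + 1/2 * Real.exp (-(4 * p.β * (h + 1)))) * p.Z {ψ | ψ ∈ p.OmF (flU U) ∧ p.el B ψ} ≤
      p.Z {ψ | ψ ∈ p.OmF (flU (insert v U)) ∧ p.el B ψ} := by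
  have h1 := blk_prob hL hB hsB U v
  have h2 := p.Z_disj (A := {ψ | ψ ∈ p.OmF (flU U) ∧ p.el B ψ})
    (A' := {ψ | (ψ ∈ p.OmF (flU (insert v U)) ∧ p.el B ψ) ∧ ψ v = 0})
    (A'' := {ψ | ψ ∈ p.OmF (flU (insert v U)) ∧ p.el B ψ})
    (by
      intro ψ hψ hψ'
      have a := hψ.1 v hv
      have b := hψ'.2
      unfold flU at a
      rw [if_neg hvU] at a
      omega)
    (by
      intro ψ hψ
      refine ⟨fun u hu => ?_, hψ.2⟩
      have a := hψ.1 u hu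
      unfold flU at a ⊢
      by_cases h1 : u ∈ U
      · rw [if_pos h1] at a
        rw [if_pos (Finset.mem_insert_of_mem h1)]; exact a
      · rw [if_neg h1] at a
        split_ifs <;> omega)
    (fun ψ hψ => hψ.1)
  have h3 := p.Z_inj (A := {ψ | (ψ ∈ p.OmF (flU U) ∧ p.el B ψ) ∧ ∀ u ∈ blk v, ψ u = p.L})
    (A' := {ψ | (ψ ∈ p.OmF (flU (insert v U)) ∧ p.el B ψ) ∧ ψ v = 0})
    (fun ψ => Function.update ψ v 0)
    (by
      intro ψ hψ φ hφ he
      dsimp only at he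
      funext u
      by_cases hu : u = v
      · subst hu
        rw [hψ.1.2 u (mem_blk.2 (Or.inl rfl)), hφ.1.2 u (mem_blk.2 (Or.inl rfl))]
      · have := congrFun he u
        rwa [Function.update_of_ne hu, Function.update_of_ne hu] at this)
    (by
      intro ψ hψ hO
      refine ⟨⟨⟨?_, el_spike hB1 hψ.1.2 hψ.2 0⟩, Function.update_self _ _ _⟩, ?_, ?_⟩
      · intro u hu
        by_cases huv : u = v
        · subst huv
          rw [Function.update_self]
          unfold flU
          rw [if_pos (Finset.mem_insert_self _ _)]
        · rw [Function.update_of_ne huv]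
          have := hψ.1.1 u hu
          unfold flU at this ⊢
          simpa [Finset.mem_insert, huv] using this
      · intro x hx
        rw [Function.update_of_ne (show x ≠ v by rintro rfl; exact hx hv)]; exact hO.1 x hx
      · intro u hu
        by_cases huv : u = v
        · subst huv
          rw [Function.update_self]; omega
        · rw [Function.update_of_ne huv]; exact hO.2 u hu)
    (Real.exp (4 * p.β * (h + 1))) (Real.exp_pos _).le
    (by
      intro ψ hψ hO
      have := wt_spike hv (hψ.2 v (mem_blk.2 (Or.inl rfl)))
        (fun d hd => hψ.2 _ (mem_blk.2 (Or.inr (adjS_star (adjS_add hd))))) (h+1)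
      have e : p.L - ((h+1 : ℕ) : ℤ) = 0 := by rw [hL]; push_cast; ring
      rw [e] at this
      push_cast at this
      exact this)
  have hp : 0 < Real.exp (4 * p.β * (h + 1)) := Real.exp_pos _
  have h4 : 1/2 * Real.exp (-(4 * p.β * (h + 1))) * p.Z {ψ | ψ ∈ p.OmF (flU U) ∧ p.el B ψ} ≤
      p.Z {ψ | (ψ ∈ p.OmF (flU (insert v U)) ∧ p.el B ψ) ∧ ψ v = 0} := by
    rw [Real.exp_neg]
    have : p.Z {ψ | ψ ∈ p.OmF (flU U) ∧ p.el B ψ} ≤ 2 * (Real.exp (4 * p.β * (h + 1)) *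
      p.Z {ψ | (ψ ∈ p.OmF (flU (insert v U)) ∧ p.el B ψ) ∧ ψ v = 0}) := h1.trans (by gcongr)
    calc _ ≤ 1/2 * (Real.exp (4 * p.β * (h + 1)))⁻¹ * (2 * (Real.exp (4 * p.β * (h + 1)) *
      p.Z {ψ | (ψ ∈ p.OmF (flU (insert v U)) ∧ p.el B ψ) ∧ ψ v = 0})) := by gcongr
      _ = _ := by field_simp
  linarith

theorem exp_le_one_add {x : ℝ} (h0 : 0 ≤ x) (h1 : x ≤ 1) : Real.exp (x/2) ≤ 1 + x := by
  have h := Real.add_one_le_exp (-(x/2))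
  rw [Real.exp_neg] at h
  have hp := Real.exp_pos (x/2)
  have h2 : (-(x/2) + 1) * Real.exp (x/2) ≤ 1 := by
    calc _ ≤ (Real.exp (x/2))⁻¹ * Real.exp (x/2) := by gcongr
      _ = 1 := inv_mul_cancel₀ hp.ne'
  nlinarith

/-- Claim A, finite volume -/
theorem raise {h : ℕ} (hL : p.L = h + 1) {B : ℝ} (hB : p.lam * B ≤ 1) (hB1 : 1 ≤ B)
    (hsB : 4 * p.s ^ (h+1) * B ≤ 1) :
    Real.exp (1/4 * Real.exp (-(4 * p.β * (h + 1))) * p.V.card) *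
      p.Z {ψ | ψ ∈ p.OmF (fun _ => 1) ∧ p.el B ψ} ≤ p.Z {ψ | ψ ∈ p.OmF (fun _ => 0) ∧ p.el B ψ} := by
  set x := 1/2 * Real.exp (-(4 * p.β * (h + 1))) with hx
  have hx0 : 0 ≤ x := by positivity
  have hx1 : x ≤ 1 := by
    have : Real.exp (-(4 * p.β * (h + 1))) ≤ 1 := Real.exp_le_one_iff.2 (by
      have := p.hβ
      have : 0 ≤ 4 * p.β * (h + 1) := by positivity
      linarith)
    linarith
  have key : ∀ U ⊆ p.V, Real.exp (x/2 * U.card) * p.Z {ψ | ψ ∈ p.OmF (fun _ => 1) ∧ p.el B ψ} ≤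
      p.Z {ψ | ψ ∈ p.OmF (flU U) ∧ p.el B ψ} := by
    intro U
    induction U using Finset.induction_on with
    | empty =>
      intro _
      have : flU ∅ = fun _ => 1 := by funext u; simp [flU]
      rw [this]; simp
    | @insert v U hv ih =>
      intro hU
      have i1 := ih (fun u hu => hU (Finset.mem_insert_of_mem hu))
      have i2 := raise_step hL hB hB1 hsB (hU (Finset.mem_insert_self _ _)) hv
      refine le_trans ?_ i2
      rw [Finset.card_insert_of_notMem hv]
      have e : x/2 * ((U.card + 1 : ℕ) : ℝ) = x/2 + x/2 * U.card := by push_cast; ring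
      rw [e, Real.exp_add, mul_assoc]
      exact mul_le_mul (exp_le_one_add hx0 hx1) i1 (mul_nonneg (Real.exp_pos _).le (p.Z_nonneg _)) (by positivity)
  have h1 := key p.V (subset_refl _)
  have e : x/2 = 1/4 * Real.exp (-(4 * p.β * (h + 1))) := by rw [hx]; ring
  rw [e] at h1
  refine h1.trans (p.Z_mono fun ψ hψ _ => ⟨fun u hu => ?_, hψ.2⟩)
  have := hψ.1 u hu
  unfold flU at this
  rwa [if_pos hu] at this

/-- Claim B, finite volume -/
theorem lower {h : ℕ} (hL : p.L = h + 1) {B : ℝ} (hB : p.lam * B ≤ 1) :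
    p.Z {ψ | ψ ∈ p.OmF (fun _ => 0) ∧ p.el B ψ} ≤ Real.exp (4 * p.s ^ (h+1) * p.V.card) *
      p.Z {ψ | ψ ∈ p.OmF (fun _ => 1) ∧ p.el B ψ} := by
  refine ((p.low_RC (B := B) (fl := fun _ => 0)).seq hB (h+1) (by omega) (fun _ => 0) p.V (subset_refl _) (by
    intro u _; rw [hL]; push_cast; omega)).trans ?_
  refine mul_le_mul_of_nonneg_left (p.Z_mono ?_) (Real.exp_pos _).le
  rintro ψ ⟨hψ, h0⟩ _
  exact ⟨fun u hu => h0 u hu, hψ.2⟩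

theorem const_mem (B : ℝ) (hL : 0 ≤ p.L) : 0 < p.Z {ψ | ψ ∈ p.OmF (fun _ => 0) ∧ p.el B ψ} := by
  refine p.Z_pos (ψ := fun _ => p.L) ⟨fun _ _ => hL, fun v _ h => absurd rfl h⟩ ⟨fun _ _ => rfl, fun _ _ => ?_⟩
  show -1 ≤ p.L
  omega

theorem Zel_eq (h : ℤ) (hL : p.L = h) : Zel p.β p.lam (fun _ => BSign.free) h (box p.n) =
    p.Z {ψ | ψ ∈ p.OmF (fun _ => 0) ∧ p.el (elemBound p.β p.lam h) ψ} := by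
  subst hL
  unfold Zel Z
  have : signedConfigs (box p.n) (fun _ => BSign.free) p.L ∩ {ψ | allOuterElem p.β p.lam p.L (box p.n) ψ} =
      {ψ | ψ ∈ p.OmF (fun _ => 0) ∧ p.el (elemBound p.β p.lam p.L) ψ} ∩ p.Om := by
    ext ψ
    constructor
    · rintro ⟨⟨h1, h2, _⟩, h4⟩
      exact ⟨⟨h2, h4⟩, h1, fun v hv => by have := h2 v hv; omega⟩
    · rintro ⟨⟨h2, h4⟩, h1, _⟩
      exact ⟨⟨h1, h2, fun _ _ => trivial⟩, h4⟩
  rw [this]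
  rfl

end Par
end

open scoped BigOperators
open Filter

noncomputable section
attribute [local instance] Classical.propDecidable

theorem sixteen_exp : (16:ℝ) ≤ Real.exp 8 := by
  have h := Real.add_one_le_exp (4:ℝ)
  have : Real.exp 8 = Real.exp 4 * Real.exp 4 := by rw [← Real.exp_add]; norm_num
  rw [this]; nlinarith

theorem box_card_pos (n : ℕ) : (0:ℝ) < ((box n).card : ℝ) := by
  have : (0, 0) ∈ box n := by
    unfold box
    rw [Finset.mem_product, Finset.mem_Icc]
    dsimp only
    omega
  exact_mod_cast Finset.card_pos.2 ⟨_, this⟩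

theorem elemBound_mul {β lam : ℝ} (hl : 0 < lam) (h : ℤ) : lam * elemBound β lam h ≤ 1 := by
  calc lam * elemBound β lam h ≤ lam * (1 / lam) := by gcongr; exact min_le_left _ _
    _ = 1 := by field_simp

theorem elemBound_one {β lam : ℝ} (hβ : 0 ≤ β) (hl : 0 < lam) (hl1 : lam ≤ 1) (h : ℕ) :
    1 ≤ elemBound β lam (h : ℤ) := by
  refine le_min ?_ (Real.one_le_exp (by push_cast; positivity))
  rw [le_div_iff₀ hl]; linarith

theorem elemBound_mono {β lam : ℝ} (hβ : 0 ≤ β) {h k : ℤ} (hk : h ≤ k) :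
    elemBound β lam h ≤ elemBound β lam k := by
  have : (h:ℝ) ≤ k := by exact_mod_cast hk
  unfold elemBound
  gcongr

theorem s_pow (p : Par) (k : ℕ) : p.s ^ k = Real.exp (k * (-4 * p.β + p.lam)) := by
  unfold Par.s
  rw [Real.exp_nat_mul]

theorem s_elemBound (p : Par) (h : ℕ) : 4 * p.s ^ (h+1) * elemBound p.β p.lam (h : ℤ) ≤ 1 := by
  have hβ := p.hβ
  have hl1 := p.lam_le_one
  have hs := p.s_pos
  calc 4 * p.s ^ (h+1) * elemBound p.β p.lam (h : ℤ)
      ≤ 4 * p.s ^ (h+1) * Real.exp (3 * p.β * ((h : ℝ) + 1)) := by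
        gcongr
        refine (min_le_right _ _).trans (le_of_eq ?_)
        push_cast; rfl
    _ = 4 * Real.exp (((h+1 : ℕ) : ℝ) * (-4 * p.β + p.lam) + 3 * p.β * ((h : ℝ) + 1)) := by
        rw [s_pow, Real.exp_add]; ring
    _ ≤ 4 * Real.exp (-4) := by
        gcongr
        push_cast
        have : (0:ℝ) ≤ h := by positivity
        nlinarith
    _ ≤ 1 := Par.four_exp

theorem Zel_pos (p : Par) (h : ℕ) (hL : p.L = (h:ℤ)) :
    0 < Zel p.β p.lam (fun _ => BSign.free) (h:ℤ) (box p.n) := by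
  rw [Par.Zel_eq _ hL]
  exact Par.const_mem _ (by omega)

theorem Zel_sh (p : Par) (h : ℕ) (hL : p.L = (h:ℤ) + 1) :
    Zel p.β p.lam (fun _ => BSign.free) (h:ℤ) (box p.n) = Real.exp (p.lam * p.V.card) *
      p.Z {ψ | ψ ∈ p.OmF (fun _ => 1) ∧ p.el (elemBound p.β p.lam (h:ℤ)) ψ} := by
  rw [← p.shift]
  exact Par.Zel_eq (p := p.sh) (h:ℤ) (show p.L - 1 = h by omega)

theorem finA (p : Par) (h : ℕ) (hL : p.L = (h:ℤ) + 1) :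
    Real.exp ((1/4 * Real.exp (-(4 * p.β * (h + 1))) - p.lam) * (box p.n).card) *
      Zel p.β p.lam (fun _ => BSign.free) (h:ℤ) (box p.n) ≤
      Zel p.β p.lam (fun _ => BSign.free) ((h+1 : ℕ):ℤ) (box p.n) := by
  have hβ := p.hβ
  rw [Zel_sh p h hL, Par.Zel_eq (p := p) ((h+1:ℕ):ℤ) (by rw [hL]; push_cast; rfl)]
  have h1 := Par.raise (p := p) hL (elemBound_mul p.hl (β := p.β) (h:ℤ))
    (elemBound_one (by linarith) p.hl p.lam_le_one h) (s_elemBound p h)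
  rw [← mul_assoc, ← Real.exp_add]
  have e : (1/4 * Real.exp (-(4 * p.β * (h + 1))) - p.lam) * (box p.n).card + p.lam * p.V.card =
      1/4 * Real.exp (-(4 * p.β * (h + 1))) * p.V.card := by
    show _ + p.lam * (box p.n).card = _ * ((box p.n).card : ℝ)
    ring
  rw [e]
  refine h1.trans (p.Z_mono fun ψ hψ _ => ⟨hψ.1, fun v hv hne => small_mono ?_ (hψ.2 v hv hne)⟩)
  exact elemBound_mono (by linarith) (by push_cast; omega)

theorem finB (p : Par) (h i : ℕ) (hL : p.L = (h:ℤ) + 1) (hi : i ≤ h)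
    (hlo : Real.exp (-4 * p.β * (i : ℝ) - 2 * p.β) ≤ p.lam)
    (hup : p.lam ≤ Real.exp (-4 * p.β * (i : ℝ) - p.β)) :
    Real.exp (p.lam / 2 * (box p.n).card) *
      Zel p.β p.lam (fun _ => BSign.free) ((h+1 : ℕ):ℤ) (box p.n) ≤
      Zel p.β p.lam (fun _ => BSign.free) (h:ℤ) (box p.n) := by
  have hβ := p.hβ
  have hl := p.hl
  have hih : (i:ℝ) ≤ h := by exact_mod_cast hi
  have hi0 : (0:ℝ) ≤ i := by positivity
  rw [Zel_sh p h hL, Par.Zel_eq (p := p) ((h+1:ℕ):ℤ) (by rw [hL]; push_cast; rfl)]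
  have h16 := sixteen_exp
  have h1 : 4 * p.s ^ (h+1) ≤ p.lam / 4 := by
    have hli : p.lam * (i + 1) ≤ 1 := by
      calc p.lam * (i + 1) ≤ Real.exp (-4 * p.β * (i : ℝ) - p.β) * Real.exp i := by
            gcongr; linarith [Real.add_one_le_exp (i:ℝ)]
        _ = Real.exp (-4 * p.β * (i : ℝ) - p.β + i) := by rw [Real.exp_add]
        _ ≤ 1 := Real.exp_le_one_iff.2 (by nlinarith)
    have h2 : p.s ^ (h+1) ≤ Real.exp (-4 * p.β * (i : ℝ) - 2 * p.β - 8) := by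
      rw [s_pow]
      apply Real.exp_le_exp.2
      push_cast
      have := p.lam_le_one
      nlinarith
    have h3 : 16 * Real.exp (-4 * p.β * (i : ℝ) - 2 * p.β - 8) ≤ p.lam := by
      refine le_trans ?_ hlo
      calc _ ≤ Real.exp 8 * Real.exp (-4 * p.β * (i : ℝ) - 2 * p.β - 8) := by gcongr
        _ = _ := by rw [← Real.exp_add]; ring_nf
    linarith
  have h2 : p.Z {ψ | ψ ∈ p.OmF (fun _ => 0) ∧ p.el (elemBound p.β p.lam ((h+1:ℕ):ℤ)) ψ} ≤
      Real.exp (p.lam / 4 * p.V.card) *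
        p.Z {ψ | ψ ∈ p.OmF (fun _ => 0) ∧ p.el (elemBound p.β p.lam (h:ℤ)) ψ} := by
    rcases le_or_gt (1 / p.lam) (Real.exp (3 * p.β * ((h:ℝ) + 1))) with hc | hc
    · have e1 : elemBound p.β p.lam (h:ℤ) = 1 / p.lam := by
        unfold elemBound
        exact min_eq_left (by push_cast; exact hc)
      have e2 : elemBound p.β p.lam ((h+1:ℕ):ℤ) = 1 / p.lam := by
        refine le_antisymm (min_le_left _ _) ?_
        rw [← e1]
        exact elemBound_mono (by linarith) (by push_cast; omega)
      rw [e1, e2]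
      refine le_mul_of_one_le_left (p.Z_nonneg _) (Real.one_le_exp (by positivity))
    · have e1 : elemBound p.β p.lam (h:ℤ) = Real.exp (3 * p.β * ((h:ℝ) + 1)) := by
        unfold elemBound
        push_cast
        exact min_eq_right hc.le
      set n0 := ⌊elemBound p.β p.lam (h:ℤ)⌋₊ with hn0
      have hB1 := elemBound_one (β := p.β) (by linarith) p.hl p.lam_le_one h
      have hn1 : 1 ≤ n0 := Nat.le_floor (by exact_mod_cast hB1)
      have h3 := Par.shrink (p := p) (fl := fun _ => 0) (a := h+1) (B' := elemBound p.β p.lam ((h+1:ℕ):ℤ))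
        (B := elemBound p.β p.lam (h:ℤ)) (elemBound_mul p.hl _) (s_elemBound p (h+1))
        (fun _ _ => le_rfl) (fun _ _ => by rw [hL]; push_cast; omega) n0 hn1 (Nat.floor_le (by linarith))
      have h4 : 3 * p.β * ((h:ℝ) + 1) ≤ n0 := by
        have a := Nat.lt_floor_add_one (elemBound p.β p.lam (h:ℤ))
        have b := Real.add_one_le_exp (3 * p.β * ((h:ℝ) + 1))
        rw [← hn0] at a
        rw [← e1] at b
        linarith
      have h5 : 4 * Real.exp (-((p.β - 18) * n0)) ≤ p.lam / 4 := by
        have h6 : 16 * Real.exp (-((p.β - 18) * n0)) ≤ p.lam := by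
          refine le_trans ?_ hlo
          calc _ ≤ Real.exp 8 * Real.exp (-((p.β - 18) * n0)) := by gcongr
            _ = Real.exp (8 + -((p.β - 18) * n0)) := by rw [← Real.exp_add]
            _ ≤ _ := by
              apply Real.exp_le_exp.2
              have h7 : (82:ℝ) * (3 * p.β * ((h:ℝ) + 1)) ≤ (p.β - 18) * n0 := by
                have : (0:ℝ) ≤ n0 := by positivity
                nlinarith
              nlinarith
        linarith
      refine h3.trans (mul_le_mul_of_nonneg_right ?_ (p.Z_nonneg _))
      gcongr
  have h3 := Par.lower (p := p) hL (elemBound_mul p.hl (β := p.β) (h:ℤ))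
  set Z1 := p.Z {ψ | ψ ∈ p.OmF (fun _ => 1) ∧ p.el (elemBound p.β p.lam (h:ℤ)) ψ}
  have hZ1 : 0 ≤ Z1 := p.Z_nonneg _
  have hV : (box p.n).card = p.V.card := rfl
  rw [hV]
  calc _ ≤ Real.exp (p.lam / 2 * p.V.card) * (Real.exp (p.lam / 4 * p.V.card) *
        (Real.exp (4 * p.s ^ (h+1) * p.V.card) * Z1)) := by
          gcongr
          exact h2.trans (by gcongr)
    _ ≤ Real.exp (p.lam / 2 * p.V.card) * (Real.exp (p.lam / 4 * p.V.card) *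
        (Real.exp (p.lam / 4 * p.V.card) * Z1)) := by gcongr
    _ = _ := by
      rw [← mul_assoc, ← mul_assoc, ← Real.exp_add, ← Real.exp_add]
      congr 2; ring

theorem lim_gap {u v : ℕ → ℝ} {a b c : ℝ} (hu : ∀ n, 0 < u n)
    (h : ∀ n, Real.exp (c * (box n).card) * u n ≤ v n)
    (ha : Tendsto (fun n => Real.log (u n) / ((box n).card : ℝ)) atTop (nhds a))
    (hb : Tendsto (fun n => Real.log (v n) / ((box n).card : ℝ)) atTop (nhds b)) : c ≤ b - a := by
  refine ge_of_tendsto (hb.sub ha) (Eventually.of_forall fun n => ?_)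
  have hp := box_card_pos n
  rw [← sub_div, le_div_iff₀ hp]
  have h1 := Real.log_le_log (mul_pos (Real.exp_pos _) (hu n)) (h n)
  rw [Real.log_mul (Real.exp_pos _).ne' (hu n).ne', Real.log_exp] at h1
  linarith


end


/-- free-energy gaps in the windows `I_i`. Let
`I_i = [e^{-4βi-2β}, e^{-4βi-β}]`. There is an absolute `β₀` such that for `β > β₀`:
if `λ ∈ I_i` then for every `j ≠ i` the elementary free energies (characterized as the
infinite-volume limits of `|Λ_n|⁻¹ log Z^el`) satisfy
`f^el_i - f^el_j ≥ e^{-4β min(i, j+1) - 3β}`. -/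
theorem statement9 :
    ∃ β₀ : ℝ, ∀ β : ℝ, β₀ < β → ∀ lam : ℝ, ∀ i : ℕ,
      Real.exp (-4 * β * (i : ℝ) - 2 * β) ≤ lam →
      lam ≤ Real.exp (-4 * β * (i : ℝ) - β) →
      ∀ fel : ℕ → ℝ,
        (∀ r : ℕ, ∀ η : Site → BSign,
          Tendsto (fun n => Real.log (Zel β lam η (r : ℤ) (box n)) / ((box n).card : ℝ))
            atTop (nhds (fel r))) →
        ∀ j : ℕ, j ≠ i →
          Real.exp (-4 * β * (min i (j + 1) : ℝ) - 3 * β) ≤ fel i - fel j := by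
  refine ⟨100, fun β hβ lam i hlo hup fel hfel j hj => ?_⟩
  have hl : 0 < lam := (Real.exp_pos _).trans_le hlo
  have hi0 : (0:ℝ) ≤ i := by positivity
  have hl1 : lam ≤ Real.exp (-β) := hup.trans (Real.exp_le_exp.2 (by nlinarith))
  have hA : ∀ h : ℕ, 1/4 * Real.exp (-(4 * β * (h + 1))) - lam ≤ fel (h+1) - fel h := by
    intro h
    refine lim_gap (fun n => ?_) (fun n => ?_) (hfel h (fun _ => BSign.free)) (hfel (h+1) (fun _ => BSign.free))
    · exact Zel_pos ⟨β, lam, n, h, hβ.le, hl, hl1⟩ h rfl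
    · exact finA ⟨β, lam, n, (h:ℤ)+1, hβ.le, hl, hl1⟩ h rfl
  have hB : ∀ h : ℕ, i ≤ h → lam / 2 ≤ fel h - fel (h+1) := by
    intro h hi
    refine lim_gap (fun n => ?_) (fun n => ?_) (hfel (h+1) (fun _ => BSign.free)) (hfel h (fun _ => BSign.free))
    · exact Zel_pos ⟨β, lam, n, ((h+1:ℕ):ℤ), hβ.le, hl, hl1⟩ (h+1) rfl
    · exact finB ⟨β, lam, n, (h:ℤ)+1, hβ.le, hl, hl1⟩ h i rfl hi hlo hup
  have h8 : Real.exp (-β) ≤ 1/8 := by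
    rw [Real.exp_neg, inv_le_comm₀ (Real.exp_pos _) (by norm_num)]
    have := Real.add_one_le_exp β
    norm_num
    linarith
  have hA2 : ∀ h : ℕ, h < i → Real.exp (-4 * β * ((h:ℝ) + 1) - 3 * β) ≤ fel (h+1) - fel h := by
    intro h hh
    have hh' : (h:ℝ) + 1 ≤ i := by exact_mod_cast hh
    have e1 : lam ≤ Real.exp (-(4 * β * (h + 1))) * Real.exp (-β) := by
      rw [← Real.exp_add]
      exact hup.trans (Real.exp_le_exp.2 (by nlinarith))
    have e2 : Real.exp (-4 * β * ((h:ℝ) + 1) - 3 * β) ≤ Real.exp (-(4 * β * (h + 1))) * Real.exp (-β) := by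
      rw [← Real.exp_add]
      exact Real.exp_le_exp.2 (by nlinarith)
    have e3 := hA h
    have e4 : Real.exp (-(4 * β * ((h:ℝ) + 1))) * Real.exp (-β) ≤ Real.exp (-(4 * β * (h + 1))) * (1/8) := by
      gcongr
    linarith
  rcases lt_or_gt_of_ne hj with hlt | hgt
  · have hmin : min (i:ℝ) ((j:ℝ) + 1) = (j:ℝ) + 1 := min_eq_right (by exact_mod_cast hlt)
    rw [hmin]
    have key : ∀ k, j + 1 ≤ k → k ≤ i → fel (j+1) ≤ fel k := by
      intro k hk
      induction k, hk using Nat.le_induction with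
      | base => intro _; exact le_rfl
      | succ k _ ih =>
        intro hki
        have := hA2 k (by omega)
        have := Real.exp_pos (-4 * β * ((k:ℝ) + 1) - 3 * β)
        linarith [ih (by omega)]
    linarith [key i hlt le_rfl, hA2 j hlt]
  · have hji : (i:ℝ) ≤ (j:ℝ) := by exact_mod_cast hgt.le
    have hmin : min (i:ℝ) ((j:ℝ) + 1) = i := min_eq_left (by linarith)
    rw [hmin]
    have key : ∀ k, i + 1 ≤ k → fel k ≤ fel (i+1) := by
      intro k hk
      induction k, hk using Nat.le_induction with
      | base => exact le_rfl
      | succ k hk ih =>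
        have := hB k (by omega)
        linarith
    have e1 : Real.exp (-4 * β * (i:ℝ) - 3 * β) ≤ lam * Real.exp (-β) := by
      calc _ = Real.exp (-4 * β * (i:ℝ) - 2 * β) * Real.exp (-β) := by rw [← Real.exp_add]; ring_nf
        _ ≤ _ := by gcongr
    have e2 : lam * Real.exp (-β) ≤ lam * (1/8) := by gcongr
    linarith [key j hgt, hB i le_rfl]
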